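/- Identify the vertices of a convex $n$-gon with $\{1,\dots,n\}$. Two disjoint pairs $\{i,j\}$, $\{k,l\}$ with $i<j$, $k<l$ \emph{cross} if $i<k<j<l$ or $k<i<l<j$; a \emph{$2$-triangulation} of the $n$-gon is an inclusion-maximal set of pairs of distinct vertices containing no three pairwise crossing pairs. The \emph{length} of a pair $\{i,j\}$ is $\min\{|i-j|,\,n-|i-j|\}$; a pair is \emph{relevant} if its length is at least $3$ and \emph{short} otherwise. (Short pairs lie in every $2$-triangulation. The $2$-associahedron of the $n$-gon is the simplicial complex on the relevant pairs whose facets are the sets $T^{\mathrm{rel}}$ of relevant pairs of the $2$-triangulations $T$.) For $p_1,\dots,p_n\in\mathbb{R}^4$ let $R(p_1,\dots,p_n)$ be the bar-and-joint rigidity matrix: it has one row for each pair $\{i,j\}$ and $n$ blocks of $4$ columns, and the row of $\{i,j\}$ has $p_i-p_j$ in block $i$, $p_j-p_i$ in block $j$, and zeros elsewhere. Fix $n\ge 5$. Suppose that for every choice of reals $t_1<\dots<t_n$ and every $2$-triangulation $T$ of the $n$-gon, the rows of $R(p_1,\dots,p_n)$ indexed by $T$ are linearly independent, where $p_i=(t_i,t_i^2,t_i^3,t_i^4)$.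 Then for every choice of reals $t_1<\dots<t_n$, the rows $v_e$ of $R(p_1,\dots,p_n)$ realize the $2$-associahedron of the $n$-gon as a complete simplicial fan. That is: for every $2$-triangulation $T$ the vectors $v_e$, $e\in T$, are linearly independent, and, writing $\bar v_e$ for the image of $v_e$ in the quotient of $\mathbb{R}^{4n}$ by the linear span of $\{v_f : f \text{ short}\}$ and $\operatorname{cone}(S)$ for the set of nonnegative linear combinations of $\{\bar v_e : e\in S\}$, (a) for every $2$-triangulation $T$ the vectors $\bar v_e$, $e\in T^{\mathrm{rel}}$, are linearly independent; (b) for any two $2$-triangulations $T,T'$ one has $\operatorname{cone}(T^{\mathrm{rel}})\cap\operatorname{cone}(T'^{\,\mathrm{rel}})=\operatorname{cone}(T^{\mathrm{rel}}\cap T'^{\,\mathrm{rel}})$; (c) the union of the cones $\operatorname{cone}(T^{\mathrm{rel}})$ over all $2$-triangulations $T$ equals the linear span of $\{\bar v_e : e \text{ relevant}\}$. -/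

import Mathlib

open scoped BigOperators

/-- A pair `{i,j}` of distinct vertices of the `n`-gon.  Vertices `1,…,n` are represented by
`Fin n` (vertex `i` corresponds to `i-1 : Fin n`), and a pair is recorded with its endpoints
in increasing order. -/
abbrev Pair (n : ℕ) := {p : Fin n × Fin n // p.1 < p.2}

/-- Two pairs `{i,j}` (`i<j`) and `{k,l}` (`k<l`) cross if `i<k<j<l` or `k<i<l<j`. -/
def Cross {n : ℕ} (e f : Pair n) : Prop :=
  (e.val.1 < f.val.1 ∧ f.val.1 < e.val.2 ∧ e.val.2 < f.val.2) ∨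
  (f.val.1 < e.val.1 ∧ e.val.1 < f.val.2 ∧ f.val.2 < e.val.2)

/-- A set of pairs is `(k+1)`-crossing-free if it contains no `k+1` pairwise crossing pairs. -/
def CrossingFree (n k : ℕ) (S : Set (Pair n)) : Prop :=
  ¬ ∃ C : Finset (Pair n), ↑C ⊆ S ∧ C.card = k + 1 ∧
      ∀ e ∈ C, ∀ f ∈ C, e ≠ f → Cross e f

/-- A `k`-triangulation of the `n`-gon: an inclusion-maximal `(k+1)`-crossing-free set. -/
def IsTriangulation (n k : ℕ) (T : Set (Pair n)) : Prop :=
  CrossingFree n k T ∧ ∀ S : Set (Pair n), CrossingFree n k S → T ⊆ S → S = T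

/-- The length of a pair `{i,j}`, `i<j`, in the `n`-gon: `min (j-i) (n-(j-i))`. -/
def pairLen {n : ℕ} (e : Pair n) : ℕ :=
  min ((e.val.2 : ℕ) - (e.val.1 : ℕ)) (n - ((e.val.2 : ℕ) - (e.val.1 : ℕ)))

/-- The `k`-relevant pairs: those of length at least `k+1`. -/
def relevantPairs (n k : ℕ) : Set (Pair n) := {e | k + 1 ≤ pairLen e}

/-- The pairs of length at most `k`; they lie in every `k`-triangulation of the `n`-gon. -/
def shortPairs (n k : ℕ) : Set (Pair n) := {e | pairLen e ≤ k}

/-- The facets of the (reduced) `k`-associahedron of the `n`-gon: the sets of relevant pairs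
of the `k`-triangulations. -/
def IsFacet (n k : ℕ) (F : Set (Pair n)) : Prop :=
  ∃ T : Set (Pair n), IsTriangulation n k T ∧ F = T ∩ relevantPairs n k

/-- Row of the bar-and-joint rigidity matrix `R(p)` indexed by the pair `e`:
`p_i - p_j` in block `i`, `p_j - p_i` in block `j`, zeros elsewhere. -/
def bjRow {n d : ℕ} (p : Fin n → Fin d → ℝ) (e : Pair n) : Fin n × Fin d → ℝ :=
  fun ma =>
    if ma.1 = e.val.1 then p e.val.1 ma.2 - p e.val.2 ma.2
    else if ma.1 = e.val.2 then p e.val.2 ma.2 - p e.val.1 ma.2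
    else 0

/-- The point `(t, t², …, t^d)` of the moment curve in `ℝ^d`. -/
def momentPoint (d : ℕ) (t : ℝ) : Fin d → ℝ := fun a => t ^ ((a : ℕ) + 1)

/-- The cone of all nonnegative linear combinations of `{w e : e ∈ S}`. -/
def coneOf {n : ℕ} {V : Type*} [AddCommGroup V] [Module ℝ V]
    (w : Pair n → V) (S : Set (Pair n)) : Set V :=
  {x | ∃ c : Pair n → ℝ, (∀ e, 0 ≤ c e) ∧ (∀ e, c e ≠ 0 → e ∈ S) ∧ x = ∑ e, c e • w e}

/-- The vectors `w e`, for `e` relevant, form a complete simplicial fan with the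
combinatorics of the reduced `k`-associahedron of the `n`-gon:
the vectors of every facet are linearly independent, the cones of two facets intersect in the
cone of the common face, and the cones of the facets cover the linear span of the vectors. -/
structure IsAssociahedronFan (n k : ℕ) {V : Type*} [AddCommGroup V] [Module ℝ V]
    (w : Pair n → V) : Prop where
  linearIndependent : ∀ F : Set (Pair n), IsFacet n k F →
    LinearIndependent ℝ (fun e : F => w e.val)
  inter : ∀ F F' : Set (Pair n), IsFacet n k F → IsFacet n k F' →
    coneOf w F ∩ coneOf w F' = coneOf w (F ∩ F')
  complete : (⋃ F ∈ {F : Set (Pair n) | IsFacet n k F}, coneOf w F) =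
    (Submodule.span ℝ (w '' relevantPairs n k) : Set V)

/-- The images of the vectors `v e` in the quotient by the span of the vectors of the short
pairs, i.e. the contraction of the configuration at the short pairs. -/
def contraction (n k : ℕ) {V : Type*} [AddCommGroup V] [Module ℝ V] (v : Pair n → V) :
    Pair n → V ⧸ Submodule.span ℝ (v '' shortPairs n k) :=
  fun e => Submodule.Quotient.mk (v e)

/-- The vectors `(v e)` realize the `k`-associahedron of the `n`-gon as a complete simplicial
fan: the vectors of every `k`-triangulation (short pairs included) are linearly independent,
and contracting the short pairs, which lie in every `k`-triangulation, yields a complete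
simplicial fan for the reduced complex. -/
structure RealizesFan (n k : ℕ) {V : Type*} [AddCommGroup V] [Module ℝ V]
    (v : Pair n → V) : Prop where
  linearIndependent : ∀ T : Set (Pair n), IsTriangulation n k T →
    LinearIndependent ℝ (fun e : T => v e.val)
  fan : IsAssociahedronFan n k (contraction n k v)

namespace FlipFan

open Filter Topology

variable {E V : Type*} [Fintype E] [AddCommGroup V] [Module ℝ V]

/-- The linear combination of the vectors `w e` with coefficients `y e`. -/
def comb (w : E → V) (y : E → ℝ) : V := ∑ e, y e • w e

lemma comb_add (w : E → V) (y z : E → ℝ) : comb w (y + z) = comb w y + comb w z := by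
  simp [comb, add_smul, Finset.sum_add_distrib]

lemma comb_smul (w : E → V) (a : ℝ) (y : E → ℝ) : comb w (a • y) = a • comb w y := by
  simp [comb, mul_smul, Finset.smul_sum]

lemma comb_sub (w : E → V) (y z : E → ℝ) : comb w (y - z) = comb w y - comb w z := by
  simp [comb, sub_smul, Finset.sum_sub_distrib]

lemma comb_single [DecidableEq E] (w : E → V) (e : E) : comb w (Pi.single e 1) = w e := by
  simp [comb, Pi.single_apply, ite_smul]

/-- The vectors indexed by `T` form a basis of the span of all the vectors. -/
structure IsFrame (w : E → V) (T : Set E) : Prop where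
  indep : ∀ z : E → ℝ, (∀ e, e ∉ T → z e = 0) → comb w z = 0 → z = 0
  span : ∀ y : E → ℝ, ∃ z : E → ℝ, (∀ e, e ∉ T → z e = 0) ∧ comb w z = comb w y

open Classical in
/-- The coordinates of the point `comb w y` with respect to the vectors indexed by `T`. -/
noncomputable def coord (w : E → V) (T : Set E) (y : E → ℝ) : E → ℝ :=
  if h : ∃ z : E → ℝ, (∀ e, e ∉ T → z e = 0) ∧ comb w z = comb w y then h.choose else 0

namespace IsFrame

variable {w : E → V} {T : Set E}

lemma coord_supp (h : IsFrame w T) (y : E → ℝ) {e : E} (he : e ∉ T) : coord w T y e = 0 := by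
  rw [coord, dif_pos (h.span y)]
  exact (h.span y).choose_spec.1 e he

lemma comb_coord (h : IsFrame w T) (y : E → ℝ) : comb w (coord w T y) = comb w y := by
  rw [coord, dif_pos (h.span y)]
  exact (h.span y).choose_spec.2

lemma coord_unique (h : IsFrame w T) {y z : E → ℝ} (hz : ∀ e, e ∉ T → z e = 0)
    (hc : comb w z = comb w y) :
    coord w T y = z := by
  rw [← sub_eq_zero]
  refine h.indep _ (fun e he => ?_) ?_
  · simp [h.coord_supp y he, hz e he]
  · rw [comb_sub, h.comb_coord, hc, sub_self]

lemma coord_self (h : IsFrame w T) {y : E → ℝ} (hy : ∀ e, e ∉ T → y e = 0) : coord w T y = y :=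
  h.coord_unique hy rfl

lemma coord_add (h : IsFrame w T) (y z : E → ℝ) : coord w T
    (y + z) = coord w T y + coord w T z := by
  refine h.coord_unique (fun e he => ?_) ?_
  · simp [h.coord_supp _ he]
  · simp [comb_add, h.comb_coord]

lemma coord_smul (h : IsFrame w T) (a : ℝ) (y : E → ℝ) : coord w T (a • y) = a • coord w T y := by
  refine h.coord_unique (fun e he => ?_) ?_
  · simp [h.coord_supp _ he]
  · simp [comb_smul, h.comb_coord]

end IsFrame

/-- A family of facets `𝓕` on the vectors `w`, all containing the set `S` of lineality vectors:
every facet is a basis, every vector of a facet outside `S` can be exchanged, and the two vectors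
of an exchange lie on opposite sides of the common wall. -/
structure FlipSystem (w : E → V) (S : Set E) (𝓕 : Set (Set E)) : Prop where
  sub : ∀ T ∈ 𝓕, S ⊆ T
  frame : ∀ T ∈ 𝓕, IsFrame w T
  flip : ∀ T ∈ 𝓕, ∀ e ∈ T, e ∉ S → ∃ e', e' ∉ T ∧ insert e' (T \ {e}) ∈ 𝓕
  sign : ∀ T ∈ 𝓕, ∀ e ∈ T, e ∉ S → ∀ e', e' ∉ T → insert e' (T \ {e}) ∈ 𝓕 →
    ∀ z : E → ℝ, (∀ f, f ∉ T → z f = 0) → comb w z = w e' → z e < 0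

/-- The point `comb w y` lies in the relative interior of the cone of `T`, modulo `S`. -/
def Inside (w : E → V) (S : Set E) (y : E → ℝ) (T : Set E) : Prop :=
  ∀ e ∈ T, e ∉ S → 0 < coord w T y e

/-- The point `comb w y` lies on no wall. -/
def Generic (w : E → V) (S : Set E) (𝓕 : Set (Set E)) (y : E → ℝ) : Prop :=
  ∀ T ∈ 𝓕, ∀ e ∈ T, e ∉ S → coord w T y e ≠ 0

/-- The interiors of the cones of two different facets are disjoint. -/
def NoOverlap (w : E → V) (S : Set E) (𝓕 : Set (Set E)) : Prop :=
  ∀ T₁ ∈ 𝓕, ∀ T₂ ∈ 𝓕, ∀ y, Inside w S y T₁ → Inside w S y T₂ → T₁ = T₂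

/-- Some point in the interior of the cone of a facet lies in no other cone. -/
def HasSimplePoint (w : E → V) (S : Set E) (𝓕 : Set (Set E)) : Prop :=
  ∃ T₀ ∈ 𝓕, ∃ y : E → ℝ, (∀ e, e ∉ T₀ → y e = 0) ∧ (∀ e ∈ T₀, e ∉ S → 0 < y e) ∧
    ∀ T ∈ 𝓕, ∀ z : E → ℝ, (∀ e, e ∉ T → z e = 0) → (∀ e, e ∉ S → 0 ≤ z e) →
      comb w z = comb w y → T = T₀

/-- Lexicographic positivity of a pair of reals. -/
def LexPos (a b : ℝ) : Prop := 0 < a ∨ (a = 0 ∧ 0 < b)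

/-- The facets whose cone contains the points of the ray starting at `y` in direction `d`
close to `y`. -/
def germFacets (w : E → V) (S : Set E) (𝓕 : Set (Set E)) (y d : E → ℝ) :
    Set (Set E) :=
  {T ∈ 𝓕 | ∀ e ∈ T, e ∉ S → LexPos (coord w T y e) (coord w T d e)}

lemma eventually_lexPos_right (s a b : ℝ) :
    ∀ᶠ r in 𝓝[>] s, (LexPos (a + (r - s) * b) b ↔ LexPos a b) := by
  have hc : Tendsto (fun r : ℝ => a + (r - s) * b) (𝓝[>] s) (𝓝 a) := by
    have : Continuous (fun r : ℝ => a + (r - s) * b) := by fun_prop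
    simpa using (this.tendsto s).mono_left nhdsWithin_le_nhds
  rcases lt_trichotomy a 0 with ha | ha | ha
  · filter_upwards [hc.eventually (gt_mem_nhds ha)] with r hr
    constructor
    · rintro (h | ⟨h, _⟩) <;> linarith
    · rintro (h | ⟨h, _⟩) <;> linarith
  · filter_upwards [self_mem_nhdsWithin] with r hr
    have hr' : 0 < r - s := sub_pos.2 hr
    subst ha
    constructor
    · rintro (h | h)
      · exact Or.inr ⟨rfl, by simpa [hr'] using h⟩
      · exact Or.inr ⟨rfl, h.2⟩
    · rintro (h | h)
      · exact absurd h (lt_irrefl _)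
      · exact Or.inl (by simpa [hr'] using h.2)
  · filter_upwards [hc.eventually (lt_mem_nhds ha)] with r hr
    exact ⟨fun _ => Or.inl ha, fun _ => Or.inl hr⟩

lemma eventually_lexPos_left (s a b : ℝ) :
    ∀ᶠ r in 𝓝[<] s, (LexPos (a + (r - s) * b) b ↔ LexPos a (-b)) := by
  have hc : Tendsto (fun r : ℝ => a + (r - s) * b) (𝓝[<] s) (𝓝 a) := by
    have : Continuous (fun r : ℝ => a + (r - s) * b) := by fun_prop
    simpa using (this.tendsto s).mono_left nhdsWithin_le_nhds
  rcases lt_trichotomy a 0 with ha | ha | ha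
  · filter_upwards [hc.eventually (gt_mem_nhds ha)] with r hr
    constructor
    · rintro (h | ⟨h, _⟩) <;> linarith
    · rintro (h | ⟨h, _⟩) <;> linarith
  · filter_upwards [self_mem_nhdsWithin] with r hr
    have hr' : r - s < 0 := sub_neg.2 hr
    subst ha
    constructor
    · rintro (h | h)
      · exact Or.inr ⟨rfl, by nlinarith⟩
      · exact Or.inr ⟨rfl, by nlinarith [h.1, h.2]⟩
    · rintro (h | h)
      · exact absurd h (lt_irrefl _)
      · exact Or.inl (by nlinarith [h.2])
  · filter_upwards [hc.eventually (lt_mem_nhds ha)] with r hr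
    exact ⟨fun _ => Or.inl ha, fun _ => Or.inl hr⟩

namespace FlipSystem

variable {w : E → V} {S : Set E} {𝓕 : Set (Set E)}

/-- How coordinates change under an exchange. -/
lemma coord_flip (G : FlipSystem w S 𝓕) {T : Set E} (hT : T ∈ 𝓕) {e e' : E} (he : e ∈ T)
    (heS : e ∉ S) (he' : e' ∉ T)
    (hT' : insert e' (T \ {e}) ∈ 𝓕) :
    ∃ z : E → ℝ, z e < 0 ∧ ∀ y,
      coord w (insert e' (T \ {e})) y e' = coord w T y e / z e ∧
      ∀ f, f ≠ e → f ≠ e' → coord w (insert e' (T \ {e})) y f =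
        coord w T y f - coord w T y e / z e * z f := by
  classical
  obtain ⟨z, hz, hzc⟩ := (G.frame T hT).span (Pi.single e' 1)
  rw [comb_single] at hzc
  have hneg := G.sign T hT e he heS e' he' hT' z hz hzc
  have hee' : e ≠ e' := fun h => he' (h ▸ he)
  refine ⟨z, hneg, fun y => ?_⟩
  have key : coord w (insert e' (T \ {e})) y = coord w T y - (coord w T y e / z e) • z +
      (coord w T y e / z e) • Pi.single e' 1 := by
    refine (G.frame _ hT').coord_unique (fun f hf => ?_) ?_
    · have hf1 : f ≠ e' := fun h => hf (by simp [h])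
      by_cases hfe : f = e
      · subst hfe
        simp [hf1, div_mul_cancel₀ _ hneg.ne]
      · have hfT : f ∉ T := fun h => hf (by simp [h, hfe])
        simp [hf1, hz f hfT, (G.frame T hT).coord_supp y hfT]
    · rw [comb_add, comb_sub, comb_smul, comb_smul, comb_single, hzc,
        (G.frame T hT).comb_coord]
      simp
  constructor
  · rw [key]
    simp [hz e' he', (G.frame T hT).coord_supp y he']
  · intro f _ hf'
    rw [key]
    simp [hf']

lemma ncard_germFacets_le (G : FlipSystem w S 𝓕) (y d : E → ℝ)
    (hy : ∀ T ∈ 𝓕, ∀ e ∈ T, e ∉ S → ∀ f ∈ T, f ∉ S → e ≠ f →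
      ¬ (coord w T y e = 0 ∧ coord w T y f = 0)) :
    (germFacets w S 𝓕 y d).ncard ≤ (germFacets w S 𝓕 y (-d)).ncard := by
  classical
  have hneg : ∀ T ∈ 𝓕, ∀ e, coord w T (-d) e = - coord w T d e := by
    intro T hT e
    have := (G.frame T hT).coord_smul (-1) d
    simp only [neg_smul, one_smul] at this
    rw [this]; rfl
  have hex : ∀ T ∈ germFacets w S 𝓕 y d, ∃ T' ∈ 𝓕,
      ((∀ e ∈ T, e ∉ S → coord w T y e ≠ 0) ∧ T' = T) ∨
      ∃ e ∈ T, e ∉ S ∧ coord w T y e = 0 ∧ ∃ e', e' ∉ T ∧ T' = insert e' (T \ {e}) := by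
    intro T hT
    by_cases h0 : ∀ e ∈ T, e ∉ S → coord w T y e ≠ 0
    · exact ⟨T, hT.1, Or.inl ⟨h0, rfl⟩⟩
    · push Not at h0
      obtain ⟨e, he, heS, h0⟩ := h0
      obtain ⟨e', he', hT'⟩ := G.flip T hT.1 e he heS
      exact ⟨_, hT', Or.inr ⟨e, he, heS, h0, e', he', rfl⟩⟩
  choose! φ hφ𝓕 hφ using hex
  have hslope : ∀ T ∈ germFacets w S 𝓕 y d, ∀ e ∈ T, e ∉ S → coord w T y e = 0 →
      0 < coord w T d e := by
    intro T hT e he heS h0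
    rcases hT.2 e he heS with h | h
    · exact absurd h0 h.ne'
    · exact h.2
  refine Set.ncard_le_ncard_of_injOn φ ?_ ?_ (Set.toFinite _)
  · intro T hT
    refine ⟨hφ𝓕 T hT, fun f hf hfS => ?_⟩
    rcases hφ T hT with ⟨h0, h⟩ | ⟨e, he, heS, h0, e', he', h⟩
    · rw [h] at hf ⊢
      rcases hT.2 f hf hfS with h' | h'
      · exact Or.inl h'
      · exact absurd h'.1 (h0 f hf hfS)
    · have h𝓕 := hφ𝓕 T hT
      rw [h] at hf h𝓕 ⊢
      obtain ⟨z, hz, hco⟩ := G.coord_flip hT.1 he heS he' h𝓕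
      rcases hf with rfl | hf
      · refine Or.inr ⟨by rw [(hco y).1, h0, zero_div], ?_⟩
        rw [hneg _ h𝓕, (hco d).1]
        have := hslope T hT e he heS h0
        have h2 := div_neg_of_pos_of_neg this hz
        linarith
      · have hfe : f ≠ e := by simpa using hf.2
        have hfe' : f ≠ e' := fun h => he' (h ▸ hf.1)
        left
        rw [(hco y).2 f hfe hfe', h0, zero_div, zero_mul, sub_zero]
        rcases hT.2 f hf.1 hfS with h' | h'
        · exact h'
        · exact absurd ⟨h'.1, h0⟩ (hy T hT.1 f hf.1 hfS e he heS hfe)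
  · intro T₁ hT₁ T₂ hT₂ h12
    have zeroAt : ∀ T ∈ germFacets w S 𝓕 y d, ∀ e ∈ T, e ∉ S → coord w T y e = 0 →
        ∀ e', e' ∉ T → φ T = insert e' (T \ {e}) → coord w (φ T) y e' = 0 := by
      intro T hT e he heS h0 e' he' h
      have h𝓕 := hφ𝓕 T hT
      rw [h] at h𝓕 ⊢
      obtain ⟨z, hz, hco⟩ := G.coord_flip hT.1 he heS he' h𝓕
      rw [(hco y).1, h0, zero_div]
    have notS : ∀ T ∈ 𝓕, ∀ e', e' ∉ T → e' ∉ S := fun T hT e' he' h => he' (G.sub T hT h)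
    rcases hφ T₁ hT₁ with ⟨h0₁, h₁⟩ | ⟨e₁, he₁, heS₁, h0₁, e₁', he₁', h₁⟩ <;>
      rcases hφ T₂ hT₂ with ⟨h0₂, h₂⟩ | ⟨e₂, he₂, heS₂, h0₂, e₂', he₂', h₂⟩
    · rw [← h₁, h12, h₂]
    · have := zeroAt T₂ hT₂ e₂ he₂ heS₂ h0₂ e₂' he₂' h₂
      rw [← h12, h₁] at this
      refine absurd this (h0₁ e₂' ?_ (notS T₂ hT₂.1 _ he₂'))
      rw [← h₁, h12, h₂]
      simp
    · have := zeroAt T₁ hT₁ e₁ he₁ heS₁ h0₁ e₁' he₁' h₁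
      rw [h12, h₂] at this
      refine absurd this (h0₂ e₁' ?_ (notS T₁ hT₁.1 _ he₁'))
      rw [← h₂, ← h12, h₁]
      simp
    · have z₁ := zeroAt T₁ hT₁ e₁ he₁ heS₁ h0₁ e₁' he₁' h₁
      have z₂ := zeroAt T₂ hT₂ e₂ he₂ heS₂ h0₂ e₂' he₂' h₂
      rw [← h12] at z₂
      have hee : e₁' = e₂' := by
        by_contra hne
        refine hy _ (hφ𝓕 T₁ hT₁) e₁' ?_ (notS T₁ hT₁.1 _ he₁') e₂' ?_ (notS T₂ hT₂.1 _ he₂') hne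
          ⟨z₁, z₂⟩
        · rw [h₁]; simp
        · rw [h12, h₂]; simp
      subst hee
      have hR : T₁ \ {e₁} = T₂ \ {e₂} := by
        have h3 : insert e₁' (T₁ \ {e₁}) = insert e₁' (T₂ \ {e₂}) := by rw [← h₁, ← h₂, h12]
        ext f
        have h4 := Set.ext_iff.1 h3 f
        by_cases hf : f = e₁'
        · subst hf
          simp [he₁', he₂']
        · simpa [hf] using h4
      have hT₁R : T₁ = insert e₁ (T₁ \ {e₁}) := by simp [Set.insert_eq_of_mem he₁]
      have hT₂R : T₂ = insert e₂ (T₁ \ {e₁}) := by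
        rw [hR]; simp [Set.insert_eq_of_mem he₂]
      by_contra hne
      have he12 : e₁ ≠ e₂ := by
        rintro rfl
        exact hne (hT₁R.trans hT₂R.symm)
      have he₂T₁ : e₂ ∉ T₁ := by
        intro h
        have h5 : e₂ ∈ T₁ \ {e₁} := ⟨h, by simpa using he12.symm⟩
        rw [hR] at h5
        simp at h5
      have hT₂' : insert e₂ (T₁ \ {e₁}) ∈ 𝓕 := hT₂R ▸ hT₂.1
      obtain ⟨z, hz, hco⟩ := G.coord_flip hT₁.1 he₁ heS₁ he₂T₁ hT₂'
      have s₁ := hslope T₁ hT₁ e₁ he₁ heS₁ h0₁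
      have s₂ := hslope T₂ hT₂ e₂ he₂ heS₂ h0₂
      rw [hT₂R, (hco d).1] at s₂
      have := div_neg_of_pos_of_neg s₁ hz
      linarith

lemma ncard_germFacets_neg (G : FlipSystem w S 𝓕) (y d : E → ℝ)
    (hy : ∀ T ∈ 𝓕, ∀ e ∈ T, e ∉ S → ∀ f ∈ T, f ∉ S → e ≠ f →
      ¬ (coord w T y e = 0 ∧ coord w T y f = 0)) :
    (germFacets w S 𝓕 y (-d)).ncard = (germFacets w S 𝓕 y d).ncard := by
  refine le_antisymm ?_ (G.ncard_germFacets_le y d hy)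
  simpa using G.ncard_germFacets_le y (-d) hy

lemma coord_line (G : FlipSystem w S 𝓕) {T : Set E} (hT : T ∈ 𝓕) (x d : E → ℝ) (s : ℝ) (e : E) :
    coord w T (x + s • d) e = coord w T x e + s * coord w T d e := by
  rw [(G.frame T hT).coord_add, (G.frame T hT).coord_smul]
  simp

/-- The number of facets met by a line that avoids intersections of walls is constant. -/
lemma ncard_germFacets_line (G : FlipSystem w S 𝓕) (x d : E → ℝ)
    (hx : ∀ s : ℝ, ∀ T ∈ 𝓕, ∀ e ∈ T, e ∉ S → ∀ f ∈ T, f ∉ S → e ≠ f →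
      ¬ (coord w T (x + s • d) e = 0 ∧ coord w T (x + s • d) f = 0)) (s r : ℝ) :
    (germFacets w S 𝓕 (x + s • d) d).ncard = (germFacets w S 𝓕 (x + r • d) d).ncard := by
  have hstep : ∀ T ∈ 𝓕, ∀ e, ∀ s r : ℝ, coord w T (x + r • d) e =
      coord w T (x + s • d) e + (r - s) * coord w T d e := by
    intro T hT e s r
    rw [G.coord_line hT, G.coord_line hT]; ring
  have hneg : ∀ T ∈ 𝓕, ∀ e, coord w T (-d) e = - coord w T d e := by
    intro T hT e
    have := (G.frame T hT).coord_smul (-1) d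
    simp only [neg_smul, one_smul] at this
    rw [this]; rfl
  have hloc : IsLocallyConstant (fun s : ℝ => (germFacets w S 𝓕 (x + s • d) d).ncard) := by
    rw [IsLocallyConstant.iff_eventually_eq]
    intro s
    rw [← nhdsLT_sup_nhdsGE, eventually_sup]
    constructor
    · have : ∀ᶠ r in 𝓝[<] s, ∀ T : Set E, ∀ e : E,
          (LexPos (coord w T (x + s • d) e + (r - s) * coord w T d e) (coord w T d e) ↔
            LexPos (coord w T (x + s • d) e) (- coord w T d e)) := by
        rw [eventually_all]; intro T
        rw [eventually_all]; intro e
        exact eventually_lexPos_left _ _ _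
      filter_upwards [this] with r hr
      rw [← G.ncard_germFacets_neg (x + s • d) d (hx s)]
      congr 1
      ext T
      refine and_congr_right fun hT => forall_congr' fun e => forall_congr' fun _ =>
        forall_congr' fun _ => ?_
      rw [hstep T hT e s r, hr, hneg T hT]
    · rw [← nhdsGT_sup_nhdsWithin_singleton, eventually_sup]
      constructor
      · have : ∀ᶠ r in 𝓝[>] s, ∀ T : Set E, ∀ e : E,
            (LexPos (coord w T (x + s • d) e + (r - s) * coord w T d e) (coord w T d e) ↔
              LexPos (coord w T (x + s • d) e) (coord w T d e)) := by
          rw [eventually_all]; intro T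
          rw [eventually_all]; intro e
          exact eventually_lexPos_right _ _ _
        filter_upwards [this] with r hr
        congr 1
        ext T
        refine and_congr_right fun hT => forall_congr' fun e => forall_congr' fun _ =>
          forall_congr' fun _ => ?_
        rw [hstep T hT e s r, hr]
      · simp
  exact hloc.apply_eq_of_preconnectedSpace s r

end FlipSystem
end FlipFan

namespace FlipFan

open Filter Topology

variable {E V : Type*} [Fintype E] [AddCommGroup V] [Module ℝ V]

/-- The number of facets whose interior contains `comb w y`. -/
noncomputable def facetCount (w : E → V) (S : Set E) (𝓕 : Set (Set E)) (y : E → ℝ) : ℕ :=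
  {T ∈ 𝓕 | Inside w S y T}.ncard

lemma germFacets_of_generic {w : E → V} {S : Set E} {𝓕 : Set (Set E)} {y : E → ℝ}
    (hy : Generic w S 𝓕 y) (d : E → ℝ) :
    (germFacets w S 𝓕 y d).ncard = facetCount w S 𝓕 y := by
  unfold facetCount germFacets
  congr 1
  ext T
  refine and_congr_right fun hT => forall_congr' fun e => forall_congr' fun he =>
    forall_congr' fun heS => ?_
  have := hy T hT e he heS
  simp [LexPos, this]

lemma exists_forall_functional_ne_zero {ι W : Type*} [Finite ι] [AddCommGroup W] [Module ℝ W]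
    (f : ι → W → ℝ) (hadd : ∀ i x y, f i (x + y) = f i x + f i y)
    (hsmul : ∀ i (a : ℝ) x, f i (a • x) = a * f i x) (h : ∀ i, ∃ x, f i x ≠ 0) :
    ∃ x, ∀ i, f i x ≠ 0 :=
  Module.Dual.exists_forall_ne_zero_of_forall_exists (K := ℝ)
    (fun i => ({ toFun := f i, map_add' := hadd i, map_smul' := hsmul i } : W →ₗ[ℝ] ℝ)) h

lemma eventually_add_mul_pos {a : ℝ} (b : ℝ) (ha : 0 < a) : ∀ᶠ r in 𝓝[>]
    (0 : ℝ), 0 < a + r * b := by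
  have : Continuous (fun r : ℝ => a + r * b) := by fun_prop
  have h : Tendsto (fun r : ℝ => a + r * b) (𝓝[>] 0) (𝓝 a) := by
    simpa using (this.tendsto 0).mono_left nhdsWithin_le_nhds
  exact h.eventually (lt_mem_nhds ha)

lemma eventually_add_mul_neg {a : ℝ} (b : ℝ) (ha : a < 0) : ∀ᶠ r in 𝓝[>]
    (0 : ℝ), a + r * b < 0 := by
  filter_upwards [eventually_add_mul_pos (-b) (neg_pos.2 ha)] with r hr
  linarith

lemma eventually_add_mul_ne {a b : ℝ} (hb : b ≠ 0) : ∀ᶠ r in 𝓝[>] (0 : ℝ), a + r * b ≠ 0 := by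
  rcases lt_trichotomy a 0 with ha | ha | ha
  · exact (eventually_add_mul_neg b ha).mono fun r hr => hr.ne
  · filter_upwards [self_mem_nhdsWithin] with r hr
    have : r ≠ 0 := ne_of_gt hr
    simp [ha, hb, this]
  · exact (eventually_add_mul_pos b ha).mono fun r hr => hr.ne'

namespace FlipSystem

variable {w : E → V} {S : Set E} {𝓕 : Set (Set E)}

lemma coord_single_self (G : FlipSystem w S 𝓕) [DecidableEq E] {T : Set E} (hT : T ∈ 𝓕) {e : E}
    (he : e ∈ T) :
    coord w T (Pi.single e 1) = Pi.single e 1 := by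
  refine (G.frame T hT).coord_self fun f hf => ?_
  have : f ≠ e := fun h => hf (h ▸ he)
  simp [this]

lemma exists_generic_direction (G : FlipSystem w S 𝓕) : ∃ z, Generic w S 𝓕 z := by
  classical
  obtain ⟨z, hz⟩ := exists_forall_functional_ne_zero
    (ι := {p : Set E × E // p.1 ∈ 𝓕 ∧ p.2 ∈ p.1}) (fun p y => coord w p.1.1 y p.1.2)
    (fun p x y => by rw [(G.frame _ p.2.1).coord_add]; rfl)
    (fun p a x => by rw [(G.frame _ p.2.1).coord_smul]; rfl)
    (fun p => ⟨Pi.single p.1.2 1, by rw [G.coord_single_self p.2.1 p.2.2]; simp⟩)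
  exact ⟨z, fun T hT e he _ => hz ⟨(T, e), hT, he⟩⟩

lemma eventually_generic (G : FlipSystem w S 𝓕) (y : E → ℝ) {z : E → ℝ} (hz : Generic w S 𝓕 z) :
    ∀ᶠ r in 𝓝[>] (0 : ℝ), Generic w S 𝓕 (y + r • z) := by
  have : ∀ᶠ r in 𝓝[>] (0 : ℝ), ∀ T : Set E, ∀ e : E, T ∈ 𝓕 → e ∈ T → e ∉ S →
      coord w T y e + r * coord w T z e ≠ 0 := by
    rw [eventually_all]; intro T
    rw [eventually_all]; intro e
    by_cases h : T ∈ 𝓕 ∧ e ∈ T ∧ e ∉ S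
    · exact (eventually_add_mul_ne (hz T h.1 e h.2.1 h.2.2)).mono fun _ hr _ _ _ => hr
    · exact Eventually.of_forall fun _ h1 h2 h3 => absurd ⟨h1, h2, h3⟩ h
  filter_upwards [this] with r hr T hT e he heS
  rw [G.coord_line hT]
  exact hr T e hT he heS

lemma eventually_inside (G : FlipSystem w S 𝓕) {y : E → ℝ} (z : E → ℝ) {T : Set E} (hT : T ∈ 𝓕)
    (hy : Inside w S y T) :
    ∀ᶠ r in 𝓝[>] (0 : ℝ), Inside w S (y + r • z) T := by
  have : ∀ᶠ r in 𝓝[>] (0 : ℝ), ∀ e : E, e ∈ T → e ∉ S →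
      0 < coord w T y e + r * coord w T z e := by
    rw [eventually_all]; intro e
    by_cases h : e ∈ T ∧ e ∉ S
    · exact (eventually_add_mul_pos _ (hy e h.1 h.2)).mono fun _ hr _ _ => hr
    · exact Eventually.of_forall fun _ h1 h2 => absurd ⟨h1, h2⟩ h
  filter_upwards [this] with r hr e he heS
  rw [G.coord_line hT]
  exact hr e he heS

/-- If `comb w y` lies outside the cone of `T`, so do all nearby points. -/
lemma eventually_not_inside (G : FlipSystem w S 𝓕) {y : E → ℝ} (z : E → ℝ) {T : Set E}
    (hT : T ∈ 𝓕) {e : E}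
    (he : e ∈ T) (heS : e ∉ S) (hy : coord w T y e < 0) :
    ∀ᶠ r in 𝓝[>] (0 : ℝ), ¬ Inside w S (y + r • z) T := by
  filter_upwards [eventually_add_mul_neg (coord w T z e) hy] with r hr hin
  have := hin e he heS
  rw [G.coord_line hT] at this
  linarith

lemma eventually_facetCount_eq (G : FlipSystem w S 𝓕) {y : E → ℝ} (z : E → ℝ)
    (hy : Generic w S 𝓕 y) :
    ∀ᶠ r in 𝓝[>] (0 : ℝ), facetCount w S 𝓕 (y + r • z) = facetCount w S 𝓕 y := by
  have : ∀ᶠ r in 𝓝[>] (0 : ℝ), ∀ T : Set E, T ∈ 𝓕 →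
      (Inside w S (y + r • z) T ↔ Inside w S y T) := by
    rw [eventually_all]; intro T
    by_cases hT : T ∈ 𝓕
    · by_cases hin : Inside w S y T
      · exact (G.eventually_inside z hT hin).mono fun _ hr _ => iff_of_true hr hin
      · have hin' := hin
        unfold Inside at hin
        push Not at hin
        obtain ⟨e, he, heS, hle⟩ := hin
        have hlt := lt_of_le_of_ne hle (hy T hT e he heS)
        exact (G.eventually_not_inside z hT he heS hlt).mono fun _ hr _ => iff_of_false hr hin'
    · exact Eventually.of_forall fun _ h => absurd h hT
  filter_upwards [this] with r hr
  unfold facetCount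
  congr 1
  ext T
  exact and_congr_right fun hT => hr T hT

/-- All points off the walls lie in the same number of cones. -/
lemma facetCount_eq (G : FlipSystem w S 𝓕) {x y : E → ℝ} (hx : Generic w S 𝓕 x)
    (hy : Generic w S 𝓕 y) :
    facetCount w S 𝓕 x = facetCount w S 𝓕 y := by
  classical
  obtain ⟨z, hz⟩ := exists_forall_functional_ne_zero
    (ι := {p : Set E × E × E // p.1 ∈ 𝓕 ∧ p.2.1 ∈ p.1 ∧ p.2.1 ∉ S ∧ p.2.2 ∈ p.1 ∧ p.2.1 ≠ p.2.2})
    (fun p y => coord w p.1.1 x p.1.2.1 * coord w p.1.1 y p.1.2.2 -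
      coord w p.1.1 x p.1.2.2 * coord w p.1.1 y p.1.2.1)
    (fun p x y => by simp only [(G.frame _ p.2.1).coord_add, Pi.add_apply]; ring)
    (fun p a x => by
      simp only [(G.frame _ p.2.1).coord_smul, Pi.smul_apply, smul_eq_mul]; ring)
    (fun p => ⟨Pi.single p.1.2.2 1, by
      obtain ⟨⟨T, e, f⟩, hT, he, heS, hf, hef⟩ := p
      rw [G.coord_single_self hT hf]
      simpa [hef] using hx T hT e he heS⟩)
  have hpair : ∀ᶠ r in 𝓝[>] (0 : ℝ), ∀ T : Set E, ∀ e f : E, T ∈ 𝓕 → e ∈ T → e ∉ S → f ∈ T →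
      e ≠ f → coord w T x e * coord w T (y + r • z) f -
        coord w T x f * coord w T (y + r • z) e ≠ 0 := by
    rw [eventually_all]; intro T
    rw [eventually_all]; intro e
    rw [eventually_all]; intro f
    by_cases h : T ∈ 𝓕 ∧ e ∈ T ∧ e ∉ S ∧ f ∈ T ∧ e ≠ f
    · refine (eventually_add_mul_ne (a := coord w T x e * coord w T y f -
        coord w T x f * coord w T y e) (hz ⟨(T, e, f), h⟩)).mono fun r hr _ _ _ _ _ => ?_
      rw [G.coord_line h.1, G.coord_line h.1]
      intro h0
      apply hr
      simp only
      linear_combination h0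
    · exact Eventually.of_forall fun _ h1 h2 h3 h4 h5 => absurd ⟨h1, h2, h3, h4, h5⟩ h
  have hgen : ∀ᶠ r in 𝓝[>] (0 : ℝ), Generic w S 𝓕 (y + r • z) := by
    have : ∀ᶠ r in 𝓝[>] (0 : ℝ), ∀ T : Set E, ∀ e : E, T ∈ 𝓕 → e ∈ T → e ∉ S →
        coord w T y e + r * coord w T z e ≠ 0 := by
      rw [eventually_all]; intro T
      rw [eventually_all]; intro e
      by_cases h : T ∈ 𝓕 ∧ e ∈ T ∧ e ∉ S
      · rcases lt_or_gt_of_ne (hy T h.1 e h.2.1 h.2.2) with h0 | h0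
        · exact (eventually_add_mul_neg _ h0).mono fun _ hr _ _ _ => hr.ne
        · exact (eventually_add_mul_pos _ h0).mono fun _ hr _ _ _ => hr.ne'
      · exact Eventually.of_forall fun _ h1 h2 h3 => absurd ⟨h1, h2, h3⟩ h
    filter_upwards [this] with r hr T hT e he heS
    rw [G.coord_line hT]
    exact hr T e hT he heS
  obtain ⟨r, hpr, hgr, hcr⟩ := (hpair.and (hgen.and (G.eventually_facetCount_eq z hy))).exists
  rw [← hcr]
  set y' := y + r • z with hy'
  have hline := G.ncard_germFacets_line x (y' - x) (fun s T hT e he heS f hf hfS hef h => by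
    have hsub : ∀ g, coord w T (y' - x) g = coord w T y' g - coord w T x g := by
      intro g
      have h1 := (G.frame T hT).coord_add (y' - x) x
      rw [sub_add_cancel] at h1
      rw [h1]; simp
    obtain ⟨h1, h2⟩ := h
    rw [G.coord_line hT, hsub] at h1 h2
    have hne := hpr T e f hT he heS hf hef
    have hs : s * (coord w T x e * coord w T y' f - coord w T x f * coord w T y' e) = 0 := by
      linear_combination coord w T x e * h2 - coord w T x f * h1
    rcases mul_eq_zero.1 hs with h0 | h0
    · rw [h0] at h1
      exact hx T hT e he heS (by linarith)
    · exact hne h0) 0 1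
  rw [zero_smul, add_zero, one_smul, add_sub_cancel] at hline
  rwa [germFacets_of_generic hx, germFacets_of_generic hgr] at hline

lemma inside_indicator (G : FlipSystem w S 𝓕) {T : Set E} (hT : T ∈ 𝓕) : Inside w S
    (T.indicator 1) T := by
  intro e he _
  rw [(G.frame T hT).coord_self (fun f hf => by simp [hf])]
  simp [he]

lemma facetCount_pos (G : FlipSystem w S 𝓕) (hne : 𝓕.Nonempty) {y : E → ℝ} (hy : Generic w S 𝓕 y) :
    ∃ T ∈ 𝓕, Inside w S y T := by
  obtain ⟨T, hT⟩ := hne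
  obtain ⟨z, hz⟩ := G.exists_generic_direction
  obtain ⟨r, h1, h2⟩ := ((G.eventually_generic (T.indicator 1) hz).and
    (G.eventually_inside z hT (G.inside_indicator hT))).exists
  have h3 : 0 < facetCount w S 𝓕 (T.indicator 1 + r • z) :=
    (Set.ncard_pos (Set.toFinite _)).2 ⟨T, hT, h2⟩
  rw [G.facetCount_eq h1 hy] at h3
  exact (Set.ncard_pos (Set.toFinite _)).1 h3

/-- The cones of the facets cover the whole space. -/
theorem cover (G : FlipSystem w S 𝓕) (hne : 𝓕.Nonempty) (y : E → ℝ) :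
    ∃ T ∈ 𝓕, ∀ e, e ∉ S → 0 ≤ coord w T y e := by
  by_contra hcon
  push Not at hcon
  obtain ⟨z, hz⟩ := G.exists_generic_direction
  have : ∀ᶠ r in 𝓝[>] (0 : ℝ), ∀ T : Set E, T ∈ 𝓕 → ¬ Inside w S (y + r • z) T := by
    rw [eventually_all]; intro T
    by_cases hT : T ∈ 𝓕
    · obtain ⟨e, heS, hlt⟩ := hcon T hT
      have he : e ∈ T := by
        by_contra he
        rw [(G.frame T hT).coord_supp y he] at hlt
        exact lt_irrefl _ hlt
      exact (G.eventually_not_inside z hT he heS hlt).mono fun _ hr _ => hr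
    · exact Eventually.of_forall fun _ h => absurd h hT
  obtain ⟨r, h1, h2⟩ := (this.and (G.eventually_generic y hz)).exists
  obtain ⟨T, hT, hin⟩ := G.facetCount_pos hne h2
  exact h1 T hT hin

theorem noOverlap_of_hasSimplePoint (G : FlipSystem w S 𝓕)
    (hD : HasSimplePoint w S 𝓕) : NoOverlap w S 𝓕 := by
  intro T₁ hT₁ T₂ hT₂ y h₁ h₂
  by_contra hne
  obtain ⟨T₀, hT₀, y₀, hsupp, hpos, huniq⟩ := hD
  obtain ⟨z, hz⟩ := G.exists_generic_direction
  obtain ⟨r, hr, hr₁, hr₂⟩ := ((G.eventually_generic y hz).and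
    ((G.eventually_inside z hT₁ h₁).and (G.eventually_inside z hT₂ h₂))).exists
  have hnot : ∀ᶠ r in 𝓝[>] (0 : ℝ), ∀ T : Set E, T ∈ 𝓕 → T ≠ T₀ →
      ¬ Inside w S (y₀ + r • z) T := by
    rw [eventually_all]; intro T
    by_cases hT : T ∈ 𝓕 ∧ T ≠ T₀
    · have : ∃ e, e ∉ S ∧ coord w T y₀ e < 0 := by
        by_contra hcon
        push Not at hcon
        exact hT.2 (huniq T hT.1 (coord w T y₀) (fun e he => (G.frame T hT.1).coord_supp y₀ he)
          hcon ((G.frame T hT.1).comb_coord y₀))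
      obtain ⟨e, heS, hlt⟩ := this
      have he : e ∈ T := by
        by_contra he
        rw [(G.frame T hT.1).coord_supp y₀ he] at hlt
        exact lt_irrefl _ hlt
      exact (G.eventually_not_inside z hT.1 he heS hlt).mono fun _ hr _ _ => hr
    · exact Eventually.of_forall fun _ h1 h2 => absurd ⟨h1, h2⟩ hT
  obtain ⟨q, hq, hqn⟩ := ((G.eventually_generic y₀ hz).and hnot).exists
  have hle : facetCount w S 𝓕 (y₀ + q • z) ≤ 1 := by
    refine (Set.ncard_le_one (Set.toFinite _)).2 fun A hA B hB => ?_
    have : ∀ A ∈ {T ∈ 𝓕 | Inside w S (y₀ + q • z) T}, A = T₀ := fun A hA => by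
      by_contra h
      exact hqn A hA.1 h hA.2
    rw [this A hA, this B hB]
  rw [G.facetCount_eq hq hr] at hle
  exact hne ((Set.ncard_le_one (Set.toFinite _)).1 hle T₁ ⟨hT₁, hr₁⟩ T₂ ⟨hT₂, hr₂⟩)

theorem hasSimplePoint_of_noOverlap (G : FlipSystem w S 𝓕) (hne : 𝓕.Nonempty)
    (hN : NoOverlap w S 𝓕) :
    HasSimplePoint w S 𝓕 := by
  obtain ⟨T₀, hT₀⟩ := hne
  obtain ⟨z, hz⟩ := G.exists_generic_direction
  obtain ⟨r, h1, h2⟩ := ((G.eventually_generic (T₀.indicator 1) hz).and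
    (G.eventually_inside z hT₀ (G.inside_indicator hT₀))).exists
  refine ⟨T₀, hT₀, coord w T₀ (T₀.indicator 1 + r • z),
    fun e he => (G.frame T₀ hT₀).coord_supp _ he, h2, fun T hT u hu hu0 hc => ?_⟩
  rw [(G.frame T₀ hT₀).comb_coord] at hc
  have hco := (G.frame T hT).coord_unique hu hc
  refine hN T hT T₀ hT₀ _ (fun e he heS => ?_) h2
  refine lt_of_le_of_ne ?_ (h1 T hT e he heS).symm
  rw [hco]
  exact hu0 e heS

/-- The facets containing a larger lineality set again form a flip system. -/
lemma restrict (G : FlipSystem w S 𝓕) {S' : Set E} (hS : S ⊆ S') : FlipSystem w S'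
    {T ∈ 𝓕 | S' ⊆ T} where
  sub := fun T hT => hT.2
  frame := fun T hT => G.frame T hT.1
  flip := fun T hT e he heS => by
    obtain ⟨e', he', h⟩ := G.flip T hT.1 e he (fun h => heS (hS h))
    refine ⟨e', he', h, fun f hf => Or.inr ⟨hT.2 hf, ?_⟩⟩
    rintro rfl
    exact heS hf
  sign := fun T hT e he heS e' he' h => G.sign T hT.1 e he (fun h => heS (hS h)) e' he' h.1

/-- If interiors are disjoint, two cones meet in the cone of the common face. -/
theorem mem_of_comb_eq (G : FlipSystem w S 𝓕) (hN : NoOverlap w S 𝓕) {T T' : Set E} (hT : T ∈ 𝓕)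
    (hT' : T' ∈ 𝓕)
    {y y' : E → ℝ} (hy : ∀ e, e ∉ T → y e = 0) (hy' : ∀ e, e ∉ T' → y' e = 0)
    (hy0 : ∀ e, e ∉ S → 0 ≤ y e) (hy0' : ∀ e, e ∉ S → 0 ≤ y' e)
    (hc : comb w y = comb w y') {e : E} (he : y e ≠ 0) : e ∈ T' := by
  set S' : Set E := S ∪ {e | y e ≠ 0} with hS'
  have hST : S' ⊆ T := by
    rintro f (hf | hf)
    · exact G.sub T hT hf
    · by_contra h
      exact hf (hy f h)
  have G' : FlipSystem w S' {T ∈ 𝓕 | S' ⊆ T} := G.restrict Set.subset_union_left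
  have hne : {T ∈ 𝓕 | S' ⊆ T}.Nonempty := ⟨T, hT, hST⟩
  obtain ⟨z, hz⟩ := G'.exists_generic_direction
  obtain ⟨r, h1, h2⟩ := ((G'.eventually_generic (T'.indicator 1) hz).and
    (G.eventually_inside z hT' (G.inside_indicator hT'))).exists
  set p := T'.indicator 1 + r • z
  obtain ⟨T'', hT'', hp⟩ := G'.facetCount_pos hne h1
  have hyT'' : ∀ f, f ∉ T'' → y f = 0 := fun f hf => by
    by_contra h
    exact hf (hT''.2 (Or.inr h))
  have hcoT'' := (G.frame T'' hT''.1).coord_self hyT''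
  have hcoT' := (G.frame T' hT').coord_unique hy' hc.symm
  have hev : ∀ᶠ q in 𝓝[>] (0 : ℝ), Inside w S (y + q • p) T'' := by
    have : ∀ᶠ q in 𝓝[>] (0 : ℝ), ∀ f, f ∈ T'' → f ∉ S → 0 < y f + q * coord w T'' p f := by
      rw [eventually_all]; intro f
      by_cases hf : f ∈ T'' ∧ f ∉ S
      · by_cases hf0 : y f = 0
        · have hfS' : f ∉ S' := by
            rintro (h | h)
            · exact hf.2 h
            · exact h hf0
          filter_upwards [self_mem_nhdsWithin] with q hq _ _
          rw [hf0, zero_add]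
          exact mul_pos hq (hp f hf.1 hfS')
        · have := lt_of_le_of_ne (hy0 f hf.2) (Ne.symm hf0)
          exact (eventually_add_mul_pos _ this).mono fun _ h _ _ => h
      · exact Eventually.of_forall fun _ h1 h2 => absurd ⟨h1, h2⟩ hf
    filter_upwards [this] with q hq f hf hfS
    rw [G.coord_line hT''.1, hcoT'']
    exact hq f hf hfS
  obtain ⟨q, hq, hq0⟩ := (hev.and self_mem_nhdsWithin).exists
  have hin' : Inside w S (y + q • p) T' := by
    intro f hf hfS
    rw [G.coord_line hT', hcoT']
    have := mul_pos hq0 (h2 f hf hfS)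
    linarith [hy0' f hfS]
  have := hN T'' hT''.1 T' hT' _ hq hin'
  rw [← this]
  exact hT''.2 (Or.inr he)

end FlipSystem

/-- A simple point near the ray of `w s` in the star of `s` is simple in the whole family when the
ray of `w s` lies in no cone outside this star. -/
theorem hasSimplePoint_of_link {w : E → V} {S : Set E} {𝓕 : Set (Set E)} {s : E} (hs : s ∉ S)
    (hframe : ∀ T ∈ 𝓕, IsFrame w T)
    (hneg : ∀ T ∈ 𝓕, s ∉ T → ∀ z : E → ℝ, (∀ e, e ∉ T → z e = 0) → comb w z = w s →
      ∃ e, e ∉ S ∧ z e < 0)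
    (hD : HasSimplePoint w (insert s S) {T ∈ 𝓕 | insert s S ⊆ T}) (hS : ∀ T ∈ 𝓕, S ⊆ T) :
    HasSimplePoint w S 𝓕 := by
  classical
  obtain ⟨T₀, hT₀, y, hy, hpos, huniq⟩ := hD
  have hsT₀ : s ∈ T₀ := hT₀.2 (by simp)
  have hev : ∀ᶠ q : ℝ in atTop, ∀ T : Set E, T ∈ 𝓕 → s ∉ T →
      ∃ e, e ∉ S ∧ coord w T (y + q • (Pi.single s 1 : E → ℝ)) e < 0 := by
    rw [eventually_all]; intro T
    by_cases h : T ∈ 𝓕 ∧ s ∉ T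
    · obtain ⟨e, heS, he⟩ := hneg T h.1 h.2 (coord w T (Pi.single s 1))
        (fun e he => (hframe T h.1).coord_supp _ he)
        (by rw [(hframe T h.1).comb_coord, comb_single])
      have ht : Tendsto (fun q : ℝ => coord w T y e + q * coord w T (Pi.single s 1) e)
          atTop atBot :=
        tendsto_atBot_add_const_left _ _ (tendsto_id.atTop_mul_const_of_neg he)
      filter_upwards [ht.eventually (eventually_lt_atBot 0)] with q hq _ _
      refine ⟨e, heS, ?_⟩
      rw [(hframe T h.1).coord_add, (hframe T h.1).coord_smul]
      simpa using hq
    · exact Eventually.of_forall fun _ h1 h2 => absurd ⟨h1, h2⟩ h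
  obtain ⟨q, hq, hqs⟩ := (hev.and (eventually_gt_atTop (-y s))).exists
  refine ⟨T₀, hT₀.1, y + q • Pi.single s 1, fun e he => ?_, fun e he heS => ?_,
    fun T hT z hz hz0 hc => ?_⟩
  · have : e ≠ s := fun h => he (h ▸ hsT₀)
    simp [hy e he, this]
  · by_cases h : e = s
    · subst h
      simp
      linarith
    · simpa [h] using hpos e he (by simp [h, heS])
  · by_cases hsT : s ∈ T
    · refine huniq T ⟨hT, Set.insert_subset hsT (hS T hT)⟩ (z - q • Pi.single s 1)
        (fun e he => ?_) (fun e he => ?_) ?_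
      · have : e ≠ s := fun h => he (h ▸ hsT)
        simp [hz e he, this]
      · have h1 : e ≠ s := fun h => he (by simp [h])
        simpa [h1] using hz0 e (fun h => he (by simp [h]))
      · rw [comb_sub, hc, comb_add, add_sub_cancel_right]
    · obtain ⟨e, heS, hlt⟩ := hq T hT hsT
      rw [(hframe T hT).coord_unique hz hc] at hlt
      exact absurd (hz0 e heS) (not_le.2 hlt)

end FlipFan

namespace FlipFan

open Filter Topology

variable {E κ X : Type*} [Fintype E] [Fintype κ] [TopologicalSpace X]

/-- Coordinates with respect to a basis that varies continuously are continuous. -/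
lemma continuous_coord {w : X → E → κ → ℝ} (hw : ∀ e, Continuous fun x => w x e) {T : Set E}
    (hT : ∀ x, IsFrame (w x) T) (y : E → ℝ) (e : E) :
    Continuous fun x => coord (w x) T y e := by
  classical
  by_cases he : e ∈ T
  swap
  · simp only [(hT _).coord_supp y he]
    exact continuous_const
  let gram : X → Matrix T T ℝ := fun x => Matrix.of fun f g => w x f ⬝ᵥ w x g
  let b : X → T → ℝ := fun x g => comb (w x) y ⬝ᵥ w x g
  have hwp : ∀ e k, Continuous fun x => w x e k := fun e k => (continuous_apply k).comp (hw e)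
  have hg : Continuous gram := by
    refine continuous_matrix fun f g => ?_
    simp only [gram, Matrix.of_apply, dotProduct]
    fun_prop
  have hb : Continuous b := by
    refine continuous_pi fun g => ?_
    simp only [b, comb, dotProduct, Finset.sum_apply, Pi.smul_apply, smul_eq_mul]
    fun_prop
  have hcomb : ∀ x (c : E → ℝ), (∀ f, f ∉ T → c f = 0) → ∀ u : κ → ℝ,
      comb (w x) c ⬝ᵥ u = ∑ f : T, c f * (w x f ⬝ᵥ u) := by
    intro x c hc u
    have h1 : comb (w x) c ⬝ᵥ u = ∑ f, c f * (w x f ⬝ᵥ u) := by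
      simp [comb, sum_dotProduct, smul_dotProduct]
    rw [h1, ← Finset.sum_filter_of_ne (p := (· ∈ T)) (fun f _ hf => by
      by_contra hfT
      exact hf (by rw [hc f hfT, zero_mul]))]
    exact Finset.sum_subtype _ (by simp) _
  have hmul : ∀ x, Matrix.mulVec (gram x) (fun f : T => coord (w x) T y f) = b x := by
    intro x
    ext g
    simp only [b]
    rw [← (hT x).comb_coord y, hcomb x _ (fun f hf => (hT x).coord_supp y hf)]
    simp only [Matrix.mulVec, gram, dotProduct, Matrix.of_apply]
    refine Finset.sum_congr rfl fun f _ => ?_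
    rw [mul_comm]
    congr 1
    exact Finset.sum_congr rfl fun k _ => mul_comm _ _
  have hdet : ∀ x, (gram x).det ≠ 0 := by
    intro x h0
    obtain ⟨c, hc0, hc⟩ := Matrix.exists_mulVec_eq_zero_iff.2 h0
    let c' : E → ℝ := fun f => if h : f ∈ T then c ⟨f, h⟩ else 0
    have hc' : ∀ f, f ∉ T → c' f = 0 := fun f hf => by simp [c', hf]
    have hz : comb (w x) c' ⬝ᵥ comb (w x) c' = 0 := by
      rw [hcomb x c' hc']
      refine Finset.sum_eq_zero fun f _ => ?_
      rw [dotProduct_comm, hcomb x c' hc']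
      have := congrFun hc f
      simp only [Matrix.mulVec, gram, dotProduct, Matrix.of_apply, Pi.zero_apply] at this
      have h2 : ∑ g : T, c' g * (w x g ⬝ᵥ w x f) = 0 := by
        rw [← this]
        refine Finset.sum_congr rfl fun g _ => ?_
        simp only [c', g.2, dif_pos, dotProduct]
        rw [mul_comm]
        congr 1
        exact Finset.sum_congr rfl fun k _ => mul_comm _ _
      rw [h2, mul_zero]
    have h3 := (hT x).indep c' hc' (dotProduct_self_eq_zero.1 hz)
    apply hc0
    ext f
    have := congrFun h3 f
    simpa [c'] using this
  have hform : ∀ x, coord (w x) T y e =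
      (gram x).det⁻¹ * Matrix.mulVec (gram x).adjugate (b x) ⟨e, he⟩ := by
    intro x
    rw [← hmul x, Matrix.mulVec_mulVec, Matrix.adjugate_mul, Matrix.smul_mulVec,
      Matrix.one_mulVec]
    simp [hdet x]
  simp only [hform]
  exact (hg.matrix_det.inv₀ hdet).mul
    ((continuous_apply _).comp (hg.matrix_adjugate.matrix_mulVec hb))

/-- Having a simple point is invariant under continuous deformations of flip systems. -/
theorem hasSimplePoint_of_continuous [PreconnectedSpace X] {w : X → E → κ → ℝ}
    (hw : ∀ e, Continuous fun x => w x e) {S : Set E} {𝓕 : Set (Set E)}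
    (hG : ∀ x, FlipSystem (w x) S 𝓕) {x₀ : X} (h : HasSimplePoint (w x₀) S 𝓕) (x₁ : X) :
    HasSimplePoint (w x₁) S 𝓕 := by
  have hne : 𝓕.Nonempty := by
    obtain ⟨T, hT, -⟩ := h
    exact ⟨T, hT⟩
  have hcont : ∀ T ∈ 𝓕, ∀ y e, Continuous fun x => coord (w x) T y e := fun T hT y e =>
    continuous_coord hw (fun x => (hG x).frame T hT) y e
  have hD : IsOpen {x | HasSimplePoint (w x) S 𝓕} := by
    rw [isOpen_iff_mem_nhds]
    rintro x ⟨T₀, hT₀, y, hy, hpos, huniq⟩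
    have hev : ∀ᶠ x' in 𝓝 x, ∀ T : Set E, T ∈ 𝓕 → T ≠ T₀ →
        ∃ e, e ∉ S ∧ coord (w x') T y e < 0 := by
      rw [eventually_all]; intro T
      by_cases hT : T ∈ 𝓕 ∧ T ≠ T₀
      · have : ∃ e, e ∉ S ∧ coord (w x) T y e < 0 := by
          by_contra hcon
          push Not at hcon
          exact hT.2 (huniq T hT.1 _ (fun e he => ((hG x).frame T hT.1).coord_supp y he)
            hcon (((hG x).frame T hT.1).comb_coord y))
        obtain ⟨e, heS, hlt⟩ := this
        filter_upwards [((hcont T hT.1 y e).tendsto x).eventually (gt_mem_nhds hlt)] with x' hx' _ _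
        exact ⟨e, heS, hx'⟩
      · exact Eventually.of_forall fun _ h1 h2 => absurd ⟨h1, h2⟩ hT
    filter_upwards [hev] with x' hx'
    refine ⟨T₀, hT₀, y, hy, hpos, fun T hT z hz hz0 hc => ?_⟩
    by_contra hne
    obtain ⟨e, heS, hlt⟩ := hx' T hT hne
    rw [((hG x').frame T hT).coord_unique hz hc] at hlt
    exact absurd (hz0 e heS) (not_le.2 hlt)
  have hO : IsOpen {x | ¬ HasSimplePoint (w x) S 𝓕} := by
    rw [isOpen_iff_mem_nhds]
    intro x hx
    have hx' : ¬ NoOverlap (w x) S 𝓕 := fun h => hx ((hG x).hasSimplePoint_of_noOverlap hne h)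
    unfold NoOverlap at hx'
    push Not at hx'
    obtain ⟨T₁, hT₁, T₂, hT₂, y, h₁, h₂, h12⟩ := hx'
    have hev : ∀ T ∈ 𝓕, Inside (w x) S y T → ∀ᶠ x' in 𝓝 x, Inside (w x') S y T := by
      intro T hT hin
      have : ∀ᶠ x' in 𝓝 x, ∀ e, e ∈ T → e ∉ S → 0 < coord (w x') T y e := by
        rw [eventually_all]; intro e
        by_cases he : e ∈ T ∧ e ∉ S
        · filter_upwards [((hcont T hT y e).tendsto x).eventually
            (lt_mem_nhds (hin e he.1 he.2))] with x' hx' _ _ using hx'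
        · exact Eventually.of_forall fun _ h1 h2 => absurd ⟨h1, h2⟩ he
      filter_upwards [this] with x' hx' e he heS using hx' e he heS
    filter_upwards [hev T₁ hT₁ h₁, hev T₂ hT₂ h₂] with x' h₁' h₂' hD'
    exact h12 ((hG x').noOverlap_of_hasSimplePoint hD' T₁ hT₁ T₂ hT₂ y h₁' h₂')
  have hclopen : IsClopen {x | HasSimplePoint (w x) S 𝓕} :=
    ⟨⟨hO⟩, hD⟩
  have := hclopen.eq_univ ⟨x₀, h⟩
  exact Set.eq_univ_iff_forall.1 this x₁

end FlipFan

namespace TwoTri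

/-- The pair `(i, j)` crosses two crossing pairs of `A`. -/
def Blocked (A : ℕ → ℕ → Prop) (i j : ℕ) : Prop :=
  ∃ k l p q, A k l ∧ A p q ∧
    ((i < k ∧ k < p ∧ p < j ∧ j < l ∧ l < q) ∨ (k < i ∧ i < p ∧ p < l ∧ l < j ∧ j < q) ∨
      (k < p ∧ p < i ∧ i < l ∧ l < q ∧ q < j))

/-- `A` is the edge relation of a `2`-triangulation of the polygon with vertices `0, …, n - 1`,
edges being recorded with increasing endpoints. -/
structure Tri (n : ℕ) (A : ℕ → ℕ → Prop) : Prop where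
  bound : ∀ {i j}, A i j → i < j ∧ j < n
  free : ∀ {a b c a' b' c'}, A a a' → A b b' → A c c' → a < b → b < c → c < a' → a' < b' →
    b' < c' → False
  max : ∀ {i j}, i < j → j < n → ¬ Blocked A i j → A i j

namespace Tri

variable {n : ℕ} {A : ℕ → ℕ → Prop}

lemma short_mem (h : Tri n A) {i j : ℕ} (hij : i < j) (hj : j < n)
    (hs : j ≤ i + 2 ∨ n ≤ j - i + 2) : A i j := by
  refine h.max hij hj ?_
  rintro ⟨k, l, p, q, h1, h2, h3⟩
  have := h.bound h1
  have := h.bound h2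
  omega

/-- Below every edge there is an ear. -/
lemma exists_ear (h : Tri n A) {i j : ℕ} (hA : A i j)
    (hij : i + 3 ≤ j) : ∃ v, i ≤ v ∧ v + 3 ≤ j ∧ A v (v + 3) := by
  induction hd : j - i using Nat.strong_induction_on generalizing i j with
  | _ d ih =>
    subst hd
    by_cases hex : ∃ k l, A k l ∧ k + 3 ≤ l ∧ i ≤ k ∧ l ≤ j ∧ l - k < j - i
    · obtain ⟨k, l, hkl, h3, hik, hlj, hlt⟩ := hex
      obtain ⟨v, hv⟩ := ih (l - k) hlt hkl h3 rfl
      exact ⟨v, by omega, by omega, hv.2.2⟩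
    · have hmin : ∀ k l, A k l → k + 3 ≤ l → i ≤ k → l ≤ j → j - i ≤ l - k := by
        intro k l a1 a2 a3 a4
        by_contra a5
        exact hex ⟨k, l, a1, a2, a3, a4, by omega⟩
      refine ⟨i, le_rfl, hij, h.max (by omega) (by have := h.bound hA; omega) ?_⟩
      rintro ⟨k, l, p, q, h1, h2, h3 | h3 | h3⟩
      · have := hmin k l h1
        exact h.free hA h1 h2 (by omega) (by omega) (by omega) (by omega) (by omega)
      · have := hmin p q h2
        exact h.free h1 hA h2 (by omega) (by omega) (by omega) (by omega) (by omega)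
      · exact h.free h1 h2 hA (by omega) (by omega) (by omega) (by omega) (by omega)

/-- There is an ear different from any given edge. -/
lemma exists_ear_ne (h : Tri n A) (hn : 6 ≤ n) (a b : ℕ) : ∃ v, A v (v + 3) ∧ ¬
    (v = a ∧ v + 3 = b) := by
  by_contra hcon
  push Not at hcon
  obtain ⟨v, -, -, hv⟩ := h.exists_ear (h.short_mem (i := 0) (j := n - 1) (by omega) (by omega)
    (by omega)) (by omega)
  obtain ⟨rfl, hb⟩ := hcon v hv
  have hall : ∀ i j, A i j → i + 3 ≤ j → i ≤ v ∧ v + 3 ≤ j := by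
    intro i j hA hij
    obtain ⟨x, h1, h2, h3⟩ := h.exists_ear hA hij
    have := hcon x h3
    omega
  have hvn := h.bound hv
  have hno : ∀ x, x ≠ v → ¬ A x (x + 3) := fun x hx hA => hx (hcon x hA).1
  rcases Nat.eq_zero_or_pos v with rfl | hpos
  · refine hno 1 (by omega) (h.max (by omega) (by omega) ?_)
    rintro ⟨k, l, p, q, h1, h2, h3⟩
    have := hall k l h1
    have := hall p q h2
    omega
  · obtain ⟨x, rfl⟩ : ∃ x, v = x + 1 := ⟨v - 1, by omega⟩
    refine hno x (by omega) (h.max (by omega) (by omega) ?_)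
    rintro ⟨k, l, p, q, h1, h2, h3⟩
    have := hall k l h1
    have := hall p q h2
    omega

lemma ear_right (h : Tri n A) {v : ℕ} (hv : A v (v + 3)) {o o' : ℕ} (h1 : A (v + 1) o)
    (h2 : A (v + 2) o') (ho : v + 3 < o) : o' ≤ o := by
  by_contra hlt
  exact h.free hv h1 h2 (by omega) (by omega) (by omega) (by omega) (by omega)

lemma ear_mixed (h : Tri n A) {v : ℕ} (hv : A v (v + 3)) {o o' : ℕ} (h1 : A (v + 1) o)
    (h2 : A o' (v + 2)) (ho : v + 3 < o)
    (ho' : o' < v) : False :=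
  h.free h2 hv h1 (by omega) (by omega) (by omega) (by omega) (by omega)

lemma ear_left (h : Tri n A) {v : ℕ} (hv : A v (v + 3)) {o o' : ℕ} (h1 : A o (v + 1))
    (h2 : A o' (v + 2)) (ho : o' < v) : o' ≤ o := by
  by_contra hlt
  exact h.free h1 h2 hv (by omega) (by omega) (by omega) (by omega) (by omega)

end Tri

/-- `c` is joined to both `v + 1` and `v + 2` and lies outside the ear `(v, v + 3)`. -/
def Common (A : ℕ → ℕ → Prop) (v c : ℕ) : Prop :=
  (v + 3 < c ∧ A (v + 1) c ∧ A (v + 2) c) ∨ (c < v ∧ A c (v + 1) ∧ A c (v + 2))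

lemma Tri.common_unique {n : ℕ} {A : ℕ → ℕ → Prop} (h : Tri n A) {v c c' : ℕ}
    (hv : A v (v + 3)) (hc : Common A v c) (hc' : Common A v c') : c = c' := by
  rcases hc with ⟨h1, h2, h3⟩ | ⟨h1, h2, h3⟩ <;> rcases hc' with ⟨h1', h2', h3'⟩ | ⟨h1', h2', h3'⟩
  · exact le_antisymm (h.ear_right hv h2' h3 h1') (h.ear_right hv h2 h3' h1)
  · exact (h.ear_mixed hv h2 h3' h1 h1').elim
  · exact (h.ear_mixed hv h2' h3 h1' h1).elim
  · exact le_antisymm (h.ear_left hv h2' h3 h1) (h.ear_left hv h2 h3' h1')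

lemma Tri.exists_common {n : ℕ} {A : ℕ → ℕ → Prop} (h : Tri n A) (hn : 6 ≤ n) {v : ℕ}
    (hv : A v (v + 3)) : ∃ c, Common A v c := by
  have hvn := h.bound hv
  by_cases hL : ∃ o, o < v ∧ A o (v + 2)
  · obtain ⟨o, ho⟩ := hL
    obtain ⟨c, ⟨hcv, hc⟩, hmax⟩ : ∃ c, (c < v ∧ A c (v + 2)) ∧
        ∀ x, x < v ∧ A x (v + 2) → x ≤ c := by
      classical
      refine ⟨Nat.findGreatest (fun x => x < v ∧ A x (v + 2)) v,
        Nat.findGreatest_spec (P := fun x => x < v ∧ A x (v + 2)) ho.1.le ho, fun x hx =>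
          Nat.le_findGreatest hx.1.le hx⟩
    refine ⟨c, Or.inr ⟨hcv, h.max (by omega) (by omega) ?_, hc⟩⟩
    rintro ⟨k, l, p, q, h1, h2, h3 | h3 | h3⟩
    · by_cases hl : l = v + 2
      · subst hl
        have := hmax k ⟨by omega, h1⟩
        omega
      · exact h.free hc h1 h2 (by omega) (by omega) (by omega) (by omega) (by omega)
    · by_cases hq : q = v + 2
      · subst hq
        have := hmax p ⟨by omega, h2⟩
        omega
      · exact h.free h1 hc h2 (by omega) (by omega) (by omega) (by omega) (by omega)
    · exact h.free h1 h2 hc (by omega) (by omega) (by omega) (by omega) (by omega)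
  · have hL' : ∀ o, o < v → ¬ A o (v + 2) := fun o h1 h2 => hL ⟨o, h1, h2⟩
    have hv4 : v + 4 < n := by
      by_contra hcon
      exact hL' 0 (by omega) (h.short_mem (by omega) (by omega) (by omega))
    have h4 : A (v + 2) (v + 4) := h.short_mem (by omega) (by omega) (by omega)
    obtain ⟨c, ⟨hcv, hc⟩, hmax⟩ : ∃ c, (v + 3 < c ∧ A (v + 2) c) ∧
        ∀ x, v + 3 < x ∧ A (v + 2) x → x ≤ c := by
      classical
      refine ⟨Nat.findGreatest (fun x => v + 3 < x ∧ A (v + 2) x) n,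
        Nat.findGreatest_spec (P := fun x => v + 3 < x ∧ A (v + 2) x) hv4.le ⟨by omega, h4⟩,
        fun x hx => Nat.le_findGreatest (h.bound hx.2).2.le hx⟩
    have hcn := h.bound hc
    refine ⟨c, Or.inl ⟨hcv, h.max (by omega) (by omega) ?_, hc⟩⟩
    rintro ⟨k, l, p, q, h1, h2, h3 | h3 | h3⟩
    · by_cases hk : k = v + 2
      · subst hk
        have := hmax l ⟨by omega, h1⟩
        omega
      · exact h.free hc h1 h2 (by omega) (by omega) (by omega) (by omega) (by omega)
    · by_cases hp : p = v + 2
      · subst hp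
        have := hmax q ⟨by omega, h2⟩
        omega
      · exact h.free h1 hc h2 (by omega) (by omega) (by omega) (by omega) (by omega)
    · by_cases hl : l = v + 2
      · subst hl
        exact hL' k (by omega) h1
      · exact h.free h1 h2 hc (by omega) (by omega) (by omega) (by omega) (by omega)

/-- The map merging the vertices `v + 1` and `v + 2`. -/
def merge (v i : ℕ) : ℕ := if i ≤ v + 1 then i else i - 1

lemma merge_spec (v i : ℕ) : (i ≤ v + 1 ∧ merge v i = i) ∨ (v + 2 ≤ i ∧ merge v i + 1 = i) := by
  unfold merge
  split_ifs <;> omega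

lemma merge_lt {v i j : ℕ} (hij : i < j) (h : ¬ (v + 1 = i ∧ v + 2 = j)) :
    merge v i < merge v j := by
  have := merge_spec v i
  have := merge_spec v j
  omega

lemma lt_of_merge_lt {v i j : ℕ} (h : merge v i < merge v j) : i < j := by
  have := merge_spec v i
  have := merge_spec v j
  omega

/-- The contraction of the boundary edge `(v + 1, v + 2)`. -/
def contr (v : ℕ) (A : ℕ → ℕ → Prop) (x y : ℕ) : Prop :=
  x < y ∧ ∃ i j, A i j ∧ merge v i = x ∧ merge v j = y

lemma contr_of_mem {v : ℕ} {A : ℕ → ℕ → Prop} {i j : ℕ} (hA : A i j)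
    (hij : merge v i < merge v j) : contr v A (merge v i) (merge v j) :=
  ⟨hij, i, j, hA, rfl, rfl⟩

/-- A pair of the polygon is contained in the contraction as soon as one of its lifts is
admissible and not blocked by edges at both merged vertices. -/
lemma Tri.contr_of_lift {N : ℕ} {A : ℕ → ℕ → Prop} (h : Tri (N + 1) A) {v i j : ℕ}
    (hij : i < j) (hj : j < N + 1) (hm : merge v i < merge v j)
    (hb : ¬ Blocked (contr v A) (merge v i) (merge v j))
    (hno : ∀ k l p q, A k l → A p q →
      ((i < k ∧ k < p ∧ p < j ∧ j < l ∧ l < q) ∨ (k < i ∧ i < p ∧ p < l ∧ l < j ∧ j < q) ∨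
      (k < p ∧ p < i ∧ i < l ∧ l < q ∧ q < j)) →
      ¬ ((v + 1 = i ∨ v + 1 = j ∨ v + 1 = k ∨ v + 1 = l ∨ v + 1 = p ∨ v + 1 = q) ∧
        (v + 2 = i ∨ v + 2 = j ∨ v + 2 = k ∨ v + 2 = l ∨ v + 2 = p ∨ v + 2 = q))) :
    contr v A (merge v i) (merge v j) := by
  refine contr_of_mem (h.max hij hj ?_) hm
  rintro ⟨k, l, p, q, h1, h2, h3⟩
  have hk := h.bound h1
  have hp := h.bound h2
  have hno' := hno k l p q h1 h2 h3
  rcases h3 with ⟨a1, a2, a3, a4, a5⟩ | ⟨a1, a2, a3, a4, a5⟩ | ⟨a1, a2, a3, a4, a5⟩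
  · have m1 := merge_lt a1 (v := v) (by omega)
    have m2 := merge_lt a2 (v := v) (by omega)
    have m3 := merge_lt a3 (v := v) (by omega)
    have m4 := merge_lt a4 (v := v) (by omega)
    have m5 := merge_lt a5 (v := v) (by omega)
    exact hb ⟨_, _, _, _, contr_of_mem h1 (by omega), contr_of_mem h2 (by omega),
      Or.inl ⟨m1, m2, m3, m4, m5⟩⟩
  · have m1 := merge_lt a1 (v := v) (by omega)
    have m2 := merge_lt a2 (v := v) (by omega)
    have m3 := merge_lt a3 (v := v) (by omega)
    have m4 := merge_lt a4 (v := v) (by omega)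
    have m5 := merge_lt a5 (v := v) (by omega)
    exact hb ⟨_, _, _, _, contr_of_mem h1 (by omega), contr_of_mem h2 (by omega),
      Or.inr (Or.inl ⟨m1, m2, m3, m4, m5⟩)⟩
  · have m1 := merge_lt a1 (v := v) (by omega)
    have m2 := merge_lt a2 (v := v) (by omega)
    have m3 := merge_lt a3 (v := v) (by omega)
    have m4 := merge_lt a4 (v := v) (by omega)
    have m5 := merge_lt a5 (v := v) (by omega)
    exact hb ⟨_, _, _, _, contr_of_mem h1 (by omega), contr_of_mem h2 (by omega),
      Or.inr (Or.inr ⟨m1, m2, m3, m4, m5⟩)⟩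

/-- Contracting the boundary edge below an ear gives a `2`-triangulation. -/
theorem Tri.contr {N : ℕ} {A : ℕ → ℕ → Prop} (h : Tri (N + 1) A) (hN : 5 ≤ N) {v : ℕ}
    (hv : A v (v + 3)) : Tri N (contr v A) := by
  have hvn := h.bound hv
  obtain ⟨c, hc⟩ := h.exists_common (by omega) hv
  refine ⟨?_, ?_, ?_⟩
  · rintro x y ⟨hxy, i, j, hA, rfl, rfl⟩
    have := h.bound hA
    have := merge_spec v i
    have := merge_spec v j
    omega
  · rintro _ _ _ _ _ _ ⟨-, i₁, j₁, h₁, rfl, rfl⟩ ⟨-, i₂, j₂, h₂, rfl, rfl⟩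
      ⟨-, i₃, j₃, h₃, rfl, rfl⟩ a1 a2 a3 a4 a5
    exact h.free h₁ h₂ h₃ (lt_of_merge_lt a1) (lt_of_merge_lt a2) (lt_of_merge_lt a3)
      (lt_of_merge_lt a4) (lt_of_merge_lt a5)
  · intro x y hxy hy hb
    have hlift : ∀ i j, merge v i = x → merge v j = y → (∀ k l p q, A k l → A p q →
      ((i < k ∧ k < p ∧ p < j ∧ j < l ∧ l < q) ∨ (k < i ∧ i < p ∧ p < l ∧ l < j ∧ j < q) ∨
      (k < p ∧ p < i ∧ i < l ∧ l < q ∧ q < j)) →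
      ¬ ((v + 1 = i ∨ v + 1 = j ∨ v + 1 = k ∨ v + 1 = l ∨ v + 1 = p ∨ v + 1 = q) ∧
        (v + 2 = i ∨ v + 2 = j ∨ v + 2 = k ∨ v + 2 = l ∨ v + 2 = p ∨ v + 2 = q))) →
        TwoTri.contr v A x y := by
      rintro i j rfl rfl hno
      have := merge_spec v i
      have := merge_spec v j
      exact h.contr_of_lift (by omega) (by omega) hxy hb hno
    by_cases hx : x = v + 1
    · subst hx
      by_cases hy3 : y = v + 2
      · subst hy3
        have := contr_of_mem (v := v) (h.short_mem (i := v + 1) (j := v + 3) (by omega) (by omega)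
          (by omega)) (by simp [merge])
        simpa [merge] using this
      have hmy : merge v (y + 1) = y := by have := merge_spec v (y + 1); omega
      by_cases hcy : v < c ∧ c ≤ y + 1
      · refine hlift (v + 1) (y + 1) (by simp [merge]) hmy ?_
        rintro k l p q h1 h2 h3 ⟨-, h4⟩
        rcases hc with ⟨hc1, hc2, hc3⟩ | hc
        · have b1 := h.bound h1
          have b2 := h.bound h2
          rcases h4 with h4 | h4 | h4 | h4 | h4 | h4
          · omega
          · omega
          · subst h4; have := h.ear_right hv hc2 h1 hc1; omega
          · subst h4; exact h.ear_mixed hv hc2 h1 hc1 (by omega)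
          · subst h4; have := h.ear_right hv hc2 h2 hc1; omega
          · subst h4; exact h.ear_mixed hv hc2 h2 hc1 (by omega)
        · omega
      · refine hlift (v + 2) (y + 1) (by simp [merge]) hmy ?_
        rintro k l p q h1 h2 h3 ⟨h4, -⟩
        have b1 := h.bound h1
        have b2 := h.bound h2
        have key : ∀ o, A (v + 1) o → v + 3 < o → o < y + 1 → False := by
          intro o ho ho3 hoy
          rcases hc with ⟨hc1, hc2, hc3⟩ | ⟨hc1, hc2, hc3⟩
          · have := h.ear_right hv ho hc3 ho3; omega
          · exact h.ear_mixed hv ho hc3 ho3 hc1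
        rcases h4 with h4 | h4 | h4 | h4 | h4 | h4
        · omega
        · omega
        · subst h4; exact key _ h1 (by omega) (by omega)
        · omega
        · subst h4; exact key _ h2 (by omega) (by omega)
        · omega
    · by_cases hy1 : y = v + 1
      · subst hy1
        have hmx : merge v x = x := by have := merge_spec v x; omega
        by_cases hxv : x = v
        · subst hxv
          have := contr_of_mem (v := x) (h.short_mem (i := x) (j := x + 1) (by omega) (by omega)
            (by omega)) (by simp [merge])
          simpa [merge] using this
        by_cases hcx : v < c ∨ c ≤ x
        · refine hlift x (v + 1) hmx (by simp [merge]) ?_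
          rintro k l p q h1 h2 h3 ⟨-, h4⟩
          have b1 := h.bound h1
          have b2 := h.bound h2
          have key : ∀ o, A o (v + 2) → o < v → x < o → False := by
            intro o ho ho3 hox
            rcases hc with ⟨hc1, hc2, hc3⟩ | ⟨hc1, hc2, hc3⟩
            · exact h.ear_mixed hv hc2 ho hc1 ho3
            · have := h.ear_left hv hc2 ho ho3; omega
          rcases h4 with h4 | h4 | h4 | h4 | h4 | h4
          · omega
          · omega
          · omega
          · subst h4; exact key _ h1 (by omega) (by omega)
          · omega
          · subst h4; exact key _ h2 (by omega) (by omega)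
        · refine hlift x (v + 2) hmx (by simp [merge]) ?_
          rintro k l p q h1 h2 h3 ⟨h4, -⟩
          have b1 := h.bound h1
          have b2 := h.bound h2
          rcases hc with hc | ⟨hc1, hc2, hc3⟩
          · omega
          rcases h4 with h4 | h4 | h4 | h4 | h4 | h4
          · omega
          · omega
          · subst h4; exact h.ear_mixed hv h1 hc3 (by omega) hc1
          · subst h4; have := h.ear_left hv h1 hc3 hc1; omega
          · subst h4; exact h.ear_mixed hv h2 hc3 (by omega) hc1
          · subst h4; have := h.ear_left hv h2 hc3 hc1; omega
      · have hsec : ∀ z, z ≠ v + 1 → ∃ i, merge v i = z ∧ i ≠ v + 1 ∧ i ≠ v + 2 := by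
          intro z hz
          by_cases hzv : z ≤ v + 1
          · exact ⟨z, by have := merge_spec v z; omega, by omega, by omega⟩
          · exact ⟨z + 1, by have := merge_spec v (z + 1); omega, by omega, by omega⟩
        obtain ⟨i, hi, hi1, hi2⟩ := hsec x hx
        obtain ⟨j, hj, hj1, hj2⟩ := hsec y hy1
        refine hlift i j hi hj ?_
        rintro k l p q h1 h2 h3 ⟨h4, h5⟩
        have b1 := h.bound h1
        have b2 := h.bound h2
        have r : ∀ o o', A (v + 1) o → A (v + 2) o' → v + 3 < o → o' ≤ o :=
          fun o o' a b => h.ear_right hv a b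
        have m : ∀ o o', A (v + 1) o → A o' (v + 2) → v + 3 < o → o' < v → False :=
          fun o o' a b => h.ear_mixed hv a b
        have l' : ∀ o o', A o (v + 1) → A o' (v + 2) → o' < v → o' ≤ o :=
          fun o o' a b => h.ear_left hv a b
        rcases h4 with h4 | h4 | h4 | h4 | h4 | h4
        · omega
        · omega
        · subst h4
          rcases h5 with h5 | h5 | h5 | h5 | h5 | h5
          · omega
          · omega
          · omega
          · omega
          · subst h5; have := r _ _ h1 h2; omega
          · subst h5; exact m _ _ h1 h2 (by omega) (by omega)
        · subst h4
          rcases h5 with h5 | h5 | h5 | h5 | h5 | h5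
          · omega
          · omega
          · omega
          · omega
          · subst h5; omega
          · subst h5; have := l' _ _ h1 h2; omega
        · subst h4
          rcases h5 with h5 | h5 | h5 | h5 | h5 | h5
          · omega
          · omega
          · subst h5; omega
          · subst h5; exact m _ _ h2 h1 (by omega) (by omega)
          · omega
          · omega
        · subst h4
          rcases h5 with h5 | h5 | h5 | h5 | h5 | h5
          · omega
          · omega
          · subst h5; omega
          · subst h5; omega
          · omega
          · omega

end TwoTri

namespace TwoTri

/-- The condition selecting, among the two lifts of an edge at the merged vertex, the ones that
respect the split at `c`. -/
def Admissible (v c i j : ℕ) : Prop :=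
  (i = v + 1 → j = v + 3 ∨ (v < c ∧ c ≤ j)) ∧ (i = v + 2 → j = v + 3 ∨ c < v ∨ j ≤ c) ∧
    (j = v + 1 → i = v ∨ v < c ∨ c ≤ i) ∧ (j = v + 2 → i = v ∨ (c < v ∧ i ≤ c))

/-- Splitting the vertex `v + 1` of `B` into `v + 1` and `v + 2`, both joined to `c`. -/
def lift (v c : ℕ) (B : ℕ → ℕ → Prop) (i j : ℕ) : Prop :=
  (i = v + 1 ∧ j = v + 2) ∨ (B (merge v i) (merge v j) ∧ Admissible v c i j)

/-- The edge of `B` at which the vertex `v + 1` can be split. -/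
def Splits (v c : ℕ) (B : ℕ → ℕ → Prop) : Prop :=
  (v + 3 < c ∧ B (v + 1) (c - 1)) ∨ (c < v ∧ B c (v + 1))

lemma Tri.lift_surj {N : ℕ} {B : ℕ → ℕ → Prop} (h : Tri N B) {v c : ℕ}
    (hc0 : v + 3 < c ∨ c < v) {k l : ℕ} (hB : B k l) :
    ∃ i j, lift v c B i j ∧ merge v i = k ∧ merge v j = l := by
  have hkl := h.bound hB
  have key : ∀ i j, merge v i = k → merge v j = l → Admissible v c i j →
      ∃ i j, lift v c B i j ∧ merge v i = k ∧ merge v j = l := by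
    intro i j hi hj hadm
    exact ⟨i, j, Or.inr ⟨by rw [hi, hj]; exact hB, hadm⟩, hi, hj⟩
  have m0 : ∀ x, x ≤ v + 1 → merge v x = x := fun x hx => by have := merge_spec v x; omega
  have m1 : ∀ x, v + 1 ≤ x → merge v (x + 1) = x := fun x hx => by
    have := merge_spec v (x + 1); omega
  by_cases hk : k = v + 1
  · by_cases hc : l = v + 2 ∨ (v < c ∧ c ≤ l + 1)
    · exact key (v + 1) (l + 1) (by rw [m0]; omega; omega) (m1 l (by omega))
        (by unfold Admissible; omega)
    · exact key (v + 2) (l + 1) (by rw [m1]; omega; omega) (m1 l (by omega))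
        (by unfold Admissible; omega)
  · by_cases hl : l = v + 1
    · by_cases hc : k = v ∨ v < c ∨ c ≤ k
      · exact key k (v + 1) (m0 k (by omega)) (by rw [m0]; omega; omega)
          (by unfold Admissible; omega)
      · exact key k (v + 2) (m0 k (by omega)) (by rw [m1]; omega; omega)
          (by unfold Admissible; omega)
    · by_cases hk' : k ≤ v + 1 <;> by_cases hl' : l ≤ v + 1
      · exact key k l (m0 k hk') (m0 l hl') (by unfold Admissible; omega)
      · exact key k (l + 1) (m0 k hk') (m1 l (by omega)) (by unfold Admissible; omega)
      · omega
      · exact key (k + 1) (l + 1) (m1 k (by omega)) (m1 l (by omega))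
          (by unfold Admissible; omega)

/-- Splitting a vertex gives a `2`-triangulation. -/
theorem Tri.lift {N : ℕ} {B : ℕ → ℕ → Prop} (h : Tri N B) {v c : ℕ}
    (hv : v + 3 ≤ N) (hc : Splits v c B) : Tri (N + 1) (lift v c B) := by
  have hcv : v + 3 < c ∨ c < v := hc.imp And.left And.left
  have hear : TwoTri.lift v c B v (v + 3) := by
    refine Or.inr ⟨?_, by unfold Admissible; omega⟩
    have e1 : merge v v = v := by have := merge_spec v v; omega
    have e2 : merge v (v + 3) = v + 2 := by have := merge_spec v (v + 3); omega
    rw [e1, e2]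
    exact h.short_mem (by omega) (by omega) (by omega)
  refine ⟨?_, ?_, ?_⟩
  · rintro i j (⟨rfl, rfl⟩ | ⟨hB, -⟩)
    · omega
    · have := h.bound hB
      have := merge_spec v i
      have := merge_spec v j
      omega
  · intro i₁ i₂ i₃ j₁ j₂ j₃ h₁ h₂ h₃ a1 a2 a3 a4 a5
    rcases h₁ with h₁ | ⟨h₁, b₁⟩
    · omega
    rcases h₂ with h₂ | ⟨h₂, b₂⟩
    · omega
    rcases h₃ with h₃ | ⟨h₃, b₃⟩
    · omega
    unfold Admissible at b₁ b₂ b₃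
    refine h.free h₁ h₂ h₃ (merge_lt a1 ?_) (merge_lt a2 ?_) (merge_lt a3 ?_) (merge_lt a4 ?_)
      (merge_lt a5 ?_)
    · clear b₃; omega
    · clear b₁; omega
    · clear b₂; omega
    · clear b₃; omega
    · clear b₁; omega
  · intro i j hij hj hb
    by_contra hL
    by_cases hm : merge v i < merge v j
    · by_cases hB : B (merge v i) (merge v j)
      · have hadm : ¬ Admissible v c i j := fun h' => hL (Or.inr ⟨hB, h'⟩)
        have hle := h.bound hB
        have si := merge_spec v i
        have sj := merge_spec v j
        have hc1 : v + 3 < c → TwoTri.lift v c B (v + 1) c ∧ TwoTri.lift v c B (v + 2) c := by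
          intro hc3
          have e1 : merge v c = c - 1 := by have := merge_spec v c; omega
          have e2 : merge v (v + 1) = v + 1 := by have := merge_spec v (v + 1); omega
          have e3 : merge v (v + 2) = v + 1 := by have := merge_spec v (v + 2); omega
          have hb' : B (v + 1) (c - 1) := by
            rcases hc with hc | hc
            · exact hc.2
            · omega
          exact ⟨Or.inr ⟨by rw [e1, e2]; exact hb', by unfold Admissible; omega⟩,
            Or.inr ⟨by rw [e1, e3]; exact hb', by unfold Admissible; omega⟩⟩
        have hc2 : c < v → TwoTri.lift v c B c (v + 1) ∧ TwoTri.lift v c B c (v + 2) := by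
          intro hc3
          have e1 : merge v c = c := by have := merge_spec v c; omega
          have e2 : merge v (v + 1) = v + 1 := by have := merge_spec v (v + 1); omega
          have e3 : merge v (v + 2) = v + 1 := by have := merge_spec v (v + 2); omega
          have hb' : B c (v + 1) := by
            rcases hc with hc | hc
            · omega
            · exact hc.2
          exact ⟨Or.inr ⟨by rw [e1, e2]; exact hb', by unfold Admissible; omega⟩,
            Or.inr ⟨by rw [e1, e3]; exact hb', by unfold Admissible; omega⟩⟩
        unfold Admissible at hadm
        apply hb
        rcases hcv with hcv | hcv
        · obtain ⟨f1, f2⟩ := hc1 hcv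
          by_cases hi1 : i = v + 1
          · exact ⟨v, v + 3, v + 2, c, hear, f2, by omega⟩
          by_cases hi2 : i = v + 2
          · exact ⟨v, v + 3, v + 1, c, hear, f1, by omega⟩
          · exact ⟨v, v + 3, v + 1, c, hear, f1, by omega⟩
        · obtain ⟨f1, f2⟩ := hc2 hcv
          by_cases hi1 : i = v + 1
          · exact ⟨c, v + 2, v, v + 3, f2, hear, by omega⟩
          by_cases hj1 : j = v + 1
          · exact ⟨c, v + 2, v, v + 3, f2, hear, by omega⟩
          · exact ⟨c, v + 1, v, v + 3, f1, hear, by omega⟩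
      · have : Blocked B (merge v i) (merge v j) := by
          by_contra hnb
          refine hB (h.max hm ?_ hnb)
          have := merge_spec v j
          omega
        obtain ⟨k, l, p, q, h1, h2, h3⟩ := this
        obtain ⟨k, l, f1, rfl, rfl⟩ := h.lift_surj hcv h1
        obtain ⟨p, q, f2, rfl, rfl⟩ := h.lift_surj hcv h2
        refine hb ⟨k, l, p, q, f1, f2, ?_⟩
        rcases h3 with ⟨a1, a2, a3, a4, a5⟩ | ⟨a1, a2, a3, a4, a5⟩ | ⟨a1, a2, a3, a4, a5⟩
        · exact Or.inl ⟨lt_of_merge_lt a1, lt_of_merge_lt a2, lt_of_merge_lt a3,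
            lt_of_merge_lt a4, lt_of_merge_lt a5⟩
        · exact Or.inr (Or.inl ⟨lt_of_merge_lt a1, lt_of_merge_lt a2, lt_of_merge_lt a3,
            lt_of_merge_lt a4, lt_of_merge_lt a5⟩)
        · exact Or.inr (Or.inr ⟨lt_of_merge_lt a1, lt_of_merge_lt a2, lt_of_merge_lt a3,
            lt_of_merge_lt a4, lt_of_merge_lt a5⟩)
    · refine hL (Or.inl ?_)
      have := merge_spec v i
      have := merge_spec v j
      omega

/-- One endpoint of `(a, b)` is `v + 1` or `v + 2`, the other one is joined to both. -/
def AtCommon (A : ℕ → ℕ → Prop) (v a b : ℕ) : Prop :=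
  (a = v + 1 ∧ Common A v b) ∨ (a = v + 2 ∧ Common A v b) ∨ (b = v + 1 ∧ Common A v a) ∨
    (b = v + 2 ∧ Common A v a)

lemma Tri.atCommon_of_twin {n : ℕ} {A : ℕ → ℕ → Prop} (h : Tri n A) {v a b i j : ℕ}
    (hab : A a b) (hr : a + 3 ≤ b) (hr' : b + 3 ≤ a + n)
    (hij : A i j) (hi : merge v i = merge v a) (hj : merge v j = merge v b)
    (hne : ¬ (i = a ∧ j = b)) : AtCommon A v a b := by
  have sa := merge_spec v a
  have sb := merge_spec v b
  have si := merge_spec v i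
  have sj := merge_spec v j
  have hij' := h.bound hij
  have hab' := h.bound hab
  by_cases hia : i = a
  · subst hia
    by_cases hb : b = v + 1
    · have hj2 : j = v + 2 := by omega
      subst hb hj2
      exact Or.inr (Or.inr (Or.inl ⟨rfl, Or.inr ⟨by omega, hab, hij⟩⟩))
    · have hb2 : b = v + 2 := by omega
      have hj2 : j = v + 1 := by omega
      subst hb2 hj2
      have : i ≠ v := by omega
      exact Or.inr (Or.inr (Or.inr ⟨rfl, Or.inr ⟨by omega, hij, hab⟩⟩))
  · by_cases ha : a = v + 1
    · have hi2 : i = v + 2 := by omega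
      have hjb : j = b := by omega
      subst ha hi2 hjb
      exact Or.inl ⟨rfl, Or.inl ⟨by omega, hab, hij⟩⟩
    · have ha2 : a = v + 2 := by omega
      have hi2 : i = v + 1 := by omega
      have hjb : j = b := by omega
      subst ha2 hi2 hjb
      exact Or.inr (Or.inl ⟨rfl, Or.inl ⟨by omega, hij, hab⟩⟩)

lemma Tri.merge_relevant {N : ℕ} {A : ℕ → ℕ → Prop} (h : Tri (N + 1) A) (hN : 5 ≤ N) {v a b : ℕ}
    (hv : v + 3 ≤ N)
    (hab : A a b) (hr : a + 3 ≤ b) (hr' : b + 3 ≤ a + (N + 1)) (hne : ¬ (a = v ∧ b = v + 3))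
    (hc : ¬ AtCommon A v a b) :
    merge v a + 3 ≤ merge v b ∧ merge v b + 3 ≤ merge v a + N := by
  by_contra hcon
  have sa := merge_spec v a
  have sb := merge_spec v b
  have hab' := h.bound hab
  have hcase : (a + 1 = v ∧ b = v + 2) ∨ (a = v + 1 ∧ b = v + 4) ∨
      (a = 0 ∧ b = v + 1 ∧ N = v + 3) ∨ (a = 2 ∧ b = N ∧ v = 0) := by omega
  rcases hcase with ⟨rfl, rfl⟩ | ⟨rfl, rfl⟩ | ⟨rfl, rfl, rfl⟩ | ⟨rfl, rfl, rfl⟩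
  · exact hc (Or.inr (Or.inr (Or.inr ⟨rfl, Or.inr ⟨by omega,
      h.short_mem (by omega) (by omega) (by omega), hab⟩⟩)))
  · exact hc (Or.inl ⟨rfl, Or.inl ⟨by omega, hab,
      h.short_mem (by omega) (by omega) (by omega)⟩⟩)
  · exact hc (Or.inr (Or.inr (Or.inl ⟨rfl, Or.inr ⟨by omega, hab,
      h.short_mem (by omega) (by omega) (by omega)⟩⟩)))
  · exact hc (Or.inr (Or.inl ⟨rfl, Or.inl ⟨by omega,
      h.short_mem (by omega) (by omega) (by omega), hab⟩⟩))

lemma exists_max_of_bounded {P : ℕ → Prop} {x b : ℕ} (hx : P x) (hb : ∀ y, P y → y ≤ b) :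
    ∃ m, P m ∧ ∀ y, P y → y ≤ m := by
  classical
  exact ⟨Nat.findGreatest P b, Nat.findGreatest_spec (hb x hx) hx,
    fun y hy => Nat.le_findGreatest (hb y hy) hy⟩

lemma exists_min {P : ℕ → Prop} {x : ℕ} (hx : P x) : ∃ m, P m ∧ ∀ y, P y → m ≤ y := by
  classical
  exact ⟨Nat.find ⟨x, hx⟩, Nat.find_spec ⟨x, hx⟩, fun y hy => Nat.find_le hy⟩

lemma Tri.contr_mem {n : ℕ} {A : ℕ → ℕ → Prop} (h : Tri n A) {v i j : ℕ} (hA : A i j)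
    (hne : ¬ (i = v + 1 ∧ j = v + 2)) : TwoTri.contr v A (merge v i) (merge v j) :=
  contr_of_mem hA (merge_lt (h.bound hA).1 (by omega))

/-- If `(a, b)` is one of the two edges at the common neighbour, there is another place to split
the contraction, which exchanges `(a, b)`. -/
lemma Tri.exists_split {N : ℕ} {A : ℕ → ℕ → Prop} (h : Tri (N + 1) A) (hN : 5 ≤ N) {v a b : ℕ}
    (hv : A v (v + 3)) (hab : A a b) (hr : a + 3 ≤ b) (hr' : b + 3 ≤ a + (N + 1))
    (hc : AtCommon A v a b) :
    ∃ c', Splits v c' (TwoTri.contr v A) ∧ ¬ Admissible v c' a b ∧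
      ∀ i j, A i j → ¬ (i = a ∧ j = b) → ¬ (i = v + 1 ∧ j = v + 2) → Admissible v c' i j := by
  have hvN := h.bound hv
  have habN := h.bound hab
  have e1 : merge v (v + 1) = v + 1 := by have := merge_spec v (v + 1); omega
  have e2 : merge v (v + 2) = v + 1 := by have := merge_spec v (v + 2); omega
  have eR : ∀ x, v + 3 < x → merge v x = x - 1 := fun x hx => by have := merge_spec v x; omega
  have eL : ∀ x, x < v → merge v x = x := fun x hx => by have := merge_spec v x; omega
  have s1R : ∀ x, A (v + 1) x → v + 3 < x → Splits v x (TwoTri.contr v A) := fun x hx h3 =>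
    Or.inl ⟨h3, by have := h.contr_mem (v := v) hx (by omega); rwa [e1, eR x h3] at this⟩
  have s2R : ∀ x, A (v + 2) x → v + 3 < x → Splits v x (TwoTri.contr v A) := fun x hx h3 =>
    Or.inl ⟨h3, by have := h.contr_mem (v := v) hx (by omega); rwa [e2, eR x h3] at this⟩
  have s1L : ∀ x, A x (v + 1) → x < v → Splits v x (TwoTri.contr v A) := fun x hx h3 =>
    Or.inr ⟨h3, by have := h.contr_mem (v := v) hx (by omega); rwa [e1, eL x h3] at this⟩
  have s2L : ∀ x, A x (v + 2) → x < v → Splits v x (TwoTri.contr v A) := fun x hx h3 =>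
    Or.inr ⟨h3, by have := h.contr_mem (v := v) hx (by omega); rwa [e2, eL x h3] at this⟩
  have fR : ∀ o o', A (v + 1) o → A (v + 2) o' → v + 3 < o → o' ≤ o :=
    fun o o' a b => h.ear_right hv a b
  have fM : ∀ o o', A (v + 1) o → A o' (v + 2) → v + 3 < o → ¬ o' < v :=
    fun o o' a b c d => h.ear_mixed hv a b c d
  have fL : ∀ o o', A o (v + 1) → A o' (v + 2) → o' < v → o' ≤ o :=
    fun o o' a b => h.ear_left hv a b
  have hadm : ∀ c', (∀ o, A (v + 1) o → ¬ (v + 1 = a ∧ o = b) → v + 3 < o → v < c' ∧ c' ≤ o) →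
      (∀ o, A (v + 2) o → ¬ (v + 2 = a ∧ o = b) → v + 3 < o → c' < v ∨ o ≤ c') →
      (∀ o, A o (v + 1) → ¬ (o = a ∧ v + 1 = b) → o < v → v < c' ∨ c' ≤ o) →
      (∀ o, A o (v + 2) → ¬ (o = a ∧ v + 2 = b) → o < v → c' < v ∧ o ≤ c') →
      ∀ i j, A i j → ¬ (i = a ∧ j = b) → ¬ (i = v + 1 ∧ j = v + 2) → Admissible v c' i j := by
    intro c' g1 g2 g3 g4 i j hij hne hne'
    have hb := h.bound hij
    refine ⟨?_, ?_, ?_, ?_⟩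
    · rintro rfl
      by_cases hj : v + 3 < j
      · exact Or.inr (g1 j hij hne hj)
      · left; omega
    · rintro rfl
      by_cases hj : v + 3 < j
      · exact Or.inr (g2 j hij hne hj)
      · left; omega
    · rintro rfl
      by_cases hj : i < v
      · exact Or.inr (g3 i hij hne hj)
      · left; omega
    · rintro rfl
      by_cases hj : i < v
      · exact Or.inr (g4 i hij hne hj)
      · left; omega
  rcases hc with ⟨rfl, hc⟩ | ⟨rfl, hc⟩ | ⟨rfl, hc⟩ | ⟨rfl, hc⟩
  · rcases hc with ⟨hb3, -, hb2⟩ | ⟨hb3, -, -⟩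
    swap
    · omega
    by_cases hex : ∃ x, b < x ∧ A (v + 1) x
    · obtain ⟨x, hx⟩ := hex
      obtain ⟨c', ⟨hbc, hAc⟩, hmin⟩ := exists_min (P := fun x => b < x ∧ A (v + 1) x) hx
      refine ⟨c', s1R c' hAc (by omega), by unfold Admissible; omega, hadm c' ?_ ?_ ?_ ?_⟩
      · intro o ho hne ho3
        have := fR o b ho hb2 ho3
        have := hmin o ⟨by omega, ho⟩
        omega
      · intro o ho hne ho3
        have := fR b o hab ho hb3
        omega
      · intro o ho hne ho3; omega
      · intro o ho hne ho3
        have := fM b o hab ho hb3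
        omega
    · have hex' : ∀ x, b < x → ¬ A (v + 1) x := fun x h1 h2 => hex ⟨x, h1, h2⟩
      have hv1 : 1 ≤ v := by
        by_contra hv0
        exact hex' N (by omega) (h.short_mem (by omega) (by omega) (by omega))
      have hsh : A (v - 1) (v + 1) := h.short_mem (by omega) (by omega) (by omega)
      obtain ⟨c', ⟨hcv, hAc⟩, hmin⟩ := exists_min (P := fun x => x < v ∧ A x (v + 1))
        ⟨by omega, hsh⟩
      refine ⟨c', s1L c' hAc hcv, by unfold Admissible; omega, hadm c' ?_ ?_ ?_ ?_⟩
      · intro o ho hne ho3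
        have := fR o b ho hb2 ho3
        exact absurd ho (hex' o (by omega))
      · intro o ho hne ho3; omega
      · intro o ho hne ho3
        exact Or.inr (hmin o ⟨ho3, ho⟩)
      · intro o ho hne ho3
        have := fM b o hab ho hb3
        omega
  · rcases hc with ⟨hb3, hb1, -⟩ | ⟨hb3, -, -⟩
    swap
    · omega
    have h4 : A (v + 2) (v + 4) := h.short_mem (by omega) (by omega) (by omega)
    obtain ⟨c', ⟨hcb, hc3, hAc⟩, hmax⟩ := exists_max_of_bounded
      (P := fun x => x < b ∧ v + 3 < x ∧ A (v + 2) x) (b := b) ⟨by omega, by omega, h4⟩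
      (fun y hy => hy.1.le)
    refine ⟨c', s2R c' hAc hc3, by unfold Admissible; omega, hadm c' ?_ ?_ ?_ ?_⟩
    · intro o ho hne ho3
      have := fR o b ho hab ho3
      omega
    · intro o ho hne ho3
      have := fR b o hb1 ho hb3
      exact Or.inr (hmax o ⟨by omega, ho3, ho⟩)
    · intro o ho hne ho3; omega
    · intro o ho hne ho3
      have := fM b o hb1 ho hb3
      omega
  · rcases hc with ⟨hb3, -, -⟩ | ⟨ha3, -, ha2⟩
    · omega
    have hsh : A (v - 1) (v + 1) := h.short_mem (by omega) (by omega) (by omega)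
    obtain ⟨c', ⟨hca, hcv, hAc⟩, hmin⟩ := exists_min
      (P := fun x => a < x ∧ x < v ∧ A x (v + 1)) ⟨by omega, by omega, hsh⟩
    refine ⟨c', s1L c' hAc hcv, by unfold Admissible; omega, hadm c' ?_ ?_ ?_ ?_⟩
    · intro o ho hne ho3
      have := fM o a ho ha2 ho3
      omega
    · intro o ho hne ho3; omega
    · intro o ho hne ho3
      have := fL o a ho ha2 ha3
      exact Or.inr (hmin o ⟨by omega, ho3, ho⟩)
    · intro o ho hne ho3
      have := fL a o hab ho ho3
      omega
  · rcases hc with ⟨hb3, -, -⟩ | ⟨ha3, ha1, -⟩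
    · omega
    by_cases hex : ∃ x, x < a ∧ A x (v + 2)
    · obtain ⟨x, hx⟩ := hex
      obtain ⟨c', ⟨hca, hAc⟩, hmax⟩ := exists_max_of_bounded
        (P := fun x => x < a ∧ A x (v + 2)) (b := a) hx (fun y hy => hy.1.le)
      refine ⟨c', s2L c' hAc (by omega), by unfold Admissible; omega, hadm c' ?_ ?_ ?_ ?_⟩
      · intro o ho hne ho3
        have := fM o a ho hab ho3
        omega
      · intro o ho hne ho3; omega
      · intro o ho hne ho3
        have := fL o a ho hab ha3
        omega
      · intro o ho hne ho3
        have := fL a o ha1 ho ho3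
        have := hmax o ⟨by omega, ho⟩
        omega
    · have hex' : ∀ x, x < a → ¬ A x (v + 2) := fun x h1 h2 => hex ⟨x, h1, h2⟩
      have hv4 : v + 4 ≤ N := by
        by_contra hv0
        exact hex' 0 (by omega) (h.short_mem (by omega) (by omega) (by omega))
      have h4 : A (v + 2) (v + 4) := h.short_mem (by omega) (by omega) (by omega)
      obtain ⟨c', ⟨hc3, hAc⟩, hmax⟩ := exists_max_of_bounded
        (P := fun x => v + 3 < x ∧ A (v + 2) x) (b := N) ⟨by omega, h4⟩
        (fun y hy => by have := h.bound hy.2; omega)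
      refine ⟨c', s2R c' hAc hc3, by unfold Admissible; omega, hadm c' ?_ ?_ ?_ ?_⟩
      · intro o ho hne ho3
        have := fM o a ho hab ho3
        omega
      · intro o ho hne ho3
        exact Or.inr (hmax o ⟨ho3, ho⟩)
      · intro o ho hne ho3; omega
      · intro o ho hne ho3
        have := fL a o ha1 ho ho3
        exact absurd ho (hex' o (by omega))

/-- Every edge of length at least `3` of a `2`-triangulation can be exchanged. -/
theorem Tri.exists_flip {n : ℕ} (hn : 5 ≤ n) {A : ℕ → ℕ → Prop} (h : Tri n A) {a b : ℕ}
    (hab : A a b) (hr : a + 3 ≤ b) (hr' : b + 3 ≤ a + n) :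
    ∃ A', Tri n A' ∧ ¬ A' a b ∧ ∀ i j, A i j → ¬ (i = a ∧ j = b) → A' i j := by
  induction n, hn using Nat.le_induction generalizing A a b with
  | base => omega
  | succ N hN ih =>
    obtain ⟨v, hv, hne⟩ := h.exists_ear_ne (by omega) a b
    have hvN := h.bound hv
    by_cases hc : AtCommon A v a b
    · obtain ⟨c', hs, hna, hadm⟩ := h.exists_split hN hv hab hr hr' hc
      refine ⟨TwoTri.lift v c' (TwoTri.contr v A), (h.contr hN hv).lift (by omega) hs, ?_, ?_⟩
      · rintro (h' | h')
        · omega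
        · exact hna h'.2
      · intro i j hij hne'
        by_cases hs' : i = v + 1 ∧ j = v + 2
        · exact Or.inl hs'
        · exact Or.inr ⟨h.contr_mem hij hs', hadm i j hij hne' hs'⟩
    · obtain ⟨hr1, hr2⟩ := h.merge_relevant hN (by omega) hab hr hr' (by omega) hc
      obtain ⟨B, hB, hnB, hBA⟩ := ih (h.contr hN hv) (h.contr_mem hab (by omega)) hr1 hr2
      have hBA' : ∀ i j, A i j → ¬ (i = a ∧ j = b) → ¬ (i = v + 1 ∧ j = v + 2) →
          B (merge v i) (merge v j) := by
        intro i j hij hne1 hne2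
        refine hBA _ _ (h.contr_mem hij hne2) ?_
        rintro ⟨h1, h2⟩
        exact hc (h.atCommon_of_twin hab hr hr' hij h1 h2 hne1)
      obtain ⟨c, hcom⟩ := h.exists_common (by omega) hv
      have fR : ∀ o o', A (v + 1) o → A (v + 2) o' → v + 3 < o → o' ≤ o :=
        fun o o' a b => h.ear_right hv a b
      have fM : ∀ o o', A (v + 1) o → A o' (v + 2) → v + 3 < o → ¬ o' < v :=
        fun o o' a b c d => h.ear_mixed hv a b c d
      have fL : ∀ o o', A o (v + 1) → A o' (v + 2) → o' < v → o' ≤ o :=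
        fun o o' a b => h.ear_left hv a b
      have hs : Splits v c B := by
        rcases hcom with ⟨h3, h1, h2⟩ | ⟨h3, h1, h2⟩
        · refine Or.inl ⟨h3, ?_⟩
          have := hBA' _ _ h1 (fun hh => hc (Or.inl ⟨hh.1.symm, Or.inl ⟨by omega, hh.2 ▸ h1,
            hh.2 ▸ h2⟩⟩)) (by omega)
          have e1 := merge_spec v (v + 1)
          have e2 := merge_spec v c
          rwa [show merge v (v + 1) = v + 1 by omega, show merge v c = c - 1 by omega] at this
        · refine Or.inr ⟨h3, ?_⟩
          have := hBA' _ _ h1 (fun hh => hc (Or.inr (Or.inr (Or.inl ⟨hh.2.symm, Or.inr ⟨by omega,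
            hh.1 ▸ h1, hh.1 ▸ h2⟩⟩)))) (by omega)
          have e1 := merge_spec v (v + 1)
          have e2 := merge_spec v c
          rwa [show merge v (v + 1) = v + 1 by omega, show merge v c = c by omega] at this
      refine ⟨TwoTri.lift v c B, hB.lift (by omega) hs, ?_, ?_⟩
      · rintro (h' | h')
        · omega
        · exact hnB h'.1
      · intro i j hij hne'
        by_cases hs' : i = v + 1 ∧ j = v + 2
        · exact Or.inl hs'
        · refine Or.inr ⟨hBA' i j hij hne' hs', ?_⟩
          have hb := h.bound hij
          rcases hcom with ⟨h3, h1, h2⟩ | ⟨h3, h1, h2⟩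
          · refine ⟨?_, ?_, ?_, ?_⟩
            · rintro rfl; have := fR j c hij h2; omega
            · rintro rfl; have := fR c j h1 hij h3; omega
            · rintro rfl; omega
            · rintro rfl; have := fM c i h1 hij h3; omega
          · refine ⟨?_, ?_, ?_, ?_⟩
            · rintro rfl; have := fM j c hij h2; omega
            · rintro rfl; omega
            · rintro rfl; have := fL i c hij h2 h3; omega
            · rintro rfl; have := fL c i h1 hij; omega

end TwoTri

namespace TwoTri

lemma Tri.finite {n : ℕ} {A : ℕ → ℕ → Prop} (h : Tri n A) : {p : ℕ × ℕ | A p.1 p.2}.Finite :=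
  (((Finset.range n) ×ˢ (Finset.range n)).finite_toSet).subset fun p hp => by
    have := h.bound hp
    simp
    omega

lemma merge_eq {v i i' : ℕ} (h : merge v i = merge v i') :
    i = i' ∨ (i = v + 1 ∧ i' = v + 2) ∨ (i = v + 2 ∧ i' = v + 1) := by
  have := merge_spec v i
  have := merge_spec v i'
  omega

/-- Contraction below an ear loses exactly four edges. -/
lemma Tri.ncard_contr {N : ℕ} {A : ℕ → ℕ → Prop} (h : Tri (N + 1) A) (hN : 5 ≤ N) {v : ℕ}
    (hv : A v (v + 3)) :
    {p : ℕ × ℕ | A p.1 p.2}.ncard = {p : ℕ × ℕ | TwoTri.contr v A p.1 p.2}.ncard + 4 := by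
  classical
  have hvN := h.bound hv
  obtain ⟨c, hc⟩ := h.exists_common (by omega) hv
  have hcv : v + 3 < c ∨ c < v := hc.imp And.left And.left
  set p₀ : ℕ × ℕ := if c < v then (c, v + 2) else (v + 2, c) with hp₀
  have hp₀A : A p₀.1 p₀.2 := by
    rw [hp₀]
    rcases hc with hc | hc
    · rw [if_neg (by omega)]; exact hc.2.2
    · rw [if_pos hc.1]; exact hc.2.2
  let R : Finset (ℕ × ℕ) := {(v + 1, v + 2), (v, v + 2), (v + 2, v + 3), p₀}
  have hR : R.card = 4 := by
    have h1 : (v + 1, v + 2) ≠ p₀ := by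
      rw [hp₀]; split_ifs <;> simp only [ne_eq, Prod.mk.injEq] <;> omega
    have h2 : (v, v + 2) ≠ p₀ := by
      rw [hp₀]; split_ifs <;> simp only [ne_eq, Prod.mk.injEq] <;> omega
    have h3 : (v + 2, v + 3) ≠ p₀ := by
      rw [hp₀]; split_ifs <;> simp only [ne_eq, Prod.mk.injEq] <;> omega
    simp only [R]
    rw [Finset.card_insert_of_notMem, Finset.card_insert_of_notMem, Finset.card_insert_of_notMem,
      Finset.card_singleton]
    · simpa using h3
    · simp [h2]
    · simp [h1]
  have hRA : (R : Set (ℕ × ℕ)) ⊆ {p | A p.1 p.2} := by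
    intro p hp
    simp only [R, Finset.coe_insert, Finset.coe_singleton, Set.mem_insert_iff,
      Set.mem_singleton_iff] at hp
    rcases hp with rfl | rfl | rfl | rfl
    · exact h.short_mem (by omega) (by omega) (by omega)
    · exact h.short_mem (by omega) (by omega) (by omega)
    · exact h.short_mem (by omega) (by omega) (by omega)
    · exact hp₀A
  have hdiff : ({p : ℕ × ℕ | A p.1 p.2} \ R).ncard + 4 = {p : ℕ × ℕ | A p.1 p.2}.ncard := by
    rw [← hR, ← Set.ncard_coe_finset]
    exact Set.ncard_sdiff_add_ncard_of_subset hRA h.finite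
  rw [← hdiff]
  congr 1
  have himg : (fun p : ℕ × ℕ => (merge v p.1, merge v p.2)) '' ({p : ℕ × ℕ | A p.1 p.2} \ R) =
      {p : ℕ × ℕ | TwoTri.contr v A p.1 p.2} := by
    ext ⟨x, y⟩
    constructor
    · rintro ⟨⟨i, j⟩, ⟨hij, hnR⟩, heq⟩
      simp only [Prod.mk.injEq] at heq
      obtain ⟨rfl, rfl⟩ := heq
      refine h.contr_mem hij fun hh => hnR ?_
      simp [R, hh.1, hh.2]
    · rintro ⟨hxy, i, j, hij, rfl, rfl⟩
      by_cases hmem : (i, j) ∈ R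
      · have hex : ∃ i' j', A i' j' ∧ merge v i' = merge v i ∧ merge v j' = merge v j ∧
            i' ≠ v + 2 ∧ j' ≠ v + 2 := by
          have e1 : merge v (v + 1) = merge v (v + 2) := by
            have := merge_spec v (v + 1); have := merge_spec v (v + 2); omega
          simp only [R, Finset.mem_insert, Finset.mem_singleton, Prod.mk.injEq] at hmem
          rcases hmem with ⟨rfl, rfl⟩ | ⟨rfl, rfl⟩ | ⟨rfl, rfl⟩ | hmem
          · omega
          · exact ⟨i, i + 1, h.short_mem (by omega) (by omega) (by omega), rfl, e1, by omega,
              by omega⟩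
          · exact ⟨v + 1, v + 3, h.short_mem (by omega) (by omega) (by omega), e1, rfl, by omega,
              by omega⟩
          · rw [hp₀] at hmem
            rcases hc with hc | hc
            · rw [if_neg (by omega)] at hmem
              simp only [Prod.mk.injEq] at hmem
              obtain ⟨rfl, rfl⟩ := hmem
              exact ⟨v + 1, j, hc.2.1, e1, rfl, by omega, by omega⟩
            · rw [if_pos hc.1] at hmem
              simp only [Prod.mk.injEq] at hmem
              obtain ⟨rfl, rfl⟩ := hmem
              exact ⟨i, v + 1, hc.2.1, rfl, e1, by omega, by omega⟩
        obtain ⟨i', j', hA, hi, hj, hi2, hj2⟩ := hex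
        refine ⟨(i', j'), ⟨hA, ?_⟩, by simp [hi, hj]⟩
        intro hmem'
        have hor : p₀.1 = v + 2 ∨ p₀.2 = v + 2 := by
          rw [hp₀]; split_ifs <;> simp
        simp only [R, Finset.coe_insert, Finset.coe_singleton, Set.mem_insert_iff,
          Set.mem_singleton_iff, Prod.mk.injEq] at hmem'
        rcases hmem' with hh | hh | hh | hh
        · omega
        · omega
        · omega
        · rw [← hh] at hor
          simp only at hor
          omega
      · exact ⟨(i, j), ⟨hij, by simpa using hmem⟩, rfl⟩
  rw [← himg, Set.InjOn.ncard_image]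
  have twin : ∀ i j i' j', A i j → A i' j' → (i, j) ∉ R → merge v i = merge v i' →
      merge v j = merge v j' → (i = v + 2 ∧ i' = v + 1 ∨ j = v + 2 ∧ j' = v + 1) → False := by
    intro i j i' j' hA hA' hnR hi hj hcase
    have b1 := h.bound hA
    have b2 := h.bound hA'
    have s1 := merge_spec v i
    have s2 := merge_spec v i'
    have s3 := merge_spec v j
    have s4 := merge_spec v j'
    simp only [R, Finset.mem_insert, Finset.mem_singleton, Prod.mk.injEq, not_or] at hnR
    obtain ⟨n1, n2, n3, n4⟩ := hnR
    rcases hcase with ⟨rfl, rfl⟩ | ⟨rfl, rfl⟩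
    · have hjj : j = j' := by omega
      subst hjj
      have := h.common_unique hv hc (Or.inl ⟨by omega, hA', hA⟩)
      subst this
      rw [hp₀, if_neg (by omega)] at n4
      exact n4 rfl
    · have hii : i = i' := by omega
      subst hii
      have := h.common_unique hv hc (Or.inr ⟨by omega, hA', hA⟩)
      subst this
      rw [hp₀, if_pos (by omega)] at n4
      exact n4 rfl
  rintro ⟨i, j⟩ ⟨hA, hnR⟩ ⟨i', j'⟩ ⟨hA', hnR'⟩ heq
  simp only [Prod.mk.injEq] at heq
  obtain ⟨hi, hj⟩ := heq
  have t1 := twin i j i' j' hA hA' hnR hi hj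
  have t2 := twin i' j' i j hA' hA hnR' hi.symm hj.symm
  rcases merge_eq hi with rfl | hi' | hi'
  · rcases merge_eq hj with rfl | hj' | hj'
    · rfl
    · exact (t2 (Or.inr ⟨hj'.2, hj'.1⟩)).elim
    · exact (t1 (Or.inr hj')).elim
  · exact (t2 (Or.inl ⟨hi'.2, hi'.1⟩)).elim
  · exact (t1 (Or.inl hi')).elim

/-- A `2`-triangulation of the `n`-gon has `4 n - 10` edges. -/
theorem Tri.ncard {n : ℕ} (hn : 5 ≤ n) {A : ℕ → ℕ → Prop} (h : Tri n A) :
    {p : ℕ × ℕ | A p.1 p.2}.ncard + 10 = 4 * n := by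
  induction n, hn using Nat.le_induction generalizing A with
  | base =>
    have : {p : ℕ × ℕ | A p.1 p.2} =
        (((Finset.range 5) ×ˢ (Finset.range 5)).filter (fun p => p.1 < p.2) : Finset (ℕ × ℕ)) := by
      ext ⟨i, j⟩
      simp only [Set.mem_ofPred_eq, Finset.coe_filter, Finset.mem_product, Finset.mem_range]
      constructor
      · intro hA
        have := h.bound hA
        omega
      · intro hA
        exact h.short_mem (by omega) (by omega) (by omega)
    rw [this, Set.ncard_coe_finset]
    decide
  | succ N hN ih =>
    obtain ⟨v, hv, -⟩ := h.exists_ear_ne (by omega) 0 0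
    rw [h.ncard_contr hN hv]
    have := ih (h.contr hN hv)
    omega

end TwoTri

namespace TwoTri

open FlipFan

/-- The pair of natural numbers `i < j < n` as a pair of vertices. -/
def mkPair {n : ℕ} (i j : ℕ) (hij : i < j) (hj : j < n) : Pair n :=
  ⟨(⟨i, hij.trans hj⟩, ⟨j, hj⟩), hij⟩

lemma pair_ext {n : ℕ} {e f : Pair n} (h1 : (e.val.1 : ℕ) = f.val.1)
    (h2 : (e.val.2 : ℕ) = f.val.2) : e = f :=
  Subtype.ext (Prod.ext (Fin.ext h1) (Fin.ext h2))

lemma pair_lt {n : ℕ} (e : Pair n) : (e.val.1 : ℕ) < e.val.2 := e.2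

/-- The relation on natural numbers given by a set of pairs. -/
def rel {n : ℕ} (T : Set (Pair n)) (i j : ℕ) : Prop :=
  ∃ e ∈ T, (e.val.1 : ℕ) = i ∧ (e.val.2 : ℕ) = j

/-- The set of pairs given by a relation on natural numbers. -/
def ofRel (n : ℕ) (A : ℕ → ℕ → Prop) : Set (Pair n) := {e | A e.val.1 e.val.2}

lemma rel_iff {n : ℕ} {T : Set (Pair n)} (e : Pair n) : rel T e.val.1 e.val.2 ↔ e ∈ T := by
  constructor
  · rintro ⟨f, hf, h1, h2⟩
    rwa [← pair_ext h1 h2]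
  · exact fun h => ⟨e, h, rfl, rfl⟩

lemma rel_mkPair {n : ℕ} {T : Set (Pair n)} {i j : ℕ} (hij : i < j) (hj : j < n) :
    rel T i j ↔ mkPair i j hij hj ∈ T := rel_iff (mkPair i j hij hj)

lemma rel_ofRel {n : ℕ} {A : ℕ → ℕ → Prop} (h : ∀ i j, A i j → i < j ∧ j < n) :
    rel (ofRel n A) = A := by
  ext i j
  constructor
  · rintro ⟨e, he, rfl, rfl⟩
    exact he
  · intro hA
    exact ⟨mkPair i j (h i j hA).1 (h i j hA).2, hA, rfl, rfl⟩

lemma rel_bound {n : ℕ} {T : Set (Pair n)} {i j : ℕ} (h : rel T i j) : i < j ∧ j < n := by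
  obtain ⟨e, -, rfl, rfl⟩ := h
  exact ⟨e.2, e.val.2.2⟩

lemma crossingFree_iff {n : ℕ} (S : Set (Pair n)) :
    CrossingFree n 2 S ↔ ∀ a b c a' b' c', rel S a a' → rel S b b' → rel S c c' →
      a < b → b < c → c < a' → a' < b' → b' < c' → False := by
  classical
  constructor
  · rintro h _ _ _ _ _ _ ⟨e, he, rfl, rfl⟩ ⟨f, hf, rfl, rfl⟩ ⟨g, hg, rfl, rfl⟩ h1 h2 h3 h4 h5
    have hef : e ≠ f := by rintro rfl; omega
    have heg : e ≠ g := by rintro rfl; omega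
    have hfg : f ≠ g := by rintro rfl; omega
    refine h ⟨{e, f, g}, ?_, Finset.card_eq_three.2 ⟨e, f, g, hef, heg, hfg, rfl⟩, ?_⟩
    · intro x hx
      simp only [Finset.coe_insert, Finset.coe_singleton, Set.mem_insert_iff,
        Set.mem_singleton_iff] at hx
      rcases hx with rfl | rfl | rfl <;> assumption
    · intro x hx y hy hxy
      simp only [Finset.mem_insert, Finset.mem_singleton] at hx hy
      unfold Cross
      simp only [Fin.lt_def]
      rcases hx with rfl | rfl | rfl <;> rcases hy with rfl | rfl | rfl <;>
        first | exact absurd rfl hxy | omega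
  · rintro h ⟨C, hCS, hcard, hcross⟩
    obtain ⟨x, y, z, hxy, hxz, hyz, rfl⟩ := Finset.card_eq_three.1 hcard
    have mx : x ∈ S := hCS (by simp)
    have my : y ∈ S := hCS (by simp)
    have mz : z ∈ S := hCS (by simp)
    have cxy := hcross x (by simp) y (by simp) hxy
    have cxz := hcross x (by simp) z (by simp) hxz
    have cyz := hcross y (by simp) z (by simp) hyz
    rw [← rel_iff] at mx my mz
    unfold Cross at cxy cxz cyz
    simp only [Fin.lt_def] at cxy cxz cyz
    rcases cxy with cxy | cxy <;> rcases cxz with cxz | cxz <;> rcases cyz with cyz | cyz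
    · exact h _ _ _ _ _ _ mx my mz (by omega) (by omega) (by omega) (by omega) (by omega)
    · exact h _ _ _ _ _ _ mx mz my (by omega) (by omega) (by omega) (by omega) (by omega)
    · omega
    · exact h _ _ _ _ _ _ mz mx my (by omega) (by omega) (by omega) (by omega) (by omega)
    · exact h _ _ _ _ _ _ my mx mz (by omega) (by omega) (by omega) (by omega) (by omega)
    · omega
    · exact h _ _ _ _ _ _ my mz mx (by omega) (by omega) (by omega) (by omega) (by omega)
    · exact h _ _ _ _ _ _ mz my mx (by omega) (by omega) (by omega) (by omega) (by omega)

lemma isTriangulation_iff {n : ℕ} (T : Set (Pair n)) : IsTriangulation n 2 T ↔ Tri n (rel T) := by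
  constructor
  · rintro ⟨hfree, hmax⟩
    rw [crossingFree_iff] at hfree
    refine ⟨rel_bound, fun {a b c a' b' c'} => hfree a b c a' b' c', ?_⟩
    intro i j hij hj hb
    rw [rel_mkPair hij hj]
    have hrel : ∀ x y, rel (insert (mkPair i j hij hj) T) x y → (x = i ∧ y = j) ∨ rel T x y := by
      rintro x y ⟨e, he, rfl, rfl⟩
      rcases he with rfl | he
      · exact Or.inl ⟨rfl, rfl⟩
      · exact Or.inr ⟨e, he, rfl, rfl⟩
    rw [← hmax (insert (mkPair i j hij hj) T) ?_ (Set.subset_insert _ _)]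
    · exact Set.mem_insert _ _
    · rw [crossingFree_iff]
      intro a b c a' b' c' h1 h2 h3 l1 l2 l3 l4 l5
      rcases hrel _ _ h1 with g1 | g1 <;> rcases hrel _ _ h2 with g2 | g2 <;>
        rcases hrel _ _ h3 with g3 | g3
      · omega
      · omega
      · omega
      · exact hb ⟨_, _, _, _, g2, g3, by omega⟩
      · omega
      · exact hb ⟨_, _, _, _, g1, g3, by omega⟩
      · exact hb ⟨_, _, _, _, g1, g2, by omega⟩
      · exact hfree _ _ _ _ _ _ g1 g2 g3 l1 l2 l3 l4 l5
  · intro h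
    refine ⟨(crossingFree_iff T).2 fun a b c a' b' c' h1 h2 h3 => h.free h1 h2 h3, ?_⟩
    intro S hS hTS
    rw [crossingFree_iff] at hS
    refine Set.Subset.antisymm (fun e he => ?_) hTS
    have hsub : ∀ {x y}, rel T x y → rel S x y := by
      rintro x y ⟨f, hf, h1, h2⟩
      exact ⟨f, hTS hf, h1, h2⟩
    rw [← rel_iff]
    refine h.max (pair_lt e) e.val.2.2 ?_
    rintro ⟨k, l, p, q, h1, h2, h3⟩
    have h1 := hsub h1
    have h2 := hsub h2
    rw [← rel_iff] at he
    rcases h3 with h3 | h3 | h3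
    · exact hS _ _ _ _ _ _ he h1 h2 (by omega) (by omega) (by omega) (by omega) (by omega)
    · exact hS _ _ _ _ _ _ h1 he h2 (by omega) (by omega) (by omega) (by omega) (by omega)
    · exact hS _ _ _ _ _ _ h1 h2 he (by omega) (by omega) (by omega) (by omega) (by omega)

lemma Tri.rel_ofRel {n : ℕ} {A : ℕ → ℕ → Prop} (h : Tri n A) : rel (ofRel n A) = A :=
  TwoTri.rel_ofRel fun _ _ => h.bound

lemma Tri.isTriangulation {n : ℕ} {A : ℕ → ℕ → Prop} (h : Tri n A) :
    IsTriangulation n 2 (ofRel n A) := by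
  rw [isTriangulation_iff, h.rel_ofRel]
  exact h

lemma notMem_shortPairs_iff {n : ℕ} (e : Pair n) : e ∉ shortPairs n 2 ↔
    (e.val.1 : ℕ) + 3 ≤ e.val.2 ∧ (e.val.2 : ℕ) + 3 ≤ e.val.1 + n := by
  have h1 := pair_lt e
  have h2 := e.val.2.2
  simp only [shortPairs, pairLen, Set.mem_ofPred_eq]
  omega

lemma ncard_eq {n : ℕ} (T : Set (Pair n)) : T.ncard = {p : ℕ × ℕ | rel T p.1 p.2}.ncard := by
  have : {p : ℕ × ℕ | rel T p.1 p.2} =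
      (fun e : Pair n => ((e.val.1 : ℕ), (e.val.2 : ℕ))) '' T := by
    ext ⟨i, j⟩
    constructor
    · rintro ⟨e, he, h1, h2⟩
      exact ⟨e, he, by simpa using ⟨h1, h2⟩⟩
    · rintro ⟨e, he, h⟩
      simp only [Prod.mk.injEq] at h
      exact ⟨e, he, h.1, h.2⟩
  rw [this, Set.InjOn.ncard_image]
  intro e _ f _ h
  simp only [Prod.mk.injEq] at h
  exact pair_ext h.1 h.2

/-- Row of the hyperconnectivity matrix of the points `t i` for cubic polynomials. -/
def row {n : ℕ} (t : Fin n → ℝ) (e : Pair n) : Fin n × Fin 4 → ℝ := fun p =>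
  (if p.1 = e.val.1 then t e.val.2 ^ (p.2 : ℕ) else 0) -
    (if p.1 = e.val.2 then t e.val.1 ^ (p.2 : ℕ) else 0)

/-- The coefficient of the pair `(i, j)`, or `0` if this is not a pair. -/
noncomputable def coef {n : ℕ} (l : Pair n → ℝ) (i j : ℕ) : ℝ :=
  if h : i < j ∧ j < n then l (mkPair i j h.1 h.2) else 0

lemma coef_pair {n : ℕ} (l : Pair n → ℝ) (e : Pair n) : coef l e.val.1 e.val.2 = l e := by
  rw [coef, dif_pos ⟨pair_lt e, e.val.2.2⟩]
  rfl

lemma coef_eq_zero {n : ℕ} (l : Pair n → ℝ) {i j : ℕ} (h : j ≤ i) : coef l i j = 0 := by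
  rw [coef, dif_neg (by omega)]

lemma rel_of_coef_ne_zero {n : ℕ} {l : Pair n → ℝ} {T : Set (Pair n)} (hl : ∀ e, e ∉ T → l e = 0)
    {i j : ℕ} (h : coef l i j ≠ 0) : rel T i j := by
  unfold coef at h
  split_ifs at h with hij
  · rw [rel_mkPair hij.1 hij.2]
    by_contra h'
    exact h (hl _ h')
  · exact absurd rfl h

lemma sum_pair {n : ℕ} (F : Pair n → ℝ) : ∑ e, F e = ∑ i : Fin n, ∑ j : Fin n, coef F i j := by
  classical
  rw [← Finset.sum_product' (f := fun i j : Fin n => coef F i j)]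
  rw [← Finset.sum_filter_of_ne (s := Finset.univ ×ˢ Finset.univ)
    (p := fun p : Fin n × Fin n => p.1 < p.2) (fun p _ hp => by
      by_contra hlt
      exact hp (coef_eq_zero F (by simpa using hlt)))]
  rw [Finset.sum_subtype (p := fun p : Fin n × Fin n => p.1 < p.2)
    (Finset.filter (fun p : Fin n × Fin n => p.1 < p.2) (Finset.univ ×ˢ Finset.univ)) (by simp)]
  exact Finset.sum_congr rfl fun e _ => (coef_pair F e).symm

/-- The coefficients of a linear combination of rows, vertex by vertex. -/
lemma comb_row_apply {n : ℕ} (t : Fin n → ℝ) (l : Pair n → ℝ) (i : Fin n) (k : Fin 4) :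
    comb (row t) l (i, k) = ∑ j : Fin n, (coef l i j - coef l j i) * t j ^ (k : ℕ) := by
  classical
  have h1 : comb (row t) l (i, k) = ∑ e, l e * row t e (i, k) := by
    simp [comb, Finset.sum_apply]
  have h2 : ∀ a b : Fin n, coef (fun e => l e * row t e (i, k)) a b =
      (if i = a then coef l a b * t b ^ (k : ℕ) else 0) -
        (if i = b then coef l a b * t a ^ (k : ℕ) else 0) := by
    intro a b
    unfold coef
    split_ifs with h <;> simp_all [row, mkPair, mul_sub]
  rw [h1, sum_pair]
  simp only [h2, Finset.sum_sub_distrib, sub_mul]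
  congr 1
  · rw [Finset.sum_comm]
    simp
  · simp

lemma comb_row_eq_zero_eval {n : ℕ} {t : Fin n → ℝ} {l : Pair n → ℝ} (h : comb (row t) l = 0)
    (i : Fin n) (a b c : ℝ) :
    ∑ j : Fin n, (coef l i j - coef l j i) * ((t j - a) * (t j - b) * (t j - c)) = 0 := by
  have e : ∀ k : Fin 4, ∑ j : Fin n, (coef l i j - coef l j i) * t j ^ (k : ℕ) = 0 := fun k => by
    rw [← comb_row_apply, h]; rfl
  have e0 := e 0
  have e1 := e 1
  have e2 := e 2
  have e3 := e 3
  simp only [Fin.isValue, Fin.val_zero, Fin.val_one, Fin.val_two, pow_zero, pow_one] at e0 e1 e2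
  have e3' : ∑ j : Fin n, (coef l i j - coef l j i) * t j ^ 3 = 0 := e3
  calc ∑ j : Fin n, (coef l i j - coef l j i) * ((t j - a) * (t j - b) * (t j - c))
      = ∑ j : Fin n, (coef l i j - coef l j i) * t j ^ 3 +
        (-(a + b + c)) * ∑ j : Fin n, (coef l i j - coef l j i) * t j ^ 2 +
        (a * b + b * c + a * c) * ∑ j : Fin n, (coef l i j - coef l j i) * t j +
        (-(a * b * c)) * ∑ j : Fin n, (coef l i j - coef l j i) * 1 := by
        simp only [Finset.mul_sum, ← Finset.sum_add_distrib]
        exact Finset.sum_congr rfl fun j _ => by ring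
    _ = 0 := by rw [e0, e1, e2, e3']; ring

end TwoTri

namespace TwoTri

open FlipFan

/-- The vertex map merging `v + 1` and `v + 2`. -/
def mergeFin {N : ℕ} (v : ℕ) (hv : v + 2 ≤ N) (i : Fin (N + 1)) : Fin N :=
  ⟨merge v i, by have := merge_spec v i; have := i.2; omega⟩

/-- The coefficients of a linear combination after merging the vertices `v + 1` and `v + 2`. -/
noncomputable def push {N : ℕ} (v : ℕ) (l : Pair (N + 1) → ℝ) (f : Pair N) : ℝ :=
  ∑ e : Pair (N + 1), if merge v e.val.1 = f.val.1 ∧ merge v e.val.2 = f.val.2 then l e else 0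

lemma push_apply_of_unique {N : ℕ} {v : ℕ} {l : Pair (N + 1) → ℝ} {f : Pair N} {e : Pair (N + 1)}
    (h1 : merge v e.val.1 = f.val.1) (h2 : merge v e.val.2 = f.val.2)
    (hu : ∀ e', e' ≠ e → merge v e'.val.1 = f.val.1 → merge v e'.val.2 = f.val.2 → l e' = 0) :
    push v l f = l e := by
  unfold push
  rw [Finset.sum_eq_single e, if_pos ⟨h1, h2⟩]
  · intro e' _ hne
    split_ifs with h
    · exact hu e' hne h.1 h.2
    · rfl
  · intro h
    exact absurd (Finset.mem_univ e) h

lemma exists_of_push_ne_zero {N : ℕ} {v : ℕ} {l : Pair (N + 1) → ℝ} {f : Pair N}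
    (h : push v l f ≠ 0) :
    ∃ e, l e ≠ 0 ∧ merge v e.val.1 = f.val.1 ∧ merge v e.val.2 = f.val.2 := by
  by_contra hcon
  push Not at hcon
  refine h (Finset.sum_eq_zero fun e _ => ?_)
  split_ifs with h'
  · by_contra h0
    exact hcon e h0 h'.1 h'.2
  · rfl

lemma sum_ite_pair_eq {N : ℕ} (F : Pair N → ℝ) (a b : Fin N) :
    (∑ f : Pair N, if (a : ℕ) = f.val.1 ∧ (b : ℕ) = f.val.2 then F f else 0) = coef F a b := by
  by_cases hab : a < b
  · rw [coef, dif_pos ⟨hab, b.2⟩, Finset.sum_eq_single (mkPair a b hab b.2)]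
    · simp [mkPair]
    · intro f _ hne
      rw [if_neg]
      rintro ⟨h1, h2⟩
      exact hne (pair_ext h1.symm h2.symm)
    · intro h
      exact absurd (Finset.mem_univ _) h
  · rw [coef_eq_zero F (by simpa using hab)]
    refine Finset.sum_eq_zero fun f _ => ?_
    rw [if_neg]
    rintro ⟨h1, h2⟩
    have := pair_lt f
    exact hab (by rw [Fin.lt_def]; omega)

lemma comb_push {N : ℕ} {v : ℕ} (hv : v + 2 ≤ N) (t : Fin N → ℝ) (l : Pair (N + 1) → ℝ)
    (a : Fin N) (k : Fin 4) : comb (row t) (push v l) (a, k) =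
      ∑ i : Fin (N + 1), if mergeFin v hv i = a then
        comb (row (t ∘ mergeFin v hv)) l (i, k) else 0 := by
  classical
  have h1 : comb (row t) (push v l) (a, k) =
      ∑ e, l e * coef (fun f => row t f (a, k)) (mergeFin v hv e.val.1)
        (mergeFin v hv e.val.2) := by
    simp only [comb, Finset.sum_apply, Pi.smul_apply, smul_eq_mul, push, Finset.sum_mul]
    rw [Finset.sum_comm]
    refine Finset.sum_congr rfl fun e _ => ?_
    rw [← sum_ite_pair_eq, Finset.mul_sum]
    refine Finset.sum_congr rfl fun f _ => ?_
    by_cases h : merge v e.val.1 = f.val.1 ∧ merge v e.val.2 = f.val.2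
    · rw [if_pos h]
      exact congrArg (l e * ·) (if_pos h).symm
    · rw [if_neg h, zero_mul]
      exact (mul_eq_zero_of_right _ (if_neg h)).symm
  have h2 : ∀ e : Pair (N + 1), coef (fun f => row t f (a, k)) (mergeFin v hv e.val.1)
      (mergeFin v hv e.val.2) = ∑ i : Fin (N + 1), if mergeFin v hv i = a then
        row (t ∘ mergeFin v hv) e (i, k) else 0 := by
    intro e
    have hR : (∑ i : Fin (N + 1), if mergeFin v hv i = a then
        row (t ∘ mergeFin v hv) e (i, k) else 0) =
        (if mergeFin v hv e.val.1 = a then t (mergeFin v hv e.val.2) ^ (k : ℕ) else 0) -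
        (if mergeFin v hv e.val.2 = a then t (mergeFin v hv e.val.1) ^ (k : ℕ) else 0) := by
      have : ∀ i : Fin (N + 1), (if mergeFin v hv i = a then
          row (t ∘ mergeFin v hv) e (i, k) else 0) =
          (if i = e.val.1 then (if mergeFin v hv i = a then
            t (mergeFin v hv e.val.2) ^ (k : ℕ) else 0) else 0) -
          (if i = e.val.2 then (if mergeFin v hv i = a then
            t (mergeFin v hv e.val.1) ^ (k : ℕ) else 0) else 0) := by
        intro i
        simp only [row, Function.comp]
        split_ifs <;> simp
      simp only [this, Finset.sum_sub_distrib, Finset.sum_ite_eq', Finset.mem_univ, if_true]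
    rw [hR]
    have hlt := pair_lt e
    by_cases hm : mergeFin v hv e.val.1 < mergeFin v hv e.val.2
    · rw [coef, dif_pos ⟨hm, (mergeFin v hv e.val.2).2⟩]
      simp only [row, mkPair, Fin.eta, eq_comm (a := a)]
    · have heq : mergeFin v hv e.val.1 = mergeFin v hv e.val.2 := by
        rw [Fin.lt_def] at hm
        apply Fin.ext
        simp only [mergeFin] at hm ⊢
        have := merge_spec v e.val.1
        have := merge_spec v e.val.2
        omega
      rw [coef_eq_zero _ (by simpa using hm), heq, sub_self]
  rw [h1]
  simp only [h2, Finset.mul_sum]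
  rw [Finset.sum_comm]
  refine Finset.sum_congr rfl fun i _ => ?_
  split_ifs with hi
  · simp [comb, Finset.sum_apply]
  · simp

lemma comb_push_eq_zero {N : ℕ} {v : ℕ} (hv : v + 2 ≤ N) {t : Fin N → ℝ} {l : Pair (N + 1) → ℝ}
    (h : comb (row (t ∘ mergeFin v hv)) l = 0) : comb (row t) (push v l) = 0 := by
  ext ⟨a, k⟩
  rw [comb_push hv]
  simp [h]

/-- The coefficient of the unordered pair with endpoints `x` and `y`. -/
noncomputable def sym {n : ℕ} (l : Pair n → ℝ) (x y : ℕ) : ℝ := coef l x y + coef l y x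

lemma sym_comm {n : ℕ} (l : Pair n → ℝ) (x y : ℕ) : sym l x y = sym l y x := add_comm _ _

lemma sym_of_lt {n : ℕ} (l : Pair n → ℝ) {x y : ℕ} (h : x < y) : sym l x y = coef l x y := by
  rw [sym, coef_eq_zero l h.le, add_zero]

lemma sym_of_gt {n : ℕ} (l : Pair n → ℝ) {x y : ℕ} (h : y < x) : sym l x y = coef l y x := by
  rw [sym, coef_eq_zero l h.le, zero_add]

lemma coef_eq_zero_of_push {N v : ℕ} {l : Pair (N + 1) → ℝ} (hp : push v l = 0) {i j : ℕ} (hi1 : i ≠ v + 1) (hi2 : i ≠ v + 2) (hj1 : j ≠ v + 1)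
    (hj2 : j ≠ v + 2) (hv : v + 2 ≤ N) : coef l i j = 0 := by
  by_cases hij : i < j ∧ j < N + 1
  swap
  · rw [coef, dif_neg hij]
  have si := merge_spec v i
  have sj := merge_spec v j
  have hm : merge v i < merge v j := merge_lt hij.1 (by omega)
  have h0 := congrFun hp (mkPair (merge v i) (merge v j) hm (by omega))
  rw [push_apply_of_unique (e := mkPair i j hij.1 hij.2) rfl rfl] at h0
  · rw [coef, dif_pos hij]
    exact h0
  · intro e' hne h1 h2
    refine absurd (pair_ext ?_ ?_) hne
    · have := merge_spec v e'.val.1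
      simp only [mkPair] at h1 ⊢
      omega
    · have := merge_spec v e'.val.2
      simp only [mkPair] at h2 ⊢
      omega

lemma sym_add_eq_zero_of_push {N v : ℕ} {l : Pair (N + 1) → ℝ} (hp : push v l = 0) {o : ℕ} (ho1 : o ≠ v + 1) (ho2 : o ≠ v + 2) (hoN : o ≤ N)
    (hv : v + 2 ≤ N) : sym l (v + 1) o + sym l (v + 2) o = 0 := by
  have e1 : merge v (v + 1) = v + 1 := by have := merge_spec v (v + 1); omega
  have e2 : merge v (v + 2) = v + 1 := by have := merge_spec v (v + 2); omega
  have so := merge_spec v o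
  by_cases ho : v + 2 < o
  · rw [sym_of_lt l (by omega), sym_of_lt l (by omega), coef, dif_pos ⟨by omega, by omega⟩,
      coef, dif_pos ⟨by omega, by omega⟩]
    have h0 := congrFun hp (mkPair (v + 1) (merge v o) (by omega) (by omega))
    refine Eq.trans ?_ h0
    rw [push, Fintype.sum_eq_add (mkPair (v + 1) o (by omega) (by omega))
      (mkPair (v + 2) o ho (by omega))]
    · simp [mkPair, e1, e2]
    · intro h
      have := congrArg (fun e : Pair (N + 1) => (e.val.1 : ℕ)) h
      simp [mkPair] at this
    · rintro e ⟨hn1, hn2⟩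
      rw [if_neg]
      rintro ⟨h1, h2⟩
      have s1 := merge_spec v e.val.1
      have s2 := merge_spec v e.val.2
      simp only [mkPair] at h1 h2
      by_cases hc : (e.val.1 : ℕ) = v + 1
      · exact hn1 (pair_ext hc (by simp only [mkPair]; omega))
      · exact hn2 (pair_ext (by simp only [mkPair]; omega) (by simp only [mkPair]; omega))
  · rw [sym_of_gt l (by omega), sym_of_gt l (by omega), coef, dif_pos ⟨by omega, by omega⟩,
      coef, dif_pos ⟨by omega, by omega⟩]
    have h0 := congrFun hp (mkPair (merge v o) (v + 1) (by omega) (by omega))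
    refine Eq.trans ?_ h0
    rw [push, Fintype.sum_eq_add (mkPair o (v + 1) (by omega) (by omega))
      (mkPair o (v + 2) (by omega) (by omega))]
    · simp [mkPair, e1, e2]
    · intro h
      have := congrArg (fun e : Pair (N + 1) => (e.val.2 : ℕ)) h
      simp [mkPair] at this
    · rintro e ⟨hn1, hn2⟩
      rw [if_neg]
      rintro ⟨h1, h2⟩
      have s1 := merge_spec v e.val.1
      have s2 := merge_spec v e.val.2
      simp only [mkPair] at h1 h2
      by_cases hc : (e.val.2 : ℕ) = v + 1
      · exact hn1 (pair_ext (by simp only [mkPair]; omega) hc)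
      · exact hn2 (pair_ext (by simp only [mkPair]; omega) (by simp only [mkPair]; omega))

/-- The balance of a dependency supported near the merged vertices, between two common
neighbours. -/
lemma exists_balance {N v : ℕ} (hv : v + 3 ≤ N) {t : Fin N → ℝ} (ht : StrictMono t)
    {l : Pair (N + 1) → ℝ} (hp : push v l = 0)
    (hl : comb (row (t ∘ mergeFin v (by omega))) l = 0) {c c' : ℕ} (hcN : c ≤ N) (hcN' : c' ≤ N)
    (hc : c < v ∨ v + 3 < c) (hc' : c' < v ∨ v + 3 < c') (hcc : c ≠ c')
    (hz : ∀ o, o ≤ N → (o < v ∨ v + 3 < o) → o ≠ c → o ≠ c' → sym l (v + 1) o = 0) :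
    ∃ q q' : ℝ, 0 < q ∧ 0 < q' ∧ sym l (v + 1) c * q = sym l (v + 2) c' * q' ∧
      sym l (v + 2) c * q = sym l (v + 1) c' * q' := by
  set s : Fin (N + 1) → ℝ := t ∘ mergeFin v (by omega) with hs
  have hlt : ∀ i j : Fin (N + 1), merge v i < merge v j → s i < s j := fun i j h => ht h
  have heq : ∀ i j : Fin (N + 1), merge v i = merge v j → s i = s j := fun i j h => by
    simp only [hs, Function.comp]
    congr 1
    exact Fin.ext h
  have hsum := comb_row_eq_zero_eval hl ⟨v + 1, by omega⟩ (s ⟨v + 1, by omega⟩) (s ⟨v, by omega⟩)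
    (s ⟨v + 3, by omega⟩)
  rw [Fintype.sum_eq_add (⟨c, by omega⟩ : Fin (N + 1)) ⟨c', by omega⟩
    (by simpa [Fin.ext_iff] using hcc)] at hsum
  swap
  · rintro ⟨o, ho⟩ ⟨h1, h2⟩
    simp only [ne_eq, Fin.mk.injEq] at h1 h2
    by_cases ho1 : o = v + 1
    · subst ho1; simp
    by_cases ho2 : o = v + 2
    · subst ho2
      rw [heq ⟨v + 2, ho⟩ ⟨v + 1, by omega⟩ (by
        have := merge_spec v (v + 1); have := merge_spec v (v + 2); simp only; omega)]
      simp
    by_cases ho3 : o = v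
    · subst ho3; simp
    by_cases ho4 : o = v + 3
    · subst ho4; simp
    have := hz o (by omega) (by omega) h1 h2
    by_cases hov : o < v + 1
    · rw [sym_of_gt l hov] at this
      simp only
      rw [this, coef_eq_zero l (by omega)]
      simp
    · rw [sym_of_lt l (by omega)] at this
      simp only
      rw [this, coef_eq_zero l (by omega)]
      simp
  have key : ∀ x (hx : x ≤ N), (x < v ∨ v + 3 < x) → ∃ r : ℝ, 0 < r ∧
      (coef l (v + 1) x - coef l x (v + 1)) * ((s ⟨x, by omega⟩ - s ⟨v + 1, by omega⟩) *
        (s ⟨x, by omega⟩ - s ⟨v, by omega⟩) * (s ⟨x, by omega⟩ - s ⟨v + 3, by omega⟩)) =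
      sym l (v + 1) x * r := by
    intro x hx hx'
    have m0 := merge_spec v v
    have m1 := merge_spec v (v + 1)
    have m3 := merge_spec v (v + 3)
    have mx := merge_spec v x
    rcases hx' with hx' | hx'
    · have l1 := hlt ⟨x, by omega⟩ ⟨v, by omega⟩ (by simp only; omega)
      have l2 := hlt ⟨x, by omega⟩ ⟨v + 1, by omega⟩ (by simp only; omega)
      have l3 := hlt ⟨x, by omega⟩ ⟨v + 3, by omega⟩ (by simp only; omega)
      refine ⟨(s ⟨v + 1, by omega⟩ - s ⟨x, by omega⟩) * (s ⟨v, by omega⟩ - s ⟨x, by omega⟩) *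
        (s ⟨v + 3, by omega⟩ - s ⟨x, by omega⟩),
        mul_pos (mul_pos (sub_pos.2 l2) (sub_pos.2 l1)) (sub_pos.2 l3), ?_⟩
      rw [sym_of_gt l (by omega), coef_eq_zero l (show x ≤ v + 1 by omega)]
      ring
    · have l1 := hlt ⟨v, by omega⟩ ⟨x, by omega⟩ (by simp only; omega)
      have l2 := hlt ⟨v + 1, by omega⟩ ⟨x, by omega⟩ (by simp only; omega)
      have l3 := hlt ⟨v + 3, by omega⟩ ⟨x, by omega⟩ (by simp only; omega)
      refine ⟨_, mul_pos (mul_pos (sub_pos.2 l2) (sub_pos.2 l1)) (sub_pos.2 l3), ?_⟩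
      rw [sym_of_lt l (by omega), coef_eq_zero l (show v + 1 ≤ x by omega)]
      ring
  obtain ⟨r, hr, hrc⟩ := key c hcN hc
  obtain ⟨r', hr', hrc'⟩ := key c' hcN' hc'
  simp only at hsum
  rw [hrc, hrc'] at hsum
  have h1 := sym_add_eq_zero_of_push hp (o := c) (by omega) (by omega) hcN (by omega)
  have h2 := sym_add_eq_zero_of_push hp (o := c') (by omega) (by omega) hcN' (by omega)
  refine ⟨r, r', hr, hr', ?_, ?_⟩
  · rw [eq_neg_of_add_eq_zero_right h2]
    linear_combination hsum
  · rw [eq_neg_of_add_eq_zero_right h1]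
    linear_combination -hsum

end TwoTri

namespace FlipFan

/-- The linear map sending coefficients to the linear combination. -/
def combLin {E V : Type*} [Fintype E] [AddCommGroup V] [Module ℝ V] (w : E → V) :
    (E → ℝ) →ₗ[ℝ] V where
  toFun := comb w
  map_add' := comb_add w
  map_smul' := comb_smul w

lemma isFrame_of_finrank_le {E V : Type*} [Fintype E] [AddCommGroup V] [Module ℝ V]
    {w : E → V} {T : Set E}
    (hi : ∀ z : E → ℝ, (∀ e, e ∉ T → z e = 0) → comb w z = 0 → z = 0)
    (hr : Module.finrank ℝ (LinearMap.range (combLin w)) ≤ T.ncard) : IsFrame w T := by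
  classical
  refine ⟨hi, fun y => ?_⟩
  let ext : (T → ℝ) →ₗ[ℝ] (E → ℝ) :=
    { toFun := fun z e => if h : e ∈ T then z ⟨e, h⟩ else 0
      map_add' := fun x y => by
        ext e
        by_cases h : e ∈ T <;> simp [h]
      map_smul' := fun a x => by
        ext e
        by_cases h : e ∈ T <;> simp [h] }
  have hsupp : ∀ z : T → ℝ, ∀ e, e ∉ T → ext z e = 0 := fun z e he => dif_neg he
  have hinj : Function.Injective (combLin w ∘ₗ ext) := by
    rw [← LinearMap.ker_eq_bot, LinearMap.ker_eq_bot']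
    intro z hz
    have := hi (ext z) (hsupp z) hz
    ext ⟨e, he⟩
    have h := congrFun this e
    change (if h : e ∈ T then z ⟨e, h⟩ else 0) = 0 at h
    rwa [dif_pos he] at h
  have hle : LinearMap.range (combLin w ∘ₗ ext) ≤ LinearMap.range (combLin w) :=
    LinearMap.range_comp_le_range _ _
  have heq := Submodule.eq_of_le_of_finrank_le hle (by
    rw [LinearMap.finrank_range_of_inj hinj, Module.finrank_fintype_fun_eq_card]
    rwa [Set.ncard_eq_toFinset_card', Set.toFinset_card] at hr)
  have hy : combLin w y ∈ LinearMap.range (combLin w ∘ₗ ext) := by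
    rw [heq]
    exact LinearMap.mem_range_self _ y
  obtain ⟨z, hz⟩ := hy
  exact ⟨ext z, hsupp z, hz⟩

end FlipFan

namespace TwoTri

open FlipFan

lemma eq_zero_of_cubic {a : Fin 4 → ℝ} {x : Fin 4 → ℝ} (hx : Function.Injective x)
    (h : ∀ i, ∑ k, a k * x i ^ (k : ℕ) = 0) : a = 0 := by
  have hdet : (Matrix.vandermonde x).det ≠ 0 := Matrix.det_vandermonde_ne_zero_iff.2 hx
  refine Matrix.eq_zero_of_mulVec_eq_zero hdet ?_
  ext i
  refine Eq.trans ?_ (h i)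
  simp [Matrix.mulVec, dotProduct, Matrix.vandermonde_apply, mul_comm]

/-- Unordered pairs of exponents. -/
abbrev Expo := {p : Fin 4 × Fin 4 // p.1 ≤ p.2}

/-- The vectors orthogonal to all rows coming from symmetric bilinear forms. -/
def symForm {n : ℕ} (t : Fin n → ℝ) : (Expo → ℝ) →ₗ[ℝ] (Fin n × Fin 4 → ℝ) where
  toFun c p := ∑ k : Fin 4, c ⟨(min p.2 k, max p.2 k), min_le_max⟩ * t p.1 ^ (k : ℕ)
  map_add' c d := by
    ext p
    simp [add_mul, Finset.sum_add_distrib]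
  map_smul' a c := by
    ext p
    simp [Finset.mul_sum, mul_assoc]

lemma symForm_injective {n : ℕ} {t : Fin n → ℝ} {x : Fin 4 → Fin n}
    (hx : Function.Injective (t ∘ x)) : Function.Injective (symForm t) := by
  rw [← LinearMap.ker_eq_bot, LinearMap.ker_eq_bot']
  intro c hc
  ext ⟨⟨a, b⟩, hab⟩
  have := eq_zero_of_cubic (a := fun k => c ⟨(min a k, max a k), min_le_max⟩) hx
    (fun i => congrFun hc (x i, a))
  have h := congrFun this b
  simp only [Pi.zero_apply] at h ⊢
  rw [← h]
  congr 2
  exact Prod.ext (min_eq_left hab).symm (max_eq_right hab).symm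

lemma sum_row_mul_symForm {n : ℕ} (t : Fin n → ℝ) (e : Pair n) (c : Expo → ℝ) :
    ∑ p, row t e p * symForm t c p = 0 := by
  classical
  have hs : ∀ a k : Fin 4, c ⟨(min a k, max a k), min_le_max⟩ =
      c ⟨(min k a, max k a), min_le_max⟩ := fun a k => by
    congr 2
    exact Prod.ext (min_comm _ _) (max_comm _ _)
  rw [Fintype.sum_prod_type]
  simp only [row, sub_mul, ite_mul, zero_mul, Finset.sum_sub_distrib]
  rw [Finset.sum_comm, Finset.sum_comm (s := (Finset.univ : Finset (Fin n)))]
  simp only [Finset.sum_ite_eq', Finset.mem_univ, if_true, symForm, LinearMap.coe_mk,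
    AddHom.coe_mk, Finset.mul_sum]
  rw [sub_eq_zero, Finset.sum_comm]
  refine Finset.sum_congr rfl fun a _ => Finset.sum_congr rfl fun b _ => ?_
  rw [hs]
  ring

lemma finrank_range_row {n : ℕ} {t : Fin n → ℝ} {x : Fin 4 → Fin n}
    (hx : Function.Injective (t ∘ x)) :
    Module.finrank ℝ (LinearMap.range (combLin (row t))) + 10 ≤ 4 * n := by
  have horth : ∀ l c, ∑ p, comb (row t) l p * symForm t c p = 0 := by
    intro l c
    simp only [comb, Finset.sum_apply, Pi.smul_apply, smul_eq_mul, Finset.sum_mul]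
    rw [Finset.sum_comm]
    refine Finset.sum_eq_zero fun e _ => ?_
    simp only [mul_assoc, ← Finset.mul_sum, sum_row_mul_symForm, mul_zero]
  have hdis : Disjoint (LinearMap.range (combLin (row t))) (LinearMap.range (symForm t)) := by
    rw [Submodule.disjoint_def]
    rintro _ ⟨l, rfl⟩ ⟨c, hc⟩
    have h := horth l c
    rw [hc] at h
    change ∑ p, combLin (row t) l p * combLin (row t) l p = 0 at h
    rw [Finset.sum_eq_zero_iff_of_nonneg (fun p _ => mul_self_nonneg _)] at h
    ext p
    exact mul_self_eq_zero.1 (h p (Finset.mem_univ p))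
  have h1 := Submodule.finrank_add_finrank_le_of_disjoint hdis
  rw [LinearMap.finrank_range_of_inj (symForm_injective hx), Module.finrank_fintype_fun_eq_card,
    Module.finrank_fintype_fun_eq_card] at h1
  have hc : Fintype.card Expo = 10 := by decide
  rw [hc, Fintype.card_prod, Fintype.card_fin, Fintype.card_fin] at h1
  omega

lemma isFrame_row {n : ℕ} (hn : 5 ≤ n) {t : Fin n → ℝ} {x : Fin 4 → Fin n}
    (hx : Function.Injective (t ∘ x)) {T : Set (Pair n)} (hT : IsTriangulation n 2 T)
    (hi : ∀ z : Pair n → ℝ, (∀ e, e ∉ T → z e = 0) → comb (row t) z = 0 → z = 0) :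
    IsFrame (row t) T := by
  refine isFrame_of_finrank_le hi ?_
  have h1 := finrank_range_row hx
  have h2 := ((isTriangulation_iff T).1 hT).ncard hn
  rw [← ncard_eq] at h2
  omega

/-- The rows of every triangulation are linearly independent. -/
def Indep (n : ℕ) (t : Fin n → ℝ) : Prop := ∀ T, IsTriangulation n 2 T →
  ∀ z : Pair n → ℝ, (∀ e, e ∉ T → z e = 0) → comb (row t) z = 0 → z = 0

lemma push_supp {N v : ℕ} {T : Set (Pair (N + 1))} {l : Pair (N + 1) → ℝ}
    (hl : ∀ e, e ∉ T → l e = 0) (f : Pair N) (hf : f ∉ ofRel N (contr v (rel T))) :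
    push v l f = 0 := by
  by_contra h
  obtain ⟨e, he, h1, h2⟩ := exists_of_push_ne_zero h
  refine hf ⟨pair_lt f, e.val.1, e.val.2, (rel_iff e).2 ?_, h1, h2⟩
  by_contra h'
  exact he (hl e h')

/-- A dependency at merged vertices which becomes trivial when merging, and does not involve
vertices beyond the ear, is trivial. -/
lemma eq_zero_of_push {N v : ℕ} (hv : v + 3 ≤ N) {t : Fin N → ℝ} (ht : StrictMono t)
    {l : Pair (N + 1) → ℝ} (hp : push v l = 0)
    (hl : comb (row (t ∘ mergeFin v (by omega))) l = 0)
    (hz : ∀ o, o ≤ N → (o < v ∨ v + 3 < o) → sym l (v + 1) o = 0) : l = 0 := by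
  set s : Fin (N + 1) → ℝ := t ∘ mergeFin v (by omega) with hs
  have hinj : ∀ i j : Fin (N + 1), merge v i ≠ merge v j → s i - s j ≠ 0 := fun i j h h' => by
    refine h ?_
    have := ht.injective (sub_eq_zero.1 h')
    simpa [mergeFin] using this
  have heq : s ⟨v + 2, by omega⟩ = s ⟨v + 1, by omega⟩ := by
    simp only [hs, Function.comp]
    congr 1
    apply Fin.ext
    have := merge_spec v (v + 1)
    have := merge_spec v (v + 2)
    simp only [mergeFin]
    omega
  have m0 := merge_spec v v
  have m1 := merge_spec v (v + 1)
  have m3 := merge_spec v (v + 3)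
  have hz' : ∀ o (ho : o < N + 1), o < v ∨ v + 3 < o →
      coef l (v + 1) o - coef l o (v + 1) = 0 := by
    intro o ho h
    have := hz o (by omega) h
    rcases h with h | h
    · rw [sym_of_gt l (by omega)] at this
      rw [this, coef_eq_zero l (by omega), sub_zero]
    · rw [sym_of_lt l (by omega)] at this
      rw [this, coef_eq_zero l (by omega), sub_zero]
  have a3 : coef l (v + 1) (v + 3) = 0 := by
    have hsum := comb_row_eq_zero_eval hl ⟨v + 1, by omega⟩ (s ⟨v + 1, by omega⟩)
      (s ⟨v, by omega⟩) (s ⟨v, by omega⟩)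
    rw [Finset.sum_eq_single (⟨v + 3, by omega⟩ : Fin (N + 1))] at hsum
    · rcases mul_eq_zero.1 hsum with h | h
      · simp only at h
        rwa [coef_eq_zero l (show v + 1 ≤ v + 3 by omega), sub_zero] at h
      · refine absurd h (mul_ne_zero (mul_ne_zero (hinj _ _ ?_) (hinj _ _ ?_)) (hinj _ _ ?_)) <;>
          simp only <;> omega
    · rintro ⟨o, ho⟩ - hne
      simp only [ne_eq, Fin.mk.injEq] at hne
      by_cases ho1 : o = v + 1
      · subst ho1; simp
      by_cases ho2 : o = v + 2
      · subst ho2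
        rw [heq]; simp
      by_cases ho0 : o = v
      · subst ho0; simp
      simp only
      rw [hz' o ho (by omega), zero_mul]
    · intro h
      exact absurd (Finset.mem_univ _) h
  have a0 : coef l v (v + 1) = 0 := by
    have hsum := comb_row_eq_zero_eval hl ⟨v + 1, by omega⟩ (s ⟨v + 1, by omega⟩)
      (s ⟨v + 1, by omega⟩) (s ⟨v + 1, by omega⟩)
    rw [Finset.sum_eq_single (⟨v, by omega⟩ : Fin (N + 1))] at hsum
    · rcases mul_eq_zero.1 hsum with h | h
      · simp only at h
        rwa [coef_eq_zero l (show v ≤ v + 1 by omega), zero_sub, neg_eq_zero] at h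
      · refine absurd h (mul_ne_zero (mul_ne_zero (hinj _ _ ?_) (hinj _ _ ?_)) (hinj _ _ ?_)) <;>
          simp only <;> omega
    · rintro ⟨o, ho⟩ - hne
      simp only [ne_eq, Fin.mk.injEq] at hne
      by_cases ho1 : o = v + 1
      · subst ho1; simp
      by_cases ho2 : o = v + 2
      · subst ho2
        rw [heq]; simp
      by_cases ho3 : o = v + 3
      · subst ho3
        simp only
        rw [a3, coef_eq_zero l (show v + 1 ≤ v + 3 by omega)]; simp
      simp only
      rw [hz' o ho (by omega), zero_mul]
    · intro h
      exact absurd (Finset.mem_univ _) h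
  have a2 : coef l (v + 1) (v + 2) = 0 := by
    have hsum := comb_row_eq_zero_eval hl ⟨v + 1, by omega⟩ (s ⟨v, by omega⟩)
      (s ⟨v, by omega⟩) (s ⟨v, by omega⟩)
    rw [Finset.sum_eq_single (⟨v + 2, by omega⟩ : Fin (N + 1))] at hsum
    · rcases mul_eq_zero.1 hsum with h | h
      · simp only at h
        rwa [coef_eq_zero l (show v + 1 ≤ v + 2 by omega), sub_zero] at h
      · rw [heq] at h
        refine absurd h (mul_ne_zero (mul_ne_zero (hinj _ _ ?_) (hinj _ _ ?_)) (hinj _ _ ?_)) <;>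
          simp only <;> omega
    · rintro ⟨o, ho⟩ - hne
      simp only [ne_eq, Fin.mk.injEq] at hne
      by_cases ho1 : o = v + 1
      · subst ho1; simp
      by_cases ho2 : o = v
      · subst ho2; simp
      by_cases ho3 : o = v + 3
      · subst ho3
        simp only
        rw [a3, coef_eq_zero l (show v + 1 ≤ v + 3 by omega)]; simp
      simp only
      rw [hz' o ho (by omega), zero_mul]
    · intro h
      exact absurd (Finset.mem_univ _) h
  have b1 : ∀ o, o ≤ N → sym l (v + 1) o = 0 := by
    intro o ho
    by_cases ho1 : o = v + 1
    · subst ho1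
      rw [sym, coef_eq_zero l le_rfl, add_zero]
    by_cases ho2 : o = v + 2
    · subst ho2
      rw [sym_of_lt l (by omega), a2]
    by_cases ho0 : o = v
    · subst ho0
      rw [sym_of_gt l (by omega), a0]
    by_cases ho3 : o = v + 3
    · subst ho3
      rw [sym_of_lt l (by omega), a3]
    exact hz o ho (by omega)
  have b2 : ∀ o, o ≤ N → sym l (v + 2) o = 0 := by
    intro o ho
    by_cases ho1 : o = v + 1
    · subst ho1
      rw [sym_comm]
      exact b1 _ (by omega)
    by_cases ho2 : o = v + 2
    · subst ho2
      rw [sym, coef_eq_zero l le_rfl, add_zero]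
    have := sym_add_eq_zero_of_push hp ho1 ho2 ho (by omega)
    rwa [b1 o ho, zero_add] at this
  ext e
  rw [← coef_pair l e, Pi.zero_apply]
  have hlt := pair_lt e
  have h1 := e.val.1.2
  have h2 := e.val.2.2
  by_cases c1 : (e.val.1 : ℕ) = v + 1
  · have := b1 e.val.2 (by omega)
    rwa [← c1, sym_of_lt l hlt] at this
  by_cases c2 : (e.val.1 : ℕ) = v + 2
  · have := b2 e.val.2 (by omega)
    rwa [← c2, sym_of_lt l hlt] at this
  by_cases c3 : (e.val.2 : ℕ) = v + 1
  · have := b1 e.val.1 (by omega)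
    rwa [← c3, sym_of_gt l hlt] at this
  by_cases c4 : (e.val.2 : ℕ) = v + 2
  · have := b2 e.val.1 (by omega)
    rwa [← c4, sym_of_gt l hlt] at this
  exact coef_eq_zero_of_push hp c1 c2 c3 c4 (by omega)

/-- The vertices `x` and `o` are joined by an edge. -/
def Adj (A : ℕ → ℕ → Prop) (x o : ℕ) : Prop := A x o ∨ A o x

lemma Tri.common_iff {n : ℕ} {A : ℕ → ℕ → Prop} (h : Tri n A) {v c : ℕ} :
    Common A v c ↔ (c < v ∨ v + 3 < c) ∧ Adj A (v + 1) c ∧ Adj A (v + 2) c := by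
  constructor
  · rintro (⟨h1, h2, h3⟩ | ⟨h1, h2, h3⟩)
    · exact ⟨Or.inr h1, Or.inl h2, Or.inl h3⟩
    · exact ⟨Or.inl h1, Or.inr h2, Or.inr h3⟩
  · rintro ⟨h1, h2 | h2, h3 | h3⟩ <;> have := h.bound h2 <;> have := h.bound h3
    · exact Or.inl ⟨by omega, h2, h3⟩
    · omega
    · omega
    · exact Or.inr ⟨by omega, h2, h3⟩

lemma adj_of_sym_ne_zero {n : ℕ} {l : Pair n → ℝ} {T : Set (Pair n)} (hl : ∀ e, e ∉ T → l e = 0)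
    {x o : ℕ} (h : sym l x o ≠ 0) : Adj (rel T) x o := by
  by_contra hcon
  rw [Adj, not_or] at hcon
  refine h ?_
  rw [sym, not_not.1 (mt (rel_of_coef_ne_zero hl) hcon.1),
    not_not.1 (mt (rel_of_coef_ne_zero hl) hcon.2), add_zero]

/-- Two triangulations with a common ear order the neighbours of its inner vertices alike. -/
lemma Tri.eq_of_swap {n : ℕ} {A A' : ℕ → ℕ → Prop} (h : Tri n A) (h' : Tri n A') {v p q : ℕ}
    (hv : A v (v + 3)) (hv' : A' v (v + 3)) (hp : p < v ∨ v + 3 < p) (hq : q < v ∨ v + 3 < q)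
    (h1 : Adj A (v + 1) p) (h2 : Adj A (v + 2) q) (h1' : Adj A' (v + 1) q)
    (h2' : Adj A' (v + 2) p) : p = q := by
  rcases h1 with h1 | h1 <;> rcases h2 with h2 | h2 <;> rcases h1' with h1' | h1' <;>
    rcases h2' with h2' | h2' <;> have b1 := h.bound h1 <;> have b2 := h.bound h2 <;>
    have b3 := h'.bound h1' <;> have b4 := h'.bound h2' <;> try omega
  · exact le_antisymm (h'.ear_right hv' h1' h2' (by omega)) (h.ear_right hv h1 h2 (by omega))
  · exact (h.ear_mixed hv h1 h2 (by omega) (by omega)).elim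
  · exact (h'.ear_mixed hv' h1' h2' (by omega) (by omega)).elim
  · exact le_antisymm (h'.ear_left hv' h1' h2' (by omega)) (h.ear_left hv h1 h2 (by omega))

theorem indep_merge {N v : ℕ} (hN : 5 ≤ N) (hv : v + 3 ≤ N) {t : Fin N → ℝ} (ht : StrictMono t)
    (hI : Indep N t) {T : Set (Pair (N + 1))} (hT : IsTriangulation (N + 1) 2 T)
    (hear : rel T v (v + 3)) {l : Pair (N + 1) → ℝ} (hl : ∀ e, e ∉ T → l e = 0)
    (h0 : comb (row (t ∘ mergeFin v (by omega))) l = 0) : l = 0 := by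
  have hA := (isTriangulation_iff T).1 hT
  have hp : push v l = 0 := hI _ (hA.contr hN hear).isTriangulation _ (push_supp hl)
    (comb_push_eq_zero (by omega) h0)
  obtain ⟨c, hc⟩ := hA.exists_common (by omega) hear
  have hzc : ∀ o, o ≤ N → (o < v ∨ v + 3 < o) → o ≠ c → sym l (v + 1) o = 0 := by
    intro o ho ho' hoc
    by_contra hne
    have h2 := sym_add_eq_zero_of_push hp (o := o) (by omega) (by omega) ho (by omega)
    have hne' : sym l (v + 2) o ≠ 0 := fun h => hne (by rwa [h, add_zero] at h2)
    exact hoc (hA.common_unique hear (hA.common_iff.2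
      ⟨ho', adj_of_sym_ne_zero hl hne, adj_of_sym_ne_zero hl hne'⟩) hc)
  have hc1 := (hA.common_iff.1 hc).1
  have hcN : c ≤ N := by
    rcases (hA.common_iff.1 hc).2.1 with h | h <;> have := hA.bound h <;> omega
  obtain ⟨c', hcN', hc', hcc⟩ : ∃ c', c' ≤ N ∧ (c' < v ∨ v + 3 < c') ∧ c ≠ c' := by
    by_cases h1 : 0 < v ∧ c ≠ 0
    · exact ⟨0, by omega, by omega, by omega⟩
    by_cases h2 : v + 3 < N ∧ c ≠ N
    · exact ⟨N, by omega, by omega, by omega⟩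
    by_cases h3 : v + 3 < N
    · exact ⟨N - 1, by omega, by omega, by omega⟩
    · exact ⟨1, by omega, by omega, by omega⟩
  obtain ⟨q, q', hq, hq', e1, -⟩ := exists_balance hv ht hp h0 hcN hcN' hc1 hc' hcc
    (fun o h1 h2 h3 _ => hzc o h1 h2 h3)
  refine eq_zero_of_push hv ht hp h0 fun o ho ho' => ?_
  by_cases hoc : o = c
  · subst hoc
    have h2 := sym_add_eq_zero_of_push hp (o := c') (by omega) (by omega) hcN' (by omega)
    rw [hzc c' hcN' hc' (Ne.symm hcc), zero_add] at h2
    rw [h2, zero_mul] at e1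
    exact (mul_eq_zero.1 e1).resolve_right hq.ne'
  · exact hzc o ho ho' hoc

end TwoTri

namespace TwoTri

open FlipFan

/-- The pair `e` has endpoints `x` and `o`. -/
def Joins {n : ℕ} (e : Pair n) (x o : ℕ) : Prop :=
  ((e.val.1 : ℕ) = x ∧ (e.val.2 : ℕ) = o) ∨ ((e.val.1 : ℕ) = o ∧ (e.val.2 : ℕ) = x)

lemma Joins.sym_eq {n : ℕ} {e : Pair n} {x o : ℕ} (h : Joins e x o) (l : Pair n → ℝ) :
    sym l x o = l e := by
  have := pair_lt e
  rcases h with ⟨rfl, rfl⟩ | ⟨rfl, rfl⟩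
  · rw [sym_of_lt l this, coef_pair]
  · rw [sym_of_gt l this, coef_pair]

lemma Joins.adj_iff {n : ℕ} {e : Pair n} {x o : ℕ} (h : Joins e x o) {T : Set (Pair n)} :
    Adj (rel T) x o ↔ e ∈ T := by
  have := pair_lt e
  rcases h with ⟨rfl, rfl⟩ | ⟨rfl, rfl⟩
  · refine ⟨fun h => h.elim (rel_iff e).1 fun h => ?_, fun h => Or.inl ((rel_iff e).2 h)⟩
    have := rel_bound h
    omega
  · refine ⟨fun h => h.elim (fun h => ?_) (rel_iff e).1, fun h => Or.inr ((rel_iff e).2 h)⟩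
    have := rel_bound h
    omega

lemma exists_joins {n : ℕ} {T : Set (Pair n)} {x o : ℕ} (h : Adj (rel T) x o) :
    ∃ e ∈ T, Joins e x o := by
  rcases h with ⟨e, he, h1, h2⟩ | ⟨e, he, h1, h2⟩
  · exact ⟨e, he, Or.inl ⟨h1, h2⟩⟩
  · exact ⟨e, he, Or.inr ⟨h1, h2⟩⟩

/-- The flip sign condition, in terms of linear dependencies. -/
def SignAt {n : ℕ} (t : Fin n → ℝ) (T : Set (Pair n)) : Prop :=
  ∀ e ∈ T, e ∉ shortPairs n 2 → ∀ e', e' ∉ T → IsTriangulation n 2 (insert e' (T \ {e})) →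
    ∀ l : Pair n → ℝ, (∀ f, f ∉ insert e' T → l f = 0) → comb (row t) l = 0 → l e' ≠ 0 →
      0 < l e * l e'

lemma short_subset {n : ℕ} {T : Set (Pair n)} (hT : IsTriangulation n 2 T) :
    shortPairs n 2 ⊆ T := by
  intro e he
  by_contra h
  rw [← rel_iff] at h
  have h1 := pair_lt e
  have h2 := e.val.2.2
  have h3 : ¬ ((e.val.1 : ℕ) + 3 ≤ e.val.2 ∧ (e.val.2 : ℕ) + 3 ≤ e.val.1 + n) :=
    fun h => (notMem_shortPairs_iff e).2 h he
  exact h (((isTriangulation_iff T).1 hT).short_mem h1 h2 (by omega))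

/-- The sign condition for flips at the common neighbour of the merged vertices. -/
lemma sign_merge_atCommon {N v : ℕ} (hN : 5 ≤ N) (hv : v + 3 ≤ N) {t : Fin N → ℝ}
    (ht : StrictMono t) (hI : Indep N t) {T : Set (Pair (N + 1))}
    (hT : IsTriangulation (N + 1) 2 T) (hear : rel T v (v + 3)) {e e' : Pair (N + 1)}
    (he : e ∈ T) (he' : e' ∉ T) (hT' : IsTriangulation (N + 1) 2 (insert e' (T \ {e})))
    (hear' : rel (insert e' (T \ {e})) v (v + 3)) {x y c : ℕ}
    (hxy : (x = v + 1 ∧ y = v + 2) ∨ (x = v + 2 ∧ y = v + 1))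
    (hex : Joins e x c) (hc : Common (rel T) v c)
    {l : Pair (N + 1) → ℝ} (hl : ∀ f, f ∉ insert e' T → l f = 0)
    (h0 : comb (row (t ∘ mergeFin v (by omega))) l = 0) (hne : l e' ≠ 0) : 0 < l e * l e' := by
  have hA := (isTriangulation_iff _).1 hT
  have hA' := (isTriangulation_iff _).1 hT'
  have hee : e' ≠ e := fun h => he' (h ▸ he)
  have heT' : e ∉ insert e' (T \ {e}) := by
    rintro (h | h)
    · exact hee h.symm
    · exact h.2 rfl
  obtain ⟨c', hc'⟩ := hA'.exists_common (by omega) hear'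
  have kc := hA.common_iff.1 hc
  have kc' := hA'.common_iff.1 hc'
  have hcc : c ≠ c' := by
    rintro rfl
    rcases hxy with ⟨rfl, rfl⟩ | ⟨rfl, rfl⟩
    · exact heT' (hex.adj_iff.1 kc'.2.1)
    · exact heT' (hex.adj_iff.1 kc'.2.2)
  have hback : ∀ {x o}, Adj (rel (insert e' (T \ {e}))) x o → Adj (rel T) x o ∨ Joins e' x o := by
    intro x o h
    obtain ⟨f, hf, hfx⟩ := exists_joins h
    rcases hf with rfl | hf
    · exact Or.inr hfx
    · exact Or.inl (hfx.adj_iff.2 hf.1)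
  have hfwd : ∀ {x o}, Adj (rel T) x o → ¬ Joins e x o →
      Adj (rel (insert e' (T \ {e}))) x o := by
    intro x o h hn
    obtain ⟨f, hf, hfx⟩ := exists_joins h
    exact hfx.adj_iff.2 (Or.inr ⟨hf, fun h => hn (by rwa [← Set.mem_singleton_iff.1 h])⟩)
  have hne1 : ∀ {z}, z ≠ x → (z = v + 1 ∨ z = v + 2) → ¬ Joins e z c := by
    intro z hz hz' h
    unfold Joins at h hex
    omega
  have hcy : Adj (rel (insert e' (T \ {e}))) y c := by
    refine hfwd ?_ (hne1 (by omega) (by omega))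
    rcases hxy with ⟨rfl, rfl⟩ | ⟨rfl, rfl⟩
    · exact kc.2.2
    · exact kc.2.1
  have hx' : Adj (rel (insert e' (T \ {e}))) x c' := by
    rcases hxy with ⟨rfl, rfl⟩ | ⟨rfl, rfl⟩
    · exact kc'.2.1
    · exact kc'.2.2
  have hy' : Adj (rel (insert e' (T \ {e}))) y c' := by
    rcases hxy with ⟨rfl, rfl⟩ | ⟨rfl, rfl⟩
    · exact kc'.2.2
    · exact kc'.2.1
  have hxc : Adj (rel T) x c := by
    rcases hxy with ⟨rfl, rfl⟩ | ⟨rfl, rfl⟩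
    · exact kc.2.1
    · exact kc.2.2
  have hnot : ¬ Adj (rel T) y c' := by
    intro h
    rcases hxy with ⟨rfl, rfl⟩ | ⟨rfl, rfl⟩
    · exact hcc (hA.eq_of_swap hA' hear hear' kc.1 kc'.1 hxc h hx' hcy)
    · exact hcc (hA.eq_of_swap hA' hear hear' kc'.1 kc.1 h hxc hcy hx').symm
  have hey : Joins e' y c' := (hback hy').resolve_left hnot
  have hxT : Adj (rel T) x c' := by
    refine (hback hx').resolve_right fun h => ?_
    unfold Joins at h hey
    omega
  have hp : push v l = 0 := by
    refine hI _ (hA.contr hN hear).isTriangulation _ (fun f hf => ?_)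
      (comb_push_eq_zero (by omega) h0)
    by_contra hpn
    obtain ⟨g, hg, h1, h2⟩ := exists_of_push_ne_zero hpn
    by_cases hgT : g ∈ T
    · exact hf ⟨pair_lt f, g.val.1, g.val.2, (rel_iff g).2 hgT, h1, h2⟩
    · have hge : g = e' := by
        by_contra h
        exact hg (hl g (by rintro (h' | h') <;> contradiction))
      subst hge
      have s1 := merge_spec v (v + 1)
      have s2 := merge_spec v (v + 2)
      have hm : merge v x = merge v y := by
        rcases hxy with ⟨rfl, rfl⟩ | ⟨rfl, rfl⟩ <;> omega
      obtain ⟨k, hk, hkx⟩ := exists_joins hxT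
      have h3 := pair_lt g
      have h4 := pair_lt k
      have b := kc'.1
      rcases hey with ⟨r1, r2⟩ | ⟨r1, r2⟩ <;> rcases hkx with ⟨r3, r4⟩ | ⟨r3, r4⟩
      · exact hf ⟨pair_lt f, x, c', by rw [← r3, ← r4]; exact (rel_iff k).2 hk,
          by rw [hm, ← r1, h1], by rw [← r2, h2]⟩
      · omega
      · omega
      · exact hf ⟨pair_lt f, c', x, by rw [← r3, ← r4]; exact (rel_iff k).2 hk,
          by rw [← r1, h1], by rw [hm, ← r2, h2]⟩
  have hbN : ∀ {A : ℕ → ℕ → Prop}, Tri (N + 1) A → ∀ {z o}, Adj A z o → o ≤ N := by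
    intro A h z o hz
    rcases hz with hz | hz <;> have := h.bound hz <;> omega
  obtain ⟨q, q', hq, hq', e1, e2⟩ := exists_balance hv ht hp h0 (hbN hA kc.2.1)
    (hbN hA' kc'.2.1) kc.1 kc'.1 hcc (fun o ho ho' hoc hoc' => by
      by_contra hne0
      have h2 := sym_add_eq_zero_of_push hp (o := o) (by omega) (by omega) ho (by omega)
      have hne' : sym l (v + 2) o ≠ 0 := fun h => hne0 (by rwa [h, add_zero] at h2)
      have hT : ∀ z, (z = v + 1 ∨ z = v + 2) → sym l z o ≠ 0 → Adj (rel T) z o := by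
        intro z hz h
        obtain ⟨f, hf, hfz⟩ := exists_joins (adj_of_sym_ne_zero hl h)
        rcases hf with rfl | hf
        · unfold Joins at hfz hey
          omega
        · exact hfz.adj_iff.2 hf
      exact hoc (hA.common_unique hear (hA.common_iff.2
        ⟨ho', hT _ (Or.inl rfl) hne0, hT _ (Or.inr rfl) hne'⟩) hc))
  have hbal : l e * q = l e' * q' := by
    rw [← hex.sym_eq l, ← hey.sym_eq l]
    rcases hxy with ⟨rfl, rfl⟩ | ⟨rfl, rfl⟩
    · exact e1
    · exact e2
  have : l e = l e' * (q' / q) := by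
    field_simp
    exact hbal
  rw [this, mul_right_comm]
  exact mul_pos (mul_self_pos.2 hne) (div_pos hq' hq)

lemma atCommon_iff_joins {n v : ℕ} {T : Set (Pair n)} (e : Pair n) :
    AtCommon (rel T) v e.val.1 e.val.2 ↔
      ∃ x c, (x = v + 1 ∨ x = v + 2) ∧ Joins e x c ∧ Common (rel T) v c := by
  constructor
  · rintro (⟨h, hc⟩ | ⟨h, hc⟩ | ⟨h, hc⟩ | ⟨h, hc⟩)
    · exact ⟨_, _, Or.inl rfl, Or.inl ⟨h, rfl⟩, hc⟩
    · exact ⟨_, _, Or.inr rfl, Or.inl ⟨h, rfl⟩, hc⟩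
    · exact ⟨_, _, Or.inl rfl, Or.inr ⟨rfl, h⟩, hc⟩
    · exact ⟨_, _, Or.inr rfl, Or.inr ⟨rfl, h⟩, hc⟩
  · rintro ⟨x, c, rfl | rfl, ⟨h1, rfl⟩ | ⟨rfl, h1⟩, hc⟩
    · exact Or.inl ⟨h1, hc⟩
    · exact Or.inr (Or.inr (Or.inl ⟨h1, hc⟩))
    · exact Or.inr (Or.inl ⟨h1, hc⟩)
    · exact Or.inr (Or.inr (Or.inr ⟨h1, hc⟩))

lemma sign_merge {N v : ℕ} (hN : 5 ≤ N) (hv : v + 3 ≤ N) {t : Fin N → ℝ}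
    (ht : StrictMono t) (hI : Indep N t) (hS : ∀ T, IsTriangulation N 2 T → SignAt t T)
    {T : Set (Pair (N + 1))}
    (hT : IsTriangulation (N + 1) 2 T) (hear : rel T v (v + 3)) {e e' : Pair (N + 1)}
    (he : e ∈ T) (hes : e ∉ shortPairs (N + 1) 2) (hne : ¬ ((e.val.1 : ℕ) = v ∧ (e.val.2 : ℕ) = v + 3))
    (he' : e' ∉ T) (hT' : IsTriangulation (N + 1) 2 (insert e' (T \ {e})))
    {l : Pair (N + 1) → ℝ} (hl : ∀ f, f ∉ insert e' T → l f = 0)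
    (h0 : comb (row (t ∘ mergeFin v (by omega))) l = 0) (hne0 : l e' ≠ 0) : 0 < l e * l e' := by
  have hA := (isTriangulation_iff _).1 hT
  have hA' := (isTriangulation_iff _).1 hT'
  have hee : e' ≠ e := fun h => he' (h ▸ he)
  have hear' : rel (insert e' (T \ {e})) v (v + 3) := by
    obtain ⟨f, hf, h1, h2⟩ := hear
    refine ⟨f, Or.inr ⟨hf, ?_⟩, h1, h2⟩
    rintro rfl
    exact hne ⟨h1, h2⟩
  by_cases hat : AtCommon (rel T) v e.val.1 e.val.2
  · obtain ⟨x, c, hx, hxc, hc⟩ := (atCommon_iff_joins e).1 hat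
    rcases hx with rfl | rfl
    · exact sign_merge_atCommon hN hv ht hI hT hear he he' hT' hear' (Or.inl ⟨rfl, rfl⟩) hxc hc
        hl h0 hne0
    · exact sign_merge_atCommon hN hv ht hI hT hear he he' hT' hear' (Or.inr ⟨rfl, rfl⟩) hxc hc
        hl h0 hne0
  obtain ⟨c, hc⟩ := hA.exists_common (by omega) hear
  have kc := hA.common_iff.1 hc
  have hnj : ∀ x, (x = v + 1 ∨ x = v + 2) → ¬ Joins e x c := fun x hx h =>
    hat ((atCommon_iff_joins e).2 ⟨x, c, hx, h, hc⟩)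
  have hfwd : ∀ {x o}, Adj (rel T) x o → ¬ Joins e x o →
      Adj (rel (insert e' (T \ {e}))) x o := by
    intro x o h hn
    obtain ⟨f, hf, hfx⟩ := exists_joins h
    exact hfx.adj_iff.2 (Or.inr ⟨hf, fun h => hn (by rwa [← Set.mem_singleton_iff.1 h])⟩)
  have hc' : Common (rel (insert e' (T \ {e}))) v c := hA'.common_iff.2
    ⟨kc.1, hfwd kc.2.1 (hnj _ (Or.inl rfl)), hfwd kc.2.2 (hnj _ (Or.inr rfl))⟩
  have kc' := hA'.common_iff.1 hc'
  have hat' : ¬ AtCommon (rel (insert e' (T \ {e}))) v e'.val.1 e'.val.2 := by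
    intro h
    obtain ⟨x, d, hx, hxd, hd⟩ := (atCommon_iff_joins e').1 h
    have := hA'.common_unique hear' hd hc'
    subst this
    rcases hx with rfl | rfl
    · exact he' (hxd.adj_iff.1 kc.2.1)
    · exact he' (hxd.adj_iff.1 kc.2.2)
  have hes' : e' ∉ shortPairs (N + 1) 2 := fun h => he' (short_subset hT h)
  rw [notMem_shortPairs_iff] at hes hes'
  have heA : rel T e.val.1 e.val.2 := (rel_iff e).2 he
  have heA' : rel (insert e' (T \ {e})) e'.val.1 e'.val.2 := (rel_iff e').2 (Or.inl rfl)
  have hr := hA.merge_relevant hN hv heA hes.1 hes.2 hne hat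
  have hr' := hA'.merge_relevant hN hv heA' hes'.1 hes'.2 (fun h => he' (by
    obtain ⟨f, hf, h1, h2⟩ := hear
    rwa [pair_ext (e := e') (f := f) (by omega) (by omega)])) hat'
  have huniq : ∀ f ∈ T, merge v f.val.1 = merge v e.val.1 → merge v f.val.2 = merge v e.val.2 →
      f = e := by
    intro f hf h1 h2
    by_contra hfe
    exact hat (hA.atCommon_of_twin heA hes.1 hes.2 ((rel_iff f).2 hf) h1 h2
      fun h => hfe (pair_ext h.1 h.2))
  have huniq' : ∀ f ∈ insert e' (T \ {e}), merge v f.val.1 = merge v e'.val.1 →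
      merge v f.val.2 = merge v e'.val.2 → f = e' := by
    intro f hf h1 h2
    by_contra hfe
    exact hat' (hA'.atCommon_of_twin heA' hes'.1 hes'.2 ((rel_iff f).2 hf) h1 h2
      fun h => hfe (pair_ext h.1 h.2))
  have htwin : ¬ (merge v e'.val.1 = merge v e.val.1 ∧ merge v e'.val.2 = merge v e.val.2) := by
    rintro ⟨h1, h2⟩
    have key : ∀ x y o, ((x = v + 1 ∧ y = v + 2) ∨ (x = v + 2 ∧ y = v + 1)) →
        Joins e x o → Joins e' y o → False := by
      intro x y o hxy hx hy
      have a1 : Adj (rel T) x o := hx.adj_iff.2 he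
      have a2 : Adj (rel (insert e' (T \ {e}))) y o := hy.adj_iff.2 (Or.inl rfl)
      have ho : o < v ∨ v + 3 < o := by
        unfold Joins at hx hy
        omega
      have hoc : o = c := by
        rcases hxy with ⟨rfl, rfl⟩ | ⟨rfl, rfl⟩
        · exact hA.eq_of_swap hA' hear hear' ho kc.1 a1 kc.2.2 kc'.2.1 a2
        · exact (hA.eq_of_swap hA' hear hear' kc.1 ho kc.2.1 a1 a2 kc'.2.2).symm
      subst hoc
      exact hnj x (by omega) hx
    have hne' : ¬ ((e'.val.1 : ℕ) = e.val.1 ∧ (e'.val.2 : ℕ) = e.val.2) :=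
      fun h => hee (pair_ext h.1 h.2)
    have p1 := pair_lt e
    have p2 := pair_lt e'
    rcases merge_eq h1 with g1 | g1 | g1 <;> rcases merge_eq h2 with g2 | g2 | g2
    · exact hne' ⟨g1, g2⟩
    · exact key _ _ e.val.1 (Or.inr ⟨rfl, rfl⟩) (Or.inr ⟨rfl, g2.2⟩) (Or.inr ⟨g1, g2.1⟩)
    · exact key _ _ e.val.1 (Or.inl ⟨rfl, rfl⟩) (Or.inr ⟨rfl, g2.2⟩) (Or.inr ⟨g1, g2.1⟩)
    · exact key _ _ e.val.2 (Or.inr ⟨rfl, rfl⟩) (Or.inl ⟨g1.2, rfl⟩) (Or.inl ⟨g1.1, g2⟩)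
    · omega
    · omega
    · exact key _ _ e.val.2 (Or.inl ⟨rfl, rfl⟩) (Or.inl ⟨g1.2, rfl⟩) (Or.inl ⟨g1.1, g2⟩)
    · omega
    · omega
  have b2 := e.val.2.2
  have b2' := e'.val.2.2
  have s2 := merge_spec v e.val.2
  have s2' := merge_spec v e'.val.2
  have hB := (hA.contr hN hear).isTriangulation
  have hB' := (hA'.contr hN hear').isTriangulation
  set f : Pair N := mkPair (merge v e.val.1) (merge v e.val.2) (by omega) (by omega) with hf
  set f' : Pair N := mkPair (merge v e'.val.1) (merge v e'.val.2) (by omega) (by omega) with hf'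
  have hfB : f ∈ ofRel N (contr v (rel T)) := contr_of_mem heA (by omega)
  have hfs : f ∉ shortPairs N 2 := (notMem_shortPairs_iff f).2 hr
  have hfB' : f' ∉ ofRel N (contr v (rel T)) := by
    rintro ⟨-, i, j, ⟨g, hg, rfl, rfl⟩, h1, h2⟩
    by_cases hge : g = e
    · subst hge
      exact htwin ⟨h1.symm, h2.symm⟩
    · exact he' (huniq' g (Or.inr ⟨hg, hge⟩) h1 h2 ▸ hg)
  have hBB : insert f' (ofRel N (contr v (rel T)) \ {f}) =
      ofRel N (contr v (rel (insert e' (T \ {e})))) := by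
    ext g
    constructor
    · rintro (rfl | ⟨⟨hlt, i, j, ⟨k, hk, rfl, rfl⟩, h1, h2⟩, hgf⟩)
      · exact contr_of_mem heA' (by omega)
      · refine ⟨hlt, _, _, ⟨k, Or.inr ⟨hk, ?_⟩, rfl, rfl⟩, h1, h2⟩
        rintro rfl
        exact hgf (pair_ext h1.symm h2.symm)
    · rintro ⟨hlt, i, j, ⟨k, hk, rfl, rfl⟩, h1, h2⟩
      rcases hk with rfl | hk
      · exact Or.inl (pair_ext h1.symm h2.symm)
      · refine Or.inr ⟨⟨hlt, _, _, ⟨k, hk.1, rfl, rfl⟩, h1, h2⟩, ?_⟩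
        rintro rfl
        exact hk.2 (huniq k hk.1 h1 h2)
  have hlT : ∀ g, l g ≠ 0 → g = e' ∨ g ∈ T := fun g hg => by
    by_contra h
    exact hg (hl g h)
  have hpf : push v l f = l e := by
    refine push_apply_of_unique rfl rfl fun g hge h1 h2 => ?_
    by_contra hg
    rcases hlT g hg with rfl | hgT
    · exact htwin ⟨h1, h2⟩
    · exact hge (huniq g hgT h1 h2)
  have hpf' : push v l f' = l e' := by
    refine push_apply_of_unique rfl rfl fun g hge h1 h2 => ?_
    by_contra hg
    rcases hlT g hg with rfl | hgT
    · exact hge rfl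
    · by_cases hgee : g = e
      · subst hgee
        exact htwin ⟨h1.symm, h2.symm⟩
      · exact hge (huniq' g (Or.inr ⟨hgT, hgee⟩) h1 h2)
  have := hS _ hB f hfB hfs f' hfB' (by rw [hBB]; exact hB') (push v l) (fun g hg => by
    by_contra hgn
    obtain ⟨k, hk, h1, h2⟩ := exists_of_push_ne_zero hgn
    rcases hlT k hk with rfl | hkT
    · exact hg (Or.inl (pair_ext h1.symm h2.symm))
    · exact hg (Or.inr ⟨pair_lt g, _, _, (rel_iff k).2 hkT, h1, h2⟩))
    (comb_push_eq_zero (by omega) h0) (by rwa [hpf'])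
  rwa [hpf, hpf'] at this

end TwoTri

namespace TwoTri

open FlipFan

/-- The vertex `v + 2`. -/
def extraVertex {N : ℕ} (v : ℕ) (hv : v + 2 ≤ N) : Fin (N + 1) := ⟨v + 2, by omega⟩

lemma succAbove_spec {N v : ℕ} (hv : v + 2 ≤ N) (i : Fin N) :
    ((i : ℕ) ≤ v + 1 ∧ ((extraVertex v hv).succAbove i : ℕ) = i) ∨
      (v + 2 ≤ (i : ℕ) ∧ ((extraVertex v hv).succAbove i : ℕ) = i + 1) := by
  by_cases h : (i : ℕ) ≤ v + 1
  · refine Or.inl ⟨h, ?_⟩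
    rw [Fin.succAbove_of_castSucc_lt _ _ (by rw [Fin.lt_def]; simp [extraVertex]; omega)]
    rfl
  · refine Or.inr ⟨by omega, ?_⟩
    rw [Fin.succAbove_of_le_castSucc _ _ (by rw [Fin.le_def]; simp [extraVertex]; omega)]
    rfl

lemma merge_succAbove {N v : ℕ} (hv : v + 2 ≤ N) (i : Fin N) :
    merge v ((extraVertex v hv).succAbove i) = i := by
  have h1 := succAbove_spec hv i
  have h2 := merge_spec v ((extraVertex v hv).succAbove i)
  omega

lemma mergeFin_succAbove {N v : ℕ} (hv : v + 2 ≤ N) (i : Fin N) :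
    mergeFin v hv ((extraVertex v hv).succAbove i) = i :=
  Fin.ext (merge_succAbove hv i)

lemma mergeFin_monotone {N v : ℕ} (hv : v + 2 ≤ N) : Monotone (mergeFin v hv) := by
  intro i j hij
  rw [Fin.le_def] at hij ⊢
  have h1 := merge_spec v i
  have h2 := merge_spec v j
  simp only [mergeFin]
  omega

/-- The parameters on the way from the merged position of `v + 2` to its position in `t`. -/
noncomputable def path {N : ℕ} (v : ℕ) (hv : v + 2 ≤ N) (t : Fin (N + 1) → ℝ) (s : ℝ) :
    Fin (N + 1) → ℝ :=
  fun i => (1 - s) * t ((extraVertex v hv).succAbove (mergeFin v hv i)) + s * t i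

lemma path_zero {N v : ℕ} (hv : v + 2 ≤ N) (t : Fin (N + 1) → ℝ) :
    path v hv t 0 = (t ∘ (extraVertex v hv).succAbove) ∘ mergeFin v hv := by
  ext i
  simp [path]

lemma path_one {N v : ℕ} (hv : v + 2 ≤ N) (t : Fin (N + 1) → ℝ) : path v hv t 1 = t := by
  ext i
  simp [path]

lemma path_strictMono {N v : ℕ} (hv : v + 2 ≤ N) {t : Fin (N + 1) → ℝ} (ht : StrictMono t) {s : ℝ}
    (h0 : 0 < s) (h1 : s ≤ 1) : StrictMono (path v hv t s) := by
  intro i j hij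
  have h2 : t ((extraVertex v hv).succAbove (mergeFin v hv i)) ≤
      t ((extraVertex v hv).succAbove (mergeFin v hv j)) :=
    ht.monotone ((Fin.strictMono_succAbove _).monotone (mergeFin_monotone hv hij.le))
  exact add_lt_add_of_le_of_lt (mul_le_mul_of_nonneg_left h2 (by linarith))
    (mul_lt_mul_of_pos_left (ht hij) h0)

lemma continuous_row {n : ℕ} {X : Type*} [TopologicalSpace X] {t : X → Fin n → ℝ}
    (ht : ∀ i, Continuous fun x => t x i) (e : Pair n) : Continuous fun x => row (t x) e := by
  refine continuous_pi fun p => ?_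
  unfold row
  refine Continuous.sub ?_ ?_
  · by_cases h : p.1 = e.val.1
    · simp only [h, if_true]
      exact Continuous.pow (ht _) _
    · simpa [h] using continuous_const
  · by_cases h : p.1 = e.val.2
    · simp only [h, if_true]
      exact Continuous.pow (ht _) _
    · simpa [h] using continuous_const

lemma continuous_row_path {N v : ℕ} (hv : v + 2 ≤ N) (t : Fin (N + 1) → ℝ) (e : Pair (N + 1)) :
    Continuous fun s : unitInterval => row (path v hv t s) e :=
  continuous_row (fun i => by unfold path; fun_prop) e

/-- The triangulations containing a given set of pairs. -/
def facets (n : ℕ) (S : Set (Pair n)) : Set (Set (Pair n)) := {T | IsTriangulation n 2 T ∧ S ⊆ T}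

lemma exists_four_of_strictMono {n : ℕ} (hn : 5 ≤ n) {t : Fin n → ℝ} (ht : StrictMono t) :
    ∃ x : Fin 4 → Fin n, Function.Injective (t ∘ x) :=
  ⟨Fin.castLE (by omega), ht.injective.comp (Fin.castLE_injective _)⟩

lemma exists_four_of_merge {N v : ℕ} (hN : 5 ≤ N) (hv : v + 2 ≤ N) {t : Fin N → ℝ}
    (ht : StrictMono t) :
    ∃ x : Fin 4 → Fin (N + 1), Function.Injective ((t ∘ mergeFin v hv) ∘ x) := by
  obtain ⟨x, hx⟩ := exists_four_of_strictMono hN ht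
  refine ⟨(extraVertex v hv).succAbove ∘ x, ?_⟩
  have : (t ∘ mergeFin v hv) ∘ (extraVertex v hv).succAbove ∘ x = t ∘ x := by
    ext i
    simp [mergeFin_succAbove]
  rwa [this]

lemma exists_flip_pair {n : ℕ} (hn : 5 ≤ n) {T : Set (Pair n)} (hT : IsTriangulation n 2 T)
    {e : Pair n} (he : e ∈ T) (hes : e ∉ shortPairs n 2) :
    ∃ e', e' ∉ T ∧ IsTriangulation n 2 (insert e' (T \ {e})) := by
  have hA := (isTriangulation_iff T).1 hT
  rw [notMem_shortPairs_iff] at hes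
  obtain ⟨A', hA', hn', hsub⟩ := hA.exists_flip hn ((rel_iff e).2 he) hes.1 hes.2
  have h1 : T.ncard + 10 = 4 * n := by rw [ncard_eq]; exact hA.ncard hn
  have h2 : (ofRel n A').ncard + 10 = 4 * n := by
    rw [ncard_eq, hA'.rel_ofRel]
    exact hA'.ncard hn
  have h3 := Set.ncard_sdiff_singleton_add_one he
  have hsub' : T \ {e} ⊆ ofRel n A' := fun f hf =>
    hsub _ _ ((rel_iff f).2 hf.1) fun h => hf.2 (pair_ext h.1 h.2)
  obtain ⟨e', he', hne'⟩ := Set.exists_mem_notMem_of_ncard_lt_ncard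
    (s := T \ {e}) (t := ofRel n A') (by omega)
  have hee : e' ≠ e := by
    rintro rfl
    exact hn' he'
  refine ⟨e', fun h => hne' ⟨h, hee⟩, ?_⟩
  rw [Set.eq_of_subset_of_ncard_le (s := insert e' (T \ {e})) (t := ofRel n A')]
  · exact hA'.isTriangulation
  · exact Set.insert_subset he' hsub'
  · rw [Set.ncard_insert_of_notMem hne']
    omega

lemma flipSystem_of_sign {n : ℕ} (hn : 5 ≤ n) {t : Fin n → ℝ} {S : Set (Pair n)}
    (hS : shortPairs n 2 ⊆ S) (hf : ∀ T ∈ facets n S, IsFrame (row t) T)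
    (hs : ∀ T ∈ facets n S, ∀ e ∈ T, e ∉ S → ∀ e', e' ∉ T →
      IsTriangulation n 2 (insert e' (T \ {e})) → ∀ l : Pair n → ℝ,
      (∀ f, f ∉ insert e' T → l f = 0) → comb (row t) l = 0 → l e' ≠ 0 → 0 < l e * l e') :
    FlipSystem (row t) S (facets n S) where
  sub := fun T hT => hT.2
  frame := hf
  flip := fun T hT e he heS => by
    obtain ⟨e', he', h⟩ := exists_flip_pair hn hT.1 he (fun h => heS (hS h))
    refine ⟨e', he', h, fun f hf => Or.inr ⟨hT.2 hf, ?_⟩⟩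
    rintro rfl
    exact heS hf
  sign := fun T hT e he heS e' he' hT' z hz hc => by
    classical
    have hee : e ≠ e' := fun h => he' (h ▸ he)
    have := hs T hT e he heS e' he' hT'.1 (Pi.single e' 1 - z) (fun f hf => by
      have h1 : f ≠ e' := fun h => hf (Or.inl h)
      simp [h1, hz f (fun h => hf (Or.inr h))])
      (by rw [comb_sub, comb_single, hc, sub_self]) (by simp [hz e' he'])
    simpa [hz e' he', hee] using this

/-- The rows of every triangulation are linearly independent for all increasing parameters. -/
def IndepAll (n : ℕ) : Prop := ∀ t : Fin n → ℝ, StrictMono t → Indep n t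

lemma frame_of_indepAll {n : ℕ} (hn : 5 ≤ n) (h : IndepAll n) {t : Fin n → ℝ} (ht : StrictMono t)
    {T : Set (Pair n)} (hT : IsTriangulation n 2 T) : IsFrame (row t) T := by
  obtain ⟨x, hx⟩ := exists_four_of_strictMono hn ht
  exact isFrame_row hn hx hT (h t ht T hT)

lemma frame_merge {N v : ℕ} (hN : 5 ≤ N) (hv : v + 3 ≤ N) {t : Fin N → ℝ} (ht : StrictMono t)
    (hI : Indep N t) {T : Set (Pair (N + 1))} (hT : IsTriangulation (N + 1) 2 T)
    (hear : rel T v (v + 3)) : IsFrame (row (t ∘ mergeFin v (by omega))) T := by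
  obtain ⟨x, hx⟩ := exists_four_of_merge (v := v) hN (by omega) ht
  exact isFrame_row (by omega) hx hT fun z hz h0 => indep_merge hN hv ht hI hT hear hz h0

lemma frame_path {N v : ℕ} (hN : 5 ≤ N) (hv : v + 3 ≤ N) {t : Fin (N + 1) → ℝ} (ht : StrictMono t)
    (hI : IndepAll N) (hI' : IndepAll (N + 1)) {T : Set (Pair (N + 1))}
    (hT : IsTriangulation (N + 1) 2 T) (hear : rel T v (v + 3)) (s : unitInterval) :
    IsFrame (row (path v (by omega) t s)) T := by
  have ht' : StrictMono (t ∘ (extraVertex v (show v + 2 ≤ N by omega)).succAbove) :=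
    ht.comp (Fin.strictMono_succAbove _)
  by_cases hs : (s : ℝ) = 0
  · rw [hs, path_zero]
    exact frame_merge hN hv ht' (hI _ ht') hT hear
  · exact frame_of_indepAll (by omega) hI'
      (path_strictMono _ ht (lt_of_le_of_ne s.2.1 (Ne.symm hs)) s.2.2) hT

lemma signAt_succ {N : ℕ} (hN : 5 ≤ N) (hI : IndepAll N) (hI' : IndepAll (N + 1))
    (hS : ∀ t : Fin N → ℝ, StrictMono t → ∀ T, IsTriangulation N 2 T → SignAt t T)
    {t : Fin (N + 1) → ℝ} (ht : StrictMono t) {T : Set (Pair (N + 1))}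
    (hT : IsTriangulation (N + 1) 2 T) : SignAt t T := by
  classical
  intro e he hes e' he' hT' l hl h0 hne
  have hA := (isTriangulation_iff _).1 hT
  obtain ⟨v, hear, hve⟩ := hA.exists_ear_ne (by omega) e.val.1 e.val.2
  have hv : v + 3 ≤ N := by have := hA.bound hear; omega
  have hee : e ≠ e' := fun h => he' (h ▸ he)
  have hear' : rel (insert e' (T \ {e})) v (v + 3) := by
    obtain ⟨f, hf, h1, h2⟩ := hear
    refine ⟨f, Or.inr ⟨hf, ?_⟩, h1, h2⟩
    rintro rfl
    exact hve ⟨h1.symm, h2.symm⟩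
  have ht' : StrictMono (t ∘ (extraVertex v (show v + 2 ≤ N by omega)).succAbove) :=
    ht.comp (Fin.strictMono_succAbove _)
  have hF := fun s => frame_path hN hv ht hI hI' hT hear s
  have hF' := fun s => frame_path hN hv ht hI hI' hT' hear' s
  let g : unitInterval → ℝ := fun s =>
    coord (row (path v (by omega) t s)) T (Pi.single e' 1) e
  have hg : Continuous g := continuous_coord
    (w := fun s : unitInterval => row (path v (by omega) t s))
    (continuous_row_path (by omega) t) hF _ _
  let m : unitInterval → Pair (N + 1) → ℝ := fun s =>
    Pi.single e' 1 - coord (row (path v (by omega) t s)) T (Pi.single e' 1)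
  have hm0 : ∀ s : unitInterval, comb (row (path v (by omega) t s)) (m s) = 0 := fun s => by
    rw [comb_sub, (hF s).comb_coord, sub_self]
  have hme' : ∀ s, m s e' = 1 := fun s => by simp [m, (hF s).coord_supp _ he']
  have hme : ∀ s, m s e = - g s := fun s => by simp [m, g, hee]
  have hmT : ∀ s f, f ∉ insert e' T → m s f = 0 := fun s f hf => by
    have h1 : f ≠ e' := fun h => hf (Or.inl h)
    simp [m, h1, (hF s).coord_supp _ (fun h => hf (Or.inr h))]
  have hg0 : ∀ s, g s ≠ 0 := by
    intro s hs
    have := (hF' s).indep (m s) (fun f hf => by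
      by_cases hfe : f = e
      · rw [hfe, hme, hs, neg_zero]
      · refine hmT s f ?_
        rintro (h | h)
        · exact hf (Or.inl h)
        · exact hf (Or.inr ⟨h, hfe⟩)) (hm0 s)
    have h := congrFun this e'
    rw [hme'] at h
    exact one_ne_zero h
  have hstart : g 0 < 0 := by
    have h1 := hm0 0
    have e0 : ((0 : unitInterval) : ℝ) = 0 := rfl
    rw [e0, path_zero] at h1
    have := sign_merge hN hv ht' (hI _ ht') (hS _ ht') hT hear he hes
      (fun h => hve ⟨h.1.symm, h.2.symm⟩) he' hT' (hmT 0) h1 (by rw [hme']; norm_num)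
    rw [hme', hme] at this
    linarith
  have hend : g 1 < 0 := by
    by_contra hcon
    obtain ⟨s, hs⟩ := intermediate_value_univ (0 : unitInterval) 1 hg
      ⟨hstart.le, not_lt.1 hcon⟩
    exact hg0 s hs
  have e1 : ((1 : unitInterval) : ℝ) = 1 := rfl
  have hF1 := hF 1
  have hg1 : g 1 = coord (row t) T (Pi.single e' 1) e := by
    simp only [g]
    rw [e1, path_one]
  rw [e1, path_one] at hF1
  rw [hg1, hF1.coord_unique (z := Pi.single e' 1 - (l e')⁻¹ • l)] at hend
  · simp only [Pi.sub_apply, Pi.smul_apply, smul_eq_mul, Pi.single_eq_of_ne hee, zero_sub,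
      neg_lt_zero] at hend
    have := mul_pos hend (mul_self_pos.2 hne)
    calc 0 < (l e')⁻¹ * l e * (l e' * l e') := this
      _ = l e * l e' := by field_simp
  · intro f hf
    by_cases hfe : f = e'
    · subst hfe
      simp [hne]
    · simp [hfe, hl f (by rintro (h | h) <;> contradiction)]
  · rw [comb_sub, comb_smul, h0, smul_zero, sub_zero]

/-- The function on pairs avoiding the vertex `v + 2`. -/
def res {N v : ℕ} (hv : v + 2 ≤ N) (l : Pair (N + 1) → ℝ) (f : Pair N) : ℝ :=
  l ⟨((extraVertex v hv).succAbove f.val.1, (extraVertex v hv).succAbove f.val.2),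
    Fin.strictMono_succAbove _ f.2⟩

/-- Extension by zero to the pairs at the vertex `v + 2`. -/
noncomputable def ext {N : ℕ} (v : ℕ) (l : Pair N → ℝ) (e : Pair (N + 1)) : ℝ :=
  if (e.val.1 : ℕ) = v + 2 ∨ (e.val.2 : ℕ) = v + 2 then 0
    else coef l (merge v e.val.1) (merge v e.val.2)

lemma res_ext {N v : ℕ} (hv : v + 2 ≤ N) (l : Pair N → ℝ) : res hv (ext v l) = l := by
  ext f
  have h1 := succAbove_spec hv f.val.1
  have h2 := succAbove_spec hv f.val.2
  rw [res, ext, if_neg (by simp only; omega)]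
  simp only [merge_succAbove, coef_pair]

lemma coef_res {N v : ℕ} (hv : v + 2 ≤ N) (l : Pair (N + 1) → ℝ) (i j : Fin N) :
    coef (res hv l) i j =
      coef l ((extraVertex v hv).succAbove i) ((extraVertex v hv).succAbove j) := by
  by_cases hij : i < j
  · have hij' : (extraVertex v hv).succAbove i < (extraVertex v hv).succAbove j :=
      Fin.strictMono_succAbove _ hij
    rw [coef, dif_pos ⟨hij, j.2⟩, coef, dif_pos ⟨hij', Fin.is_lt _⟩]
    rfl
  · have hij' : (extraVertex v hv).succAbove j ≤ (extraVertex v hv).succAbove i :=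
      (Fin.strictMono_succAbove _).monotone (not_lt.1 hij)
    rw [coef_eq_zero _ (by simpa using hij), coef_eq_zero _ (by simpa using hij')]

lemma comb_res {N v : ℕ} (hv : v + 2 ≤ N) (t : Fin (N + 1) → ℝ) {l : Pair (N + 1) → ℝ}
    (hl : ∀ x, sym l (v + 2) x = 0) (i : Fin N) (k : Fin 4) :
    comb (row t) l ((extraVertex v hv).succAbove i, k) =
      comb (row (t ∘ (extraVertex v hv).succAbove)) (res hv l) (i, k) := by
  rw [comb_row_apply, comb_row_apply, Fin.sum_univ_succAbove _ (extraVertex v hv)]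
  have h1 : ∀ x, coef l (v + 2) x = 0 ∧ coef l x (v + 2) = 0 := by
    intro x
    have := hl x
    rcases lt_trichotomy x (v + 2) with h | h | h
    · rw [sym_of_gt l h] at this
      exact ⟨coef_eq_zero l h.le, this⟩
    · exact ⟨coef_eq_zero l h.le, coef_eq_zero l h.ge⟩
    · rw [sym_of_lt l h] at this
      exact ⟨this, coef_eq_zero l h.le⟩
  have h2 : ((extraVertex v hv : Fin (N + 1)) : ℕ) = v + 2 := rfl
  rw [h2, (h1 _).1, (h1 _).2, sub_self, zero_mul, zero_add]
  simp only [coef_res, Function.comp]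

lemma sym_ext {N v : ℕ} (l : Pair N → ℝ) (x : ℕ) : sym (ext v l) (v + 2) x = 0 := by
  have h : ∀ i j, (i = v + 2 ∨ j = v + 2) → coef (ext v l) i j = 0 := by
    intro i j hij
    unfold coef
    split_ifs with h
    · exact if_pos hij
    · rfl
  rw [sym, h _ _ (Or.inl rfl), h _ _ (Or.inr rfl), add_zero]

lemma comb_extraVertex {N v : ℕ} (hv : v + 2 ≤ N) (t : Fin (N + 1) → ℝ) {l : Pair (N + 1) → ℝ}
    (hl : ∀ x, sym l (v + 2) x = 0) (k : Fin 4) :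
    comb (row t) l (extraVertex v hv, k) = 0 := by
  rw [comb_row_apply]
  refine Finset.sum_eq_zero fun j _ => ?_
  have h2 : ((extraVertex v hv : Fin (N + 1)) : ℕ) = v + 2 := rfl
  have := hl j
  rw [h2]
  rcases lt_trichotomy (j : ℕ) (v + 2) with h | h | h
  · rw [sym_of_gt l h] at this
    rw [coef_eq_zero l h.le, this, sub_self, zero_mul]
  · rw [h, sub_self, zero_mul]
  · rw [sym_of_lt l h] at this
    rw [coef_eq_zero l h.le, this, sub_self, zero_mul]

lemma comb_eq_of_res {N v : ℕ} (hv : v + 2 ≤ N) (t : Fin (N + 1) → ℝ) {l m : Pair (N + 1) → ℝ}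
    (hl : ∀ x, sym l (v + 2) x = 0) (hm : ∀ x, sym m (v + 2) x = 0) :
    comb (row t) l = comb (row t) m ↔
      comb (row (t ∘ (extraVertex v hv).succAbove)) (res hv l) =
        comb (row (t ∘ (extraVertex v hv).succAbove)) (res hv m) := by
  constructor
  · intro h
    ext ⟨i, k⟩
    rw [← comb_res hv t hl, ← comb_res hv t hm, h]
  · intro h
    ext ⟨i, k⟩
    rcases Fin.eq_self_or_eq_succAbove (extraVertex v hv) i with rfl | ⟨i, rfl⟩
    · rw [comb_extraVertex hv t hl, comb_extraVertex hv t hm]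
    · rw [comb_res hv t hl, comb_res hv t hm, h]

lemma exists_insert {N : ℕ} (hN : 5 ≤ N) {t : Fin N → ℝ} (ht : StrictMono t) :
    ∃ t' : Fin (N + 1) → ℝ, StrictMono t' ∧
      t' ∘ (extraVertex 0 (show 0 + 2 ≤ N by omega)).succAbove = t := by
  set p := extraVertex 0 (show 0 + 2 ≤ N by omega)
  have h12 : t ⟨1, by omega⟩ < t ⟨2, by omega⟩ := ht (by simp)
  refine ⟨Fin.insertNth p ((t ⟨1, by omega⟩ + t ⟨2, by omega⟩) / 2) t, ?_, ?_⟩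
  · intro a b hab
    rcases Fin.eq_self_or_eq_succAbove p a with rfl | ⟨i, rfl⟩ <;>
      rcases Fin.eq_self_or_eq_succAbove p b with rfl | ⟨j, rfl⟩
    · exact absurd hab (lt_irrefl _)
    · rw [Fin.insertNth_apply_same, Fin.insertNth_apply_succAbove]
      have hs := succAbove_spec (show 0 + 2 ≤ N by omega) j
      have : t ⟨2, by omega⟩ ≤ t j := ht.monotone (by
        rw [Fin.lt_def] at hab
        simp only [p, extraVertex] at hab hs ⊢
        rw [Fin.le_def]
        simp only
        omega)
      linarith
    · rw [Fin.insertNth_apply_same, Fin.insertNth_apply_succAbove]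
      have hs := succAbove_spec (show 0 + 2 ≤ N by omega) i
      have : t i ≤ t ⟨1, by omega⟩ := ht.monotone (by
        rw [Fin.lt_def] at hab
        simp only [p, extraVertex] at hab hs ⊢
        rw [Fin.le_def]
        simp only
        omega)
      linarith
    · rw [Fin.insertNth_apply_succAbove, Fin.insertNth_apply_succAbove]
      exact ht ((Fin.strictMono_succAbove p).lt_iff_lt.1 hab)
  · ext i
    simp

lemma Tri.splits_four {N : ℕ} (hN : 5 ≤ N) {B : ℕ → ℕ → Prop} (h : Tri N B) : Splits 0 4 B :=
  Or.inl ⟨by omega, h.short_mem (by omega) (by omega) (by omega)⟩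

lemma ext_supp_lift {N : ℕ} {T : Set (Pair N)} {l : Pair N → ℝ}
    (hl : ∀ e, e ∉ T → l e = 0) (e : Pair (N + 1)) (he : e ∉ ofRel (N + 1) (lift 0 4 (rel T))) :
    ext 0 l e = 0 := by
  unfold ext
  split_ifs with h
  · rfl
  · by_contra hne
    refine he (Or.inr ⟨rel_of_coef_ne_zero hl hne, ?_⟩)
    have := pair_lt e
    unfold Admissible
    omega

theorem indepAll_of_succ {N : ℕ} (hN : 5 ≤ N) (h : IndepAll (N + 1)) : IndepAll N := by
  intro t ht T hT l hl h0
  obtain ⟨t', ht', rfl⟩ := exists_insert hN ht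
  have hB := (isTriangulation_iff T).1 hT
  have hL := (hB.lift (by omega) (hB.splits_four hN)).isTriangulation
  have hz : comb (row t') (ext 0 l) = comb (row t') 0 := by
    rw [comb_eq_of_res (v := 0) (by omega) t' (sym_ext l) (fun x => by
      simp [sym, coef]), res_ext, h0]
    have : res (v := 0) (show 0 + 2 ≤ N by omega) (0 : Pair (N + 1) → ℝ) = 0 := rfl
    rw [this]
    simp [comb]
  have := h t' ht' _ hL (ext 0 l) (ext_supp_lift hl) (by rw [hz]; simp [comb])
  rw [← res_ext (v := 0) (show 0 + 2 ≤ N by omega) l, this]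
  rfl

theorem signAt_of_indepAll {n : ℕ} (hn : 5 ≤ n) (hI : IndepAll n) {t : Fin n → ℝ}
    (ht : StrictMono t) {T : Set (Pair n)} (hT : IsTriangulation n 2 T) : SignAt t T := by
  induction n, hn using Nat.le_induction with
  | base =>
    intro e he hes
    rw [notMem_shortPairs_iff] at hes
    omega
  | succ N hN ih =>
    exact signAt_succ hN (indepAll_of_succ hN hI) hI
      (fun t ht T hT => ih (indepAll_of_succ hN hI) ht hT) ht hT

theorem flipSystem_strict {n : ℕ} (hn : 5 ≤ n) (hI : IndepAll n) {t : Fin n → ℝ}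
    (ht : StrictMono t) {S : Set (Pair n)} (hS : shortPairs n 2 ⊆ S) :
    FlipSystem (row t) S (facets n S) :=
  flipSystem_of_sign hn hS (fun _ hT => frame_of_indepAll hn hI ht hT.1)
    fun _ hT e he heS => signAt_of_indepAll hn hI ht hT.1 e he fun h => heS (hS h)

theorem flipSystem_path {N v : ℕ} (hN : 5 ≤ N) (hv : v + 3 ≤ N) (hI : IndepAll (N + 1))
    {t : Fin (N + 1) → ℝ} (ht : StrictMono t) {S : Set (Pair (N + 1))}
    (hS : shortPairs (N + 1) 2 ⊆ S) (hear : rel S v (v + 3)) (s : unitInterval) :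
    FlipSystem (row (path v (by omega) t s)) S (facets (N + 1) S) := by
  have hI' := indepAll_of_succ hN hI
  have hsub : ∀ T ∈ facets (N + 1) S, rel T v (v + 3) := by
    intro T hT
    obtain ⟨f, hf, h⟩ := hear
    exact ⟨f, hT.2 hf, h⟩
  refine flipSystem_of_sign (by omega) hS
    (fun T hT => frame_path hN hv ht hI' hI hT.1 (hsub T hT) s) ?_
  intro T hT e he heS e' he' hT' l hl h0 hne
  have hes : e ∉ shortPairs (N + 1) 2 := fun h => heS (hS h)
  have ht' : StrictMono (t ∘ (extraVertex v (show v + 2 ≤ N by omega)).succAbove) :=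
    ht.comp (Fin.strictMono_succAbove _)
  by_cases hs : (s : ℝ) = 0
  · rw [hs, path_zero] at h0
    refine sign_merge hN hv ht' (hI' _ ht') (fun T hT => signAt_of_indepAll hN hI' ht' hT) hT.1
      (hsub T hT) he hes (fun h => ?_) he' hT' hl h0 hne
    obtain ⟨f, hf, h1, h2⟩ := hear
    exact heS (pair_ext (e := e) (f := f) (by omega) (by omega) ▸ hf)
  · exact signAt_of_indepAll (by omega) hI
      (path_strictMono _ ht (lt_of_le_of_ne s.2.1 (Ne.symm hs)) s.2.2) hT.1 e he hes e' he' hT' l hl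
      h0 hne

end TwoTri

namespace TwoTri

open FlipFan

lemma facets_insert {n : ℕ} (S : Set (Pair n)) (s : Pair n) :
    {T ∈ facets n S | insert s S ⊆ T} = facets n (insert s S) := by
  ext T
  exact ⟨fun h => ⟨h.1.1, h.2⟩, fun h => ⟨⟨h.1, fun f hf => h.2 (Or.inr hf)⟩, h.2⟩⟩

/-- The ear `(0, 3)`. -/
def firstEar (N : ℕ) (hN : 5 ≤ N) : Pair (N + 1) := mkPair 0 3 (by omega) (by omega)

/-- The ear `(1, 4)`. -/
def secondEar (N : ℕ) (hN : 5 ≤ N) : Pair (N + 1) := mkPair 1 4 (by omega) (by omega)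

lemma firstEar_notMem {N : ℕ} (hN : 5 ≤ N) : firstEar N hN ∉ shortPairs (N + 1) 2 := by
  rw [notMem_shortPairs_iff]
  simp only [firstEar, mkPair]
  omega

lemma secondEar_notMem {N : ℕ} (hN : 5 ≤ N) :
    secondEar N hN ∉ insert (firstEar N hN) (shortPairs (N + 1) 2) := by
  rintro (h | h)
  · have := congrArg (fun e : Pair (N + 1) => (e.val.1 : ℕ)) h
    simp [secondEar, firstEar, mkPair] at this
  · refine (notMem_shortPairs_iff _).2 ?_ h
    simp only [secondEar, mkPair]
    omega

/-- If the ears `(0, 3)` and `(1, 4)` are present then the vertex `2` is only on short pairs. -/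
lemma Tri.nbr_two {n : ℕ} {A : ℕ → ℕ → Prop} (h : Tri n A) (h1 : A 0 3) (h2 : A 1 4) {o : ℕ}
    (ho : Adj A 2 o) : o = 0 ∨ o = 1 ∨ o = 3 ∨ o = 4 := by
  rcases ho with ho | ho <;> have b := h.bound ho
  · by_contra hcon
    exact h.free h1 h2 ho (by omega) (by omega) (by omega) (by omega) (by omega)
  · omega

/-- A vertex of degree four in general position carries no dependency. -/
lemma sym_eq_zero_of_four {n : ℕ} {t : Fin n → ℝ} {l : Pair n → ℝ} (p : Fin n) (x : Fin 4 → Fin n)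
    (hx : Function.Injective (t ∘ x)) (hp : ∀ i, x i ≠ p)
    (hl : ∀ o : Fin n, (∀ i, x i ≠ o) → sym l p o = 0)
    (h0 : ∀ k, comb (row t) l (p, k) = 0) (o : ℕ) : sym l p o = 0 := by
  classical
  have hinj : Function.Injective x := fun i j h => hx (congrArg t h)
  have hsym : ∀ o : Fin n, sym l p o = 0 → coef l p o - coef l o p = 0 := by
    intro o ho
    rcases lt_trichotomy (p : ℕ) o with h | h | h
    · rw [sym_of_lt l h] at ho
      rw [ho, coef_eq_zero l h.le, sub_zero]
    · rw [h, sub_self]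
    · rw [sym_of_gt l h] at ho
      rw [ho, coef_eq_zero l h.le, sub_zero]
  have hsum : ∀ k : Fin 4, ∑ i, (coef l p (x i) - coef l (x i) p) * (t ∘ x) i ^ (k : ℕ) = 0 := by
    intro k
    have h1 := h0 k
    rw [comb_row_apply] at h1
    simp only [Function.comp]
    rw [← h1, ← Finset.sum_image (s := Finset.univ) (g := x)
      (f := fun o : Fin n => (coef l p o - coef l o p) * t o ^ (k : ℕ)) (fun i _ j _ h => hinj h)]
    refine Finset.sum_subset (Finset.subset_univ _) fun o _ ho => ?_
    rw [hsym o (hl o fun i hi => ho (Finset.mem_image.2 ⟨i, Finset.mem_univ _, hi⟩)), zero_mul]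
  have hdet : (Matrix.vandermonde (t ∘ x)).det ≠ 0 := Matrix.det_vandermonde_ne_zero_iff.2 hx
  have hz : (fun i => coef l p (x i) - coef l (x i) p) = 0 := by
    refine Matrix.eq_zero_of_vecMul_eq_zero hdet ?_
    ext k
    refine Eq.trans ?_ (hsum k)
    simp [Matrix.vecMul, dotProduct, Matrix.vandermonde_apply]
  by_cases ho : o < n
  · by_cases hxo : ∃ i, x i = ⟨o, ho⟩
    · obtain ⟨i, hi⟩ := hxo
      have h1 := congrFun hz i
      have h2 := hp i
      simp only [hi, Pi.zero_apply] at h1 h2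
      rcases lt_trichotomy (p : ℕ) o with h | h | h
      · rw [coef_eq_zero l h.le, sub_zero] at h1
        rw [sym_of_lt l h, h1]
      · exact absurd (Fin.ext h.symm) h2
      · rw [coef_eq_zero l h.le, zero_sub, neg_eq_zero] at h1
        rw [sym_of_gt l h, h1]
    · push Not at hxo
      exact hl ⟨o, ho⟩ hxo
  · have := p.2
    rw [sym_of_lt l (by omega), coef, dif_neg (by omega)]

/-- Passing to the polygon without the vertex `2`. -/
lemma hasSimplePoint_delete {N : ℕ} (hN : 5 ≤ N) {t : Fin N → ℝ} (ht : StrictMono t)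
    (hD : HasSimplePoint (row t) (shortPairs N 2) (facets N (shortPairs N 2))) :
    HasSimplePoint (row (t ∘ mergeFin 0 (show 0 + 2 ≤ N by omega)))
      (insert (secondEar N hN) (insert (firstEar N hN) (shortPairs (N + 1) 2)))
      (facets (N + 1) (insert (secondEar N hN)
        (insert (firstEar N hN) (shortPairs (N + 1) 2)))) := by
  have h2N : 0 + 2 ≤ N := by omega
  obtain ⟨T₀, hT₀, y, hy, hypos, huniq⟩ := hD
  set s : Fin (N + 1) → ℝ := t ∘ mergeFin 0 h2N with hs
  have hst : s ∘ (extraVertex 0 h2N).succAbove = t := by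
    ext i
    simp [hs, mergeFin_succAbove]
  have hB := (isTriangulation_iff T₀).1 hT₀.1
  have hL := (hB.lift (show 0 + 3 ≤ N by omega) (hB.splits_four hN)).isTriangulation
  have hears : ∀ e ∈ (insert (secondEar N hN)
      (insert (firstEar N hN) (shortPairs (N + 1) 2)) : Set (Pair (N + 1))),
      e ∈ ofRel (N + 1) (lift 0 4 (rel T₀)) := by
    rintro e (rfl | rfl | he)
    · have h : lift 0 4 (rel T₀) 1 4 := Or.inr ⟨hB.short_mem (i := 1) (j := 3) (by omega)
        (by omega) (by omega), by unfold Admissible; omega⟩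
      exact h
    · have h : lift 0 4 (rel T₀) 0 3 := Or.inr ⟨hB.short_mem (i := 0) (j := 2) (by omega)
        (by omega) (by omega), by unfold Admissible; omega⟩
      exact h
    · exact short_subset hL he
  refine ⟨ofRel (N + 1) (lift 0 4 (rel T₀)), ⟨hL, hears⟩, ext 0 y, ext_supp_lift hy, ?_, ?_⟩
  · intro e he hes
    have hes1 : ¬ ((e.val.1 : ℕ) = 0 ∧ (e.val.2 : ℕ) = 3) := fun h =>
      hes (Or.inr (Or.inl (pair_ext h.1 h.2)))
    have hes2 : ¬ ((e.val.1 : ℕ) = 1 ∧ (e.val.2 : ℕ) = 4) := fun h =>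
      hes (Or.inl (pair_ext h.1 h.2))
    have hes3 := (notMem_shortPairs_iff e).1 fun h => hes (Or.inr (Or.inr h))
    have hlt := pair_lt e
    have hb := e.val.2.2
    rcases he with he | ⟨he, hadm⟩
    · omega
    have hne : ¬ ((e.val.1 : ℕ) = 0 + 2 ∨ (e.val.2 : ℕ) = 0 + 2) := by
      unfold Admissible at hadm
      omega
    have m1 := merge_spec 0 e.val.1
    have m2 := merge_spec 0 e.val.2
    rw [ext, if_neg hne, coef, dif_pos (rel_bound he)]
    refine hypos _ ((rel_mkPair _ _).1 he) ?_
    rw [notMem_shortPairs_iff]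
    simp only [mkPair]
    omega
  · intro T hT z hz hz0 hc
    have hA := (isTriangulation_iff T).1 hT.1
    have hear1 : rel T 0 (0 + 3) := (rel_iff (firstEar N hN)).2 (hT.2 (Or.inr (Or.inl rfl)))
    have hear2 : rel T 1 4 := (rel_iff (secondEar N hN)).2 (hT.2 (Or.inl rfl))
    have hsz : ∀ x, sym z 2 x = 0 := by
      refine sym_eq_zero_of_four (t := s) (extraVertex 0 h2N)
        ![⟨0, by omega⟩, ⟨1, by omega⟩, ⟨3, by omega⟩, ⟨4, by omega⟩] ?_ ?_ ?_ ?_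
      · have : s ∘ ![⟨0, by omega⟩, ⟨1, by omega⟩, ⟨3, by omega⟩, ⟨4, by omega⟩] =
            t ∘ ![⟨0, by omega⟩, ⟨1, by omega⟩, ⟨2, by omega⟩, ⟨3, by omega⟩] := by
          ext i
          fin_cases i <;> rfl
        rw [this]
        refine ht.injective.comp ?_
        intro i j hij
        fin_cases i <;> fin_cases j <;> simp at hij ⊢
      · intro i
        fin_cases i <;> simp [extraVertex]
      · intro o ho
        by_contra hne
        have h0 := ho 0
        have h1 := ho 1
        have h2 := ho 2
        have h3 := ho 3
        simp [Fin.ext_iff] at h0 h1 h2 h3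
        have := hA.nbr_two hear1 hear2 (adj_of_sym_ne_zero hz hne)
        omega
      · intro k
        rw [hc]
        exact comb_extraVertex h2N s (sym_ext y) k
    have hcz : comb (row t) (res h2N z) = comb (row t) y := by
      have := (comb_eq_of_res h2N s hsz (sym_ext (v := 0) y)).1 hc
      rwa [hst, res_ext] at this
    have hT' := hA.contr hN hear1
    have hTT : ofRel N (contr 0 (rel T)) = T₀ := by
      refine huniq _ ⟨hT'.isTriangulation, short_subset hT'.isTriangulation⟩ (res h2N z) ?_ ?_ hcz
      · intro f hf
        refine hz _ fun h => hf ?_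
        have := contr_of_mem (v := 0) ((rel_iff _).2 h) (by
          simp only [merge_succAbove]
          exact pair_lt f)
        simp only [merge_succAbove] at this
        exact this
      · intro f hf
        refine hz0 _ ?_
        rw [notMem_shortPairs_iff] at hf
        have q1 := succAbove_spec h2N f.val.1
        have q2 := succAbove_spec h2N f.val.2
        rintro (h | h | h)
        · have r1 := congrArg (fun e : Pair (N + 1) => (e.val.1 : ℕ)) h
          have r2 := congrArg (fun e : Pair (N + 1) => (e.val.2 : ℕ)) h
          simp only [secondEar, mkPair] at r1 r2
          omega
        · have r1 := congrArg (fun e : Pair (N + 1) => (e.val.1 : ℕ)) h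
          have r2 := congrArg (fun e : Pair (N + 1) => (e.val.2 : ℕ)) h
          simp only [firstEar, mkPair] at r1 r2
          omega
        · refine (notMem_shortPairs_iff _).2 ?_ h
          simp only
          omega
    refine (hT.1.2 _ hL.1 fun e he => ?_).symm
    have hlt := pair_lt e
    have hb := e.val.2.2
    by_cases he12 : (e.val.1 : ℕ) = 1 ∧ (e.val.2 : ℕ) = 2
    · exact Or.inl he12
    · have hm : merge 0 e.val.1 < merge 0 e.val.2 := merge_lt hlt (by omega)
      have hrel := (rel_iff e).2 he
      refine Or.inr ⟨?_, ?_⟩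
      · have := contr_of_mem (v := 0) hrel hm
        rw [← hTT, hT'.rel_ofRel]
        exact this
      · have k1 : (e.val.1 : ℕ) = 2 → (e.val.2 : ℕ) ≤ 4 := fun h => by
          have := hA.nbr_two hear1 hear2 (Or.inl (h ▸ hrel))
          omega
        unfold Admissible
        omega

/-- Removing the ear `(1, 4)`, at parameters with the vertices `1` and `2` merged. -/
lemma hasSimplePoint_secondEar {N : ℕ} (hN : 5 ≤ N) {t : Fin N → ℝ} (ht : StrictMono t)
    (hI : Indep N t)
    (hD : HasSimplePoint (row (t ∘ mergeFin 0 (show 0 + 2 ≤ N by omega)))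
      (insert (secondEar N hN) (insert (firstEar N hN) (shortPairs (N + 1) 2)))
      (facets (N + 1) (insert (secondEar N hN)
        (insert (firstEar N hN) (shortPairs (N + 1) 2))))) :
    HasSimplePoint (row (t ∘ mergeFin 0 (show 0 + 2 ≤ N by omega)))
      (insert (firstEar N hN) (shortPairs (N + 1) 2))
      (facets (N + 1) (insert (firstEar N hN) (shortPairs (N + 1) 2))) := by
  classical
  have hear : ∀ T ∈ facets (N + 1) (insert (firstEar N hN) (shortPairs (N + 1) 2)),
      rel T 0 (0 + 3) := fun T hT => (rel_iff (firstEar N hN)).2 (hT.2 (Or.inl rfl))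
  refine hasSimplePoint_of_link (secondEar_notMem hN)
    (fun T hT => frame_merge hN (by omega) ht hI hT.1 (hear T hT)) ?_
    (by rwa [facets_insert]) (fun T hT => hT.2)
  intro T hT hsT z hz hc
  have hA := (isTriangulation_iff T).1 hT.1
  have he := hear T hT
  set l : Pair (N + 1) → ℝ := Pi.single (secondEar N hN) 1 - z with hl
  have hlT : ∀ f, f ∉ insert (secondEar N hN) T → l f = 0 := by
    intro f hf
    have h1 : f ≠ secondEar N hN := fun h => hf (Or.inl h)
    simp [hl, h1, hz f fun h => hf (Or.inr h)]
  have h0 : comb (row (t ∘ mergeFin 0 (show 0 + 2 ≤ N by omega))) l = 0 := by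
    rw [hl, comb_sub, comb_single, hc, sub_self]
  have hp : push 0 l = 0 := by
    refine hI _ (hA.contr hN he).isTriangulation _ (fun f hf => ?_) (comb_push_eq_zero _ h0)
    by_contra hpn
    obtain ⟨g, hg, h1, h2⟩ := exists_of_push_ne_zero hpn
    by_cases hgT : g ∈ T
    · exact hf ⟨pair_lt f, g.val.1, g.val.2, (rel_iff g).2 hgT, h1, h2⟩
    · have hge : g = secondEar N hN := by
        by_contra h
        exact hg (hlT g (by rintro (h' | h') <;> contradiction))
      subst hge
      refine hf ⟨pair_lt f, 2, 4, hA.short_mem (by omega) (by omega) (by omega), ?_, h2⟩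
      rw [← h1]
      rfl
  obtain ⟨c, hcc⟩ := hA.exists_common (by omega) he
  have kc := hA.common_iff.1 hcc
  have h14 : ¬ rel T 1 4 := fun h => hsT ((rel_iff (secondEar N hN)).1 h)
  have hc4 : c ≠ 4 := by
    rintro rfl
    rcases kc.2.1 with h | h
    · exact h14 h
    · have := hA.bound h
      omega
  have hcT : rel T 2 c := by
    rcases kc.2.2 with h | h
    · exact h
    · have := hA.bound h
      omega
  have hcb := hA.bound hcT
  have hj : Joins (secondEar N hN) 1 4 := Or.inl ⟨rfl, rfl⟩
  obtain ⟨q, q', hq, hq', -, e2⟩ := exists_balance (v := 0) (by omega) ht hp h0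
    (c := c) (c' := 4) (by omega) (by omega) kc.1 (by omega) hc4 (fun o ho ho' hoc hoc' => by
      by_contra hne0
      have h2 := sym_add_eq_zero_of_push hp (o := o) (by omega) (by omega) ho (by omega)
      have hne' : sym l (0 + 2) o ≠ 0 := fun h => hne0 (by rwa [h, add_zero] at h2)
      have hadj : ∀ x, sym l x o ≠ 0 → x ≠ 4 → Adj (rel T) x o := by
        intro x h hx
        obtain ⟨f, hf, hfz⟩ := exists_joins (adj_of_sym_ne_zero hlT h)
        rcases hf with rfl | hf
        · unfold Joins at hfz hj
          omega
        · exact hfz.adj_iff.2 hf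
      exact hoc (hA.common_unique he (hA.common_iff.2
        ⟨ho', hadj _ hne0 (by omega), hadj _ hne' (by omega)⟩) hcc))
  have hj2 : Joins (mkPair 2 c hcb.1 hcb.2 : Pair (N + 1)) (0 + 2) c := Or.inl ⟨rfl, rfl⟩
  rw [hj.sym_eq l, hj2.sym_eq l] at e2
  have hne : (mkPair 2 c hcb.1 hcb.2 : Pair (N + 1)) ≠ secondEar N hN := by
    intro h
    have := congrArg (fun e : Pair (N + 1) => (e.val.1 : ℕ)) h
    simp [secondEar, mkPair] at this
  simp only [hl, Pi.sub_apply, Pi.single_eq_same, hz _ hsT, Pi.single_eq_of_ne hne] at e2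
  refine ⟨mkPair 2 c hcb.1 hcb.2, ?_, ?_⟩
  · rintro (h | h)
    · have := congrArg (fun e : Pair (N + 1) => (e.val.1 : ℕ)) h
      simp [firstEar, mkPair] at this
    · refine (notMem_shortPairs_iff _).2 ?_ h
      simp only [mkPair]
      omega
  · by_contra hcon
    have h3 := mul_nonneg (not_lt.1 hcon) hq.le
    nlinarith

end TwoTri

namespace TwoTri

open FlipFan

/-- Cubic polynomials in a projective parameter define a linear functional on the rows. -/
lemma exists_functional {n : ℕ} (y : Fin n → ℝ) (hy : ∀ i, 1 / 2 - y i ≠ 0) (a : Fin n → ℝ → ℝ)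
    (ha : ∀ i, ∃ c₀ c₁ c₂ c₃ : ℝ, ∀ z, a i z = c₀ + c₁ * z + c₂ * z ^ 2 + c₃ * z ^ 3) :
    ∃ u : Fin n × Fin 4 → ℝ, ∀ e : Pair n,
      ∑ p, u p * row (fun i => 1 / (1 / 2 - y i)) e p =
        (1 / (1 / 2 - y e.val.1)) ^ 3 * (1 / (1 / 2 - y e.val.2)) ^ 3 *
          (a e.val.1 (y e.val.2) - a e.val.2 (y e.val.1)) := by
  classical
  choose c₀ c₁ c₂ c₃ hc using ha
  let w : Fin n → Fin 4 → ℝ := fun i => ![-c₃ i, c₂ i + 3 / 2 * c₃ i, -c₁ i - c₂ i - 3 / 4 * c₃ i,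
    c₀ i + c₁ i / 2 + c₂ i / 4 + c₃ i / 8]
  have hw : ∀ i j, ∑ k : Fin 4, w i k * (1 / (1 / 2 - y j)) ^ (k : ℕ) =
      (1 / (1 / 2 - y j)) ^ 3 * a i (y j) := by
    intro i j
    have h := hy j
    rw [hc, Fin.sum_univ_four]
    set x := 1 / (1 / 2 - y j) with hx
    have hyx : y j = 1 / 2 - 1 / x := by
      rw [hx, one_div_one_div]
      ring
    have hx0 : x ≠ 0 := one_div_ne_zero h
    rw [hyx]
    simp only [w, Matrix.cons_val_zero, Matrix.cons_val_one, Matrix.cons_val, Fin.val_zero,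
      Fin.val_one, Fin.val_two, pow_zero, pow_one, mul_one]
    have h3 : ((3 : Fin 4) : ℕ) = 3 := rfl
    rw [h3]
    field_simp
    ring
  refine ⟨fun p => (1 / (1 / 2 - y p.1)) ^ 3 * w p.1 p.2, fun e => ?_⟩
  rw [Fintype.sum_prod_type]
  simp only [row, mul_sub, mul_ite, mul_zero, Finset.sum_sub_distrib]
  rw [Finset.sum_comm, Finset.sum_comm (s := (Finset.univ : Finset (Fin n)))]
  simp only [Finset.sum_ite_eq', Finset.mem_univ, if_true, mul_assoc, ← Finset.mul_sum, hw]
  ring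

/-- The projective parameters of a polygon with vertices `0, 1, 2, 3` far from the others. -/
noncomputable def specialPos (d : ℝ) (i : ℕ) : ℝ :=
  if i = 0 then 1 else if i = 1 then 5 / 4 else if i = 2 then -(5 / 4) else if i = 3 then -1
  else -(1 / 3) + 2 / 3 * (((i : ℝ) - 4) / d)

/-- A linear form used in `specialCubic`. -/
noncomputable def specialLin (g y : ℝ) : ℝ :=
  209 / 864 * ((35 / 4 + 11 * g) + (55 / 4 + 7 * g) * y)

/-- The cubic polynomials defining a functional positive on a single relevant pair. -/
noncomputable def specialCubic (g : ℝ) (i : ℕ) (y : ℝ) : ℝ :=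
  if i = 0 then (y - 1 / 3) * (y - g) * (y + 1 / 3)
  else if i = 1 then (1 / 3 - y) * (y + 5 / 4) * specialLin g (-y)
  else if i = 2 then (y + 1 / 3) * (y - 5 / 4) * specialLin g y
  else if i = 3 then (y + 1 / 3) * (y + g) * (y - 1 / 3)
  else 0

lemma specialCubic_coeff (g : ℝ) (i : ℕ) : ∃ c₀ c₁ c₂ c₃ : ℝ,
    ∀ z, specialCubic g i z = c₀ + c₁ * z + c₂ * z ^ 2 + c₃ * z ^ 3 := by
  unfold specialCubic specialLin
  split_ifs
  · exact ⟨1 / 9 * g, -(1 / 9), -g, 1, fun z => by ring⟩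
  · set p := 209 / 864 * (35 / 4 + 11 * g) with hp
    set q := 209 / 864 * (55 / 4 + 7 * g) with hq
    refine ⟨5 / 12 * p, -(11 / 12) * p - 5 / 12 * q, -p + 11 / 12 * q, q, fun z => ?_⟩
    rw [hp, hq]
    ring
  · set p := 209 / 864 * (35 / 4 + 11 * g) with hp
    set q := 209 / 864 * (55 / 4 + 7 * g) with hq
    refine ⟨-(5 / 12) * p, -(11 / 12) * p - 5 / 12 * q, p - 11 / 12 * q, q, fun z => ?_⟩
    rw [hp, hq]
    ring
  · exact ⟨-(1 / 9) * g, -(1 / 9), g, 1, fun z => by ring⟩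
  · exact ⟨0, 0, 0, 0, fun z => by ring⟩

lemma specialLin_nonneg {g y : ℝ} (h1 : -(1 / 3) ≤ g) (h2 : g ≤ 1 / 3) (hy : -g ≤ y) :
    0 ≤ specialLin g y := by
  unfold specialLin
  have : 0 ≤ (55 / 4 + 7 * g) * (y + g) := mul_nonneg (by linarith) (by linarith)
  nlinarith [mul_nonneg (sub_nonneg.2 h1) (sub_nonneg.2 h2)]

/-- Parameters for which some linear functional vanishes on the short pairs, is positive on the
ear `(0, 3)`, and nonpositive on all other relevant pairs. -/
lemma exists_special {N : ℕ} (hN : 5 ≤ N) : ∃ t : Fin (N + 1) → ℝ, StrictMono t ∧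
    ∃ u : Fin (N + 1) × Fin 4 → ℝ,
      (∀ e ∈ shortPairs (N + 1) 2, ∑ p, u p * row t e p = 0) ∧
      0 < ∑ p, u p * row t (firstEar N hN) p ∧
      ∀ e, e ∉ shortPairs (N + 1) 2 → e ≠ firstEar N hN → ∑ p, u p * row t e p ≤ 0 := by
  obtain ⟨d, hd⟩ : ∃ d : ℝ, d = (N : ℝ) - 4 := ⟨_, rfl⟩
  have hN5 : (5 : ℝ) ≤ N := by exact_mod_cast hN
  have hd1 : 1 ≤ d := by linarith
  have hd0 : 0 < d := by linarith
  obtain ⟨g, hg⟩ : ∃ g : ℝ, g = 1 / 3 - 2 / 3 * (1 / d) := ⟨_, rfl⟩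
  have hinv : 0 < 1 / d := one_div_pos.2 hd0
  have hinv1 : 1 / d ≤ 1 := (div_le_one hd0).2 hd1
  have g1 : -(1 / 3) ≤ g := by linarith
  have g2 : g < 1 / 3 := by linarith
  set y : ℕ → ℝ := specialPos d with hy
  have y0 : y 0 = 1 := by simp [hy, specialPos]
  have y1 : y 1 = 5 / 4 := by simp [hy, specialPos]
  have y2 : y 2 = -(5 / 4) := by simp [hy, specialPos]
  have y3 : y 3 = -1 := by simp [hy, specialPos]
  have yo : ∀ i, 4 ≤ i → y i = -(1 / 3) + 2 / 3 * (((i : ℝ) - 4) / d) := by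
    intro i hi
    simp only [hy, specialPos]
    rw [if_neg (by omega), if_neg (by omega), if_neg (by omega), if_neg (by omega)]
  have ymono : ∀ i j, 4 ≤ i → i < j → y i < y j := by
    intro i j hi hij
    rw [yo i hi, yo j (by omega)]
    have : (i : ℝ) < j := by exact_mod_cast hij
    have := div_lt_div_of_pos_right (show (i : ℝ) - 4 < j - 4 by linarith) hd0
    linarith
  have ymono' : ∀ i j, 4 ≤ i → i ≤ j → y i ≤ y j := fun i j hi hij => by
    rcases hij.eq_or_lt with rfl | h
    · exact le_rfl
    · exact (ymono i j hi h).le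
  have y4 : y 4 = -(1 / 3) := by rw [yo 4 le_rfl]; norm_num
  have y5 : y 5 = -g := by rw [yo 5 (by omega), hg]; norm_num; ring
  have yN : y N = 1 / 3 := by
    rw [yo N (by omega), ← hd, div_self hd0.ne']
    norm_num
  have yN1 : y (N - 1) = g := by
    rw [yo (N - 1) (by omega), hg, Nat.cast_sub (by omega)]
    have : ((N : ℝ) - (1 : ℕ) - 4) / d = 1 - 1 / d := by
      rw [hd]
      rw [hd] at hd0
      field_simp
      push_cast
      ring
    rw [this]
    ring
  have yle : ∀ i, 4 ≤ i → i ≤ N → -(1 / 3) ≤ y i ∧ y i ≤ 1 / 3 := fun i h1 h2 =>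
    ⟨by rw [← y4]; exact ymono' _ _ le_rfl h1, by rw [← yN]; exact ymono' _ _ h1 h2⟩
  have ylt : ∀ i, 2 ≤ i → i ≤ N → y i < 1 / 2 := by
    intro i h1 h2
    by_cases h3 : 4 ≤ i
    · have := (yle i h3 h2).2
      linarith
    · interval_cases i
      · rw [y2]; norm_num
      · rw [y3]; norm_num
  have ygt : ∀ i, i ≤ 1 → 1 / 2 < y i := by
    intro i h
    interval_cases i
    · rw [y0]; norm_num
    · rw [y1]; norm_num
  have hne : ∀ i : Fin (N + 1), 1 / 2 - y i ≠ 0 := by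
    intro i
    by_cases h : (i : ℕ) ≤ 1
    · have := ygt i h
      linarith
    · have := ylt i (by omega) (by omega)
      linarith
  obtain ⟨u, hu⟩ := exists_functional (fun i : Fin (N + 1) => y i) hne
    (fun i => specialCubic g i) (fun i => specialCubic_coeff g i)
  have c4 : ∀ i z, 4 ≤ i → specialCubic g i z = 0 := by
    intro i z hi
    unfold specialCubic
    rw [if_neg (by omega), if_neg (by omega), if_neg (by omega), if_neg (by omega)]
  have c0 : ∀ z, specialCubic g 0 z = (z - 1 / 3) * (z - g) * (z + 1 / 3) := fun z => rfl
  have c1 : ∀ z, specialCubic g 1 z = (1 / 3 - z) * (z + 5 / 4) * specialLin g (-z) := fun z => rfl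
  have c2 : ∀ z, specialCubic g 2 z = (z + 1 / 3) * (z - 5 / 4) * specialLin g z := fun z => rfl
  have c3 : ∀ z, specialCubic g 3 z = (z + 1 / 3) * (z + g) * (z - 1 / 3) := fun z => rfl
  have tneg : ∀ i, i ≤ 1 → (1 / (1 / 2 - y i)) ^ 3 < 0 := fun i h =>
    Odd.pow_neg (by decide) (one_div_neg.2 (by linarith [ygt i h]))
  have tpos : ∀ i, 2 ≤ i → i ≤ N → 0 < (1 / (1 / 2 - y i)) ^ 3 := fun i h h' =>
    pow_pos (one_div_pos.2 (by linarith [ylt i h h'])) 3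
  refine ⟨fun i => 1 / (1 / 2 - y i), ?_, u, ?_, ?_, ?_⟩
  · intro i j hij
    rw [Fin.lt_def] at hij
    have hj : (j : ℕ) ≤ N := by omega
    by_cases hi : (i : ℕ) ≤ 1
    · by_cases hj1 : (j : ℕ) ≤ 1
      · have hi0 : (i : ℕ) = 0 := by omega
        have hj1 : (j : ℕ) = 1 := by omega
        simp only [hi0, hj1, y0, y1]
        norm_num
      · exact (one_div_neg.2 (by linarith [ygt i hi])).trans
          (one_div_pos.2 (by linarith [ylt j (by omega) hj]))
    · have hlt : y i < y j := by
        by_cases h4 : 4 ≤ (i : ℕ)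
        · exact ymono _ _ h4 hij
        · by_cases hi2 : (i : ℕ) = 2
          · by_cases hj3 : (j : ℕ) = 3
            · rw [hi2, hj3, y2, y3]; norm_num
            · have := (yle j (by omega) hj).1
              rw [hi2, y2]; linarith
          · have hi3 : (i : ℕ) = 3 := by omega
            have := (yle j (by omega) hj).1
            rw [hi3, y3]; linarith
      exact one_div_lt_one_div_of_lt (by linarith [ylt j (by omega) hj]) (by linarith)
  · intro e he
    rw [hu]
    refine mul_eq_zero_of_right _ ?_
    have hns : ¬ ((e.val.1 : ℕ) + 3 ≤ e.val.2 ∧ (e.val.2 : ℕ) + 3 ≤ e.val.1 + (N + 1)) :=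
      fun h => (notMem_shortPairs_iff e).2 h he
    have hlt := pair_lt e
    have hb := e.val.2.2
    generalize (e.val.1 : ℕ) = i at *
    generalize (e.val.2 : ℕ) = j at *
    by_cases hi : 4 ≤ i
    · rw [c4 i _ hi, c4 j _ (by omega), sub_zero]
    by_cases hj : 4 ≤ j
    · rw [c4 j _ hj, sub_zero]
      by_cases i0 : i = 0
      · subst i0
        rw [c0]
        by_cases hjN : j = N
        · rw [hjN, yN]; ring
        · have : j = N - 1 := by omega
          rw [this, yN1]; ring
      by_cases i1 : i = 1
      · subst i1
        have : j = N := by omega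
        rw [c1, this, yN]; ring
      by_cases i2 : i = 2
      · subst i2
        have : j = 4 := by omega
        rw [c2, this, y4]; ring
      · have i3 : i = 3 := by omega
        subst i3
        rw [c3]
        by_cases hj4 : j = 4
        · rw [hj4, y4]; ring
        · have : j = 5 := by omega
          rw [this, y5]; ring
    · have hij : (i = 0 ∧ j = 1) ∨ (i = 0 ∧ j = 2) ∨ (i = 1 ∧ j = 2) ∨ (i = 1 ∧ j = 3) ∨
          (i = 2 ∧ j = 3) := by omega
      rcases hij with ⟨rfl, rfl⟩ | ⟨rfl, rfl⟩ | ⟨rfl, rfl⟩ | ⟨rfl, rfl⟩ | ⟨rfl, rfl⟩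
      · rw [c0, c1, y0, y1, specialLin]; ring
      · rw [c0, c2, y0, y2, specialLin]; ring
      · rw [c1, c2, y1, y2]; ring
      · rw [c1, c3, y1, y3, specialLin]; ring
      · rw [c2, c3, y2, y3, specialLin]; ring
  · rw [hu]
    have h1 : ((firstEar N hN).val.1 : ℕ) = 0 := rfl
    have h2 : ((firstEar N hN).val.2 : ℕ) = 3 := rfl
    simp only [h1, h2]
    refine mul_pos_of_neg_of_neg (mul_neg_of_neg_of_pos (tneg 0 (by omega))
      (tpos 3 (by omega) (by omega))) ?_
    rw [c0, c3, y0, y3]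
    linarith
  · intro e hes he
    rw [hu]
    have hne : ¬ ((e.val.1 : ℕ) = 0 ∧ (e.val.2 : ℕ) = 3) := fun h => he (pair_ext h.1 h.2)
    have hb := e.val.2.2
    rw [notMem_shortPairs_iff] at hes
    clear he
    generalize (e.val.1 : ℕ) = i at *
    generalize (e.val.2 : ℕ) = j at *
    by_cases hi : 4 ≤ i
    · rw [c4 i _ hi, c4 j _ (by omega), sub_zero, mul_zero]
    have hj : 4 ≤ j := by omega
    have hy := yle j hj (by omega)
    have tj := tpos j (by omega) (by omega)
    rw [c4 j _ hj, sub_zero]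
    by_cases i0 : i = 0
    · subst i0
      refine mul_nonpos_of_nonpos_of_nonneg (mul_neg_of_neg_of_pos (tneg 0 (by omega)) tj).le ?_
      rw [c0]
      have := ymono' j (N - 1) hj (by omega)
      exact mul_nonneg (mul_nonneg_of_nonpos_of_nonpos (by linarith) (by linarith)) (by linarith)
    by_cases i1 : i = 1
    · subst i1
      refine mul_nonpos_of_nonpos_of_nonneg (mul_neg_of_neg_of_pos (tneg 1 (by omega)) tj).le ?_
      rw [c1]
      have := ymono' j (N - 1) hj (by omega)
      exact mul_nonneg (mul_nonneg (by linarith) (by linarith))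
        (specialLin_nonneg g1 g2.le (by linarith))
    have := ymono' 5 j (by omega) (by omega)
    by_cases i2 : i = 2
    · subst i2
      refine mul_nonpos_of_nonneg_of_nonpos (mul_pos (tpos 2 (by omega) (by omega)) tj).le ?_
      rw [c2]
      exact mul_nonpos_of_nonpos_of_nonneg
        (mul_nonpos_of_nonneg_of_nonpos (by linarith) (by linarith))
        (specialLin_nonneg g1 g2.le (by linarith))
    · have i3 : i = 3 := by omega
      subst i3
      refine mul_nonpos_of_nonneg_of_nonpos (mul_pos (tpos 3 (by omega) (by omega)) tj).le ?_
      rw [c3]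
      exact mul_nonpos_of_nonneg_of_nonpos (mul_nonneg (by linarith) (by linarith)) (by linarith)

/-- Removing the ear `(0, 3)`, at special parameters. -/
lemma hasSimplePoint_firstEar {N : ℕ} (hN : 5 ≤ N) (hI : IndepAll (N + 1))
    {t : Fin (N + 1) → ℝ} (ht : StrictMono t) {u : Fin (N + 1) × Fin 4 → ℝ}
    (hu0 : ∀ e ∈ shortPairs (N + 1) 2, ∑ p, u p * row t e p = 0)
    (hu1 : 0 < ∑ p, u p * row t (firstEar N hN) p)
    (hu2 : ∀ e, e ∉ shortPairs (N + 1) 2 → e ≠ firstEar N hN → ∑ p, u p * row t e p ≤ 0)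
    (hD : HasSimplePoint (row t) (insert (firstEar N hN) (shortPairs (N + 1) 2))
      (facets (N + 1) (insert (firstEar N hN) (shortPairs (N + 1) 2)))) :
    HasSimplePoint (row t) (shortPairs (N + 1) 2) (facets (N + 1) (shortPairs (N + 1) 2)) := by
  refine hasSimplePoint_of_link (firstEar_notMem hN)
    (fun T hT => frame_of_indepAll (by omega) hI ht hT.1) ?_ (by rwa [facets_insert])
    (fun T hT => hT.2)
  intro T hT hsT z hz hc
  by_contra hcon
  push Not at hcon
  have h1 : ∑ p, u p * row t (firstEar N hN) p = ∑ e, z e * ∑ p, u p * row t e p := by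
    rw [← hc]
    simp only [comb, Finset.sum_apply, Pi.smul_apply, smul_eq_mul, Finset.mul_sum]
    rw [Finset.sum_comm]
    exact Finset.sum_congr rfl fun e _ => Finset.sum_congr rfl fun p _ => by ring
  have h2 : ∑ e, z e * ∑ p, u p * row t e p ≤ 0 := by
    refine Finset.sum_nonpos fun e _ => ?_
    by_cases hes : e ∈ shortPairs (N + 1) 2
    · rw [hu0 e hes, mul_zero]
    by_cases hee : e = firstEar N hN
    · rw [hee, hz _ hsT, zero_mul]
    exact mul_nonpos_of_nonneg_of_nonpos (hcon e hes) (hu2 e hes hee)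
  linarith

lemma isTriangulation_five : IsTriangulation 5 2 Set.univ := by
  refine ⟨(crossingFree_iff _).2 ?_, fun S _ h => Set.univ_subset_iff.1 h⟩
  intro a b c a' b' c' _ _ h3 l1 l2 l3 l4 l5
  have := rel_bound h3
  omega

/-- The property of having a simple point does not depend on the increasing parameters. -/
lemma hasSimplePoint_strict {n : ℕ} (hn : 5 ≤ n) (hI : IndepAll n) {t t' : Fin n → ℝ}
    (ht : StrictMono t) (ht' : StrictMono t')
    (hD : HasSimplePoint (row t) (shortPairs n 2) (facets n (shortPairs n 2))) :
    HasSimplePoint (row t') (shortPairs n 2) (facets n (shortPairs n 2)) := by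
  let q : unitInterval → Fin n → ℝ := fun s i => (1 - (s : ℝ)) * t i + s * t' i
  have hq : ∀ s, StrictMono (q s) := by
    intro s i j hij
    have h1 := ht hij
    have h2 := ht' hij
    have s0 := s.2.1
    have s1 := s.2.2
    simp only [q]
    rcases s0.eq_or_lt with h | h
    · rw [← h]
      linarith
    · exact add_lt_add_of_le_of_lt (mul_le_mul_of_nonneg_left h1.le (by linarith))
        (mul_lt_mul_of_pos_left h2 h)
  have q0 : q 0 = t := by ext i; simp [q]
  have q1 : q 1 = t' := by ext i; simp [q]
  have := hasSimplePoint_of_continuous (w := fun s => row (q s))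
    (fun e => continuous_row (fun i => by simp only [q]; fun_prop) e)
    (fun s => flipSystem_strict hn hI (hq s) subset_rfl) (x₀ := 0) (by rwa [q0]) 1
  rwa [q1] at this

theorem hasSimplePoint_row {n : ℕ} (hn : 5 ≤ n) (hI : IndepAll n) {t : Fin n → ℝ}
    (ht : StrictMono t) :
    HasSimplePoint (row t) (shortPairs n 2) (facets n (shortPairs n 2)) := by
  induction n, hn using Nat.le_induction with
  | base =>
    have hs : ∀ e : Pair 5, e ∈ shortPairs 5 2 := by
      intro e
      by_contra h
      rw [notMem_shortPairs_iff] at h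
      omega
    refine ⟨Set.univ, ⟨isTriangulation_five, Set.subset_univ _⟩, 0, fun e _ => rfl,
      fun e _ he => absurd (hs e) he, fun T hT _ _ _ _ => ?_⟩
    exact Set.eq_univ_of_forall fun e => hT.2 (hs e)
  | succ N hN ih =>
    have hI' := indepAll_of_succ hN hI
    obtain ⟨t₀, ht₀, u, hu0, hu1, hu2⟩ := exists_special hN
    refine hasSimplePoint_strict (by omega) hI ht₀ ht ?_
    have ht₁ : StrictMono (t₀ ∘ (extraVertex 0 (show 0 + 2 ≤ N by omega)).succAbove) :=
      ht₀.comp (Fin.strictMono_succAbove _)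
    have hD := hasSimplePoint_secondEar hN ht₁ (hI' _ ht₁)
      (hasSimplePoint_delete hN ht₁ (ih hI' ht₁))
    have hpath := hasSimplePoint_of_continuous
      (w := fun s : unitInterval => row (path 0 (show 0 + 2 ≤ N by omega) t₀ s))
      (continuous_row_path (by omega) t₀)
      (fun s => flipSystem_path (v := 0) hN (by omega) hI ht₀ (Set.subset_insert _ _)
        ((rel_iff (firstEar N hN)).2 (Or.inl rfl)) s) (x₀ := 0) (by
          have e0 : ((0 : unitInterval) : ℝ) = 0 := rfl
          rw [e0, path_zero]
          exact hD) 1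
    have e1 : ((1 : unitInterval) : ℝ) = 1 := rfl
    rw [e1, path_one] at hpath
    exact hasSimplePoint_firstEar hN hI ht₀ hu0 hu1 hu2 hpath

end TwoTri

namespace FlipFan

variable {E V : Type*} [Fintype E] [AddCommGroup V] [Module ℝ V]

lemma linearIndependent_iff_comb (w : E → V) (T : Set E) :
    LinearIndependent ℝ (fun e : T => w e.val) ↔
      ∀ z : E → ℝ, (∀ e, e ∉ T → z e = 0) → comb w z = 0 → z = 0 := by
  classical
  have hsum : ∀ z : E → ℝ, (∀ e, e ∉ T → z e = 0) → ∑ e : T, z e • w e = comb w z := by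
    intro z hz
    rw [Finset.sum_set_coe (f := fun e => z e • w e)]
    refine Finset.sum_subset (Finset.subset_univ _) fun e _ he => ?_
    rw [hz e (by simpa using he), zero_smul]
  rw [Fintype.linearIndependent_iff]
  constructor
  · intro h z hz h0
    ext e
    by_cases he : e ∈ T
    · exact h (fun e => z e) (by rw [hsum z hz, h0]) ⟨e, he⟩
    · exact hz e he
  · intro h g hg e
    have := h (fun e => if he : e ∈ T then g ⟨e, he⟩ else 0) (fun e he => dif_neg he) (by
      rw [← hsum _ (fun e he => dif_neg he), ← hg]
      exact Finset.sum_congr rfl fun e _ => by rw [dif_pos e.2])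
    have h2 := congrFun this e
    simpa using h2

lemma mem_span_image_iff_comb (w : E → V) (S : Set E) (x : V) :
    x ∈ Submodule.span ℝ (w '' S) ↔ ∃ z : E → ℝ, (∀ e, e ∉ S → z e = 0) ∧ comb w z = x := by
  classical
  constructor
  · intro hx
    induction hx using Submodule.span_induction with
    | mem x hx =>
      obtain ⟨e, he, rfl⟩ := hx
      refine ⟨Pi.single e 1, fun f hf => ?_, comb_single w e⟩
      exact Pi.single_eq_of_ne (fun h => hf (by rwa [h])) 1
    | zero => exact ⟨0, fun _ _ => rfl, by simp [comb]⟩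
    | add x y _ _ hx hy =>
      obtain ⟨z, hz, rfl⟩ := hx
      obtain ⟨z', hz', rfl⟩ := hy
      exact ⟨z + z', fun e he => by simp [hz e he, hz' e he], comb_add w z z'⟩
    | smul a x _ hx =>
      obtain ⟨z, hz, rfl⟩ := hx
      exact ⟨a • z, fun e he => by simp [hz e he], comb_smul w a z⟩
  · rintro ⟨z, hz, rfl⟩
    refine Submodule.sum_mem _ fun e _ => ?_
    by_cases he : e ∈ S
    · exact Submodule.smul_mem _ _ (Submodule.subset_span ⟨e, he, rfl⟩)
    · rw [hz e he, zero_smul]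
      exact Submodule.zero_mem _

end FlipFan

namespace TwoTri

open FlipFan

lemma mem_relevantPairs_iff {n : ℕ} (e : Pair n) :
    e ∈ relevantPairs n 2 ↔ e ∉ shortPairs n 2 := by
  simp only [relevantPairs, shortPairs, Set.mem_ofPred_eq]
  omega

/-- The difference of the parameters at the ends of a pair. -/
def gap {n : ℕ} (t : Fin n → ℝ) (e : Pair n) : ℝ := t e.val.2 - t e.val.1

lemma gap_pos {n : ℕ} {t : Fin n → ℝ} (ht : StrictMono t) (e : Pair n) : 0 < gap t e :=
  sub_pos.2 (ht e.2)

lemma bjRow_eq {n : ℕ} (t : Fin n → ℝ) (e : Pair n) (i : Fin n) (k : Fin 4) :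
    bjRow (fun i => momentPoint 4 (t i)) e (i, k) =
      -∑ b : Fin 4, if b ≤ k then t i ^ ((k : ℕ) - b) * (gap t e * row t e (i, b)) else 0 := by
  have hne : e.val.2 ≠ e.val.1 := e.2.ne'
  unfold bjRow momentPoint row gap
  by_cases h1 : i = e.val.1
  · subst h1
    rw [Fin.sum_univ_four]
    fin_cases k <;> simp [hne.symm] <;> ring
  by_cases h2 : i = e.val.2
  · subst h2
    rw [Fin.sum_univ_four]
    fin_cases k <;> simp [hne] <;> ring
  · simp [h1, h2]

lemma comb_bjRow_apply {n : ℕ} (t : Fin n → ℝ) (c : Pair n → ℝ) (i : Fin n) (k : Fin 4) :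
    comb (bjRow fun i => momentPoint 4 (t i)) c (i, k) =
      -∑ b : Fin 4, if b ≤ k then t i ^ ((k : ℕ) - b) * comb (row t) (gap t * c) (i, b) else 0 := by
  simp only [comb, Finset.sum_apply, Pi.smul_apply, smul_eq_mul, bjRow_eq, Pi.mul_apply,
    mul_neg, Finset.sum_neg_distrib, Finset.mul_sum]
  rw [Finset.sum_comm]
  congr 1
  refine Finset.sum_congr rfl fun b _ => ?_
  split_ifs
  · exact Finset.sum_congr rfl fun e _ => by ring
  · simp

lemma comb_bjRow_eq_zero_iff {n : ℕ} (t : Fin n → ℝ) (c : Pair n → ℝ) :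
    comb (bjRow fun i => momentPoint 4 (t i)) c = 0 ↔ comb (row t) (gap t * c) = 0 := by
  constructor
  · intro h
    have h' : ∀ i k, (∑ b : Fin 4, if b ≤ k then
        t i ^ ((k : ℕ) - b) * comb (row t) (gap t * c) (i, b) else 0) = 0 := fun i k => by
      rw [← neg_eq_zero, ← comb_bjRow_apply, h]
      rfl
    ext ⟨i, k⟩
    have e0 := h' i 0
    have e1 := h' i 1
    have e2 := h' i 2
    have e3 := h' i 3
    rw [Fin.sum_univ_four] at e0 e1 e2 e3
    simp at e0
    simp [e0] at e1
    simp [e0, e1] at e2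
    simp [e0, e1, e2] at e3
    fin_cases k
    · exact e0
    · exact e1
    · exact e2
    · exact e3
  · intro h
    ext ⟨i, k⟩
    rw [comb_bjRow_apply, h]
    simp

lemma comb_contraction_eq_iff {n : ℕ} (t : Fin n → ℝ) (c c' : Pair n → ℝ) :
    comb (contraction n 2 (bjRow fun i => momentPoint 4 (t i))) c =
        comb (contraction n 2 (bjRow fun i => momentPoint 4 (t i))) c' ↔
      ∃ z : Pair n → ℝ, (∀ e, e ∉ shortPairs n 2 → z e = 0) ∧
        comb (row t) (gap t * (c - z)) = comb (row t) (gap t * c') := by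
  set v := bjRow fun i => momentPoint 4 (t i) with hv
  have hmk : ∀ c, comb (contraction n 2 v) c =
      Submodule.mkQ (Submodule.span ℝ (v '' shortPairs n 2)) (comb v c) := by
    intro c
    simp only [comb, map_sum, map_smul]
    rfl
  rw [hmk, hmk, Submodule.mkQ_apply, Submodule.mkQ_apply, Submodule.Quotient.eq,
    mem_span_image_iff_comb]
  refine exists_congr fun z => and_congr_right fun _ => ?_
  rw [← sub_eq_zero (a := comb (row t) _), ← comb_sub (row t), ← mul_sub, ← comb_bjRow_eq_zero_iff, ← hv,
    comb_sub, comb_sub]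
  constructor
  · intro h
    rw [h]
    abel
  · intro h
    rw [sub_right_comm, sub_eq_zero] at h
    exact h.symm

lemma indepAll_of_linearIndependent {n : ℕ}
    (H : ∀ t : Fin n → ℝ, StrictMono t → ∀ T : Set (Pair n), IsTriangulation n 2 T →
      LinearIndependent ℝ (fun e : T => bjRow (fun i => momentPoint 4 (t i)) e.val)) :
    IndepAll n := by
  intro t ht T hT z hz h0
  have hg : ∀ e, gap t e ≠ 0 := fun e => (gap_pos ht e).ne'
  have := (linearIndependent_iff_comb _ T).1 (H t ht T hT) (fun e => z e / gap t e)
    (fun e he => by rw [hz e he, zero_div]) (by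
      rw [comb_bjRow_eq_zero_iff]
      convert h0 using 2
      ext e
      simp only [Pi.mul_apply]
      rw [mul_div_cancel₀ _ (hg e)])
  ext e
  have h := congrFun this e
  simpa [hg e] using h

theorem realizesFan_bjRow {n : ℕ} (hn : 5 ≤ n)
    (H : ∀ t : Fin n → ℝ, StrictMono t → ∀ T : Set (Pair n), IsTriangulation n 2 T →
      LinearIndependent ℝ (fun e : T => bjRow (fun i => momentPoint 4 (t i)) e.val))
    {t : Fin n → ℝ} (ht : StrictMono t) :
    RealizesFan n 2 (bjRow (fun i => momentPoint 4 (t i))) := by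
  classical
  have hI := indepAll_of_linearIndependent H
  have G := flipSystem_strict hn hI ht (S := shortPairs n 2) subset_rfl
  have hD := hasSimplePoint_row hn hI ht
  have hN := G.noOverlap_of_hasSimplePoint hD
  have hfac : ∀ {T}, IsTriangulation n 2 T → T ∈ facets n (shortPairs n 2) :=
    fun hT => ⟨hT, short_subset hT⟩
  have hgp := gap_pos ht
  refine ⟨H t ht, ⟨?_, ?_, ?_⟩⟩
  · rintro _ ⟨T, hT, rfl⟩
    rw [linearIndependent_iff_comb]
    intro z hz h0
    obtain ⟨z', hz', hc⟩ := (comb_contraction_eq_iff t z 0).1 (by rw [h0]; simp [comb])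
    have h1 : gap t * (z - z') = 0 := hI t ht T hT _ (fun e he => by
      have h2 : e ∉ T ∩ relevantPairs n 2 := fun h => he h.1
      simp [hz e h2, hz' e fun h => he (short_subset hT h)]) (by
        rw [hc]
        simp [comb])
    ext e
    by_cases he : e ∈ T ∩ relevantPairs n 2
    · have h2 := congrFun h1 e
      simp only [Pi.mul_apply, Pi.sub_apply, Pi.zero_apply,
        hz' e ((mem_relevantPairs_iff e).1 he.2), sub_zero] at h2
      exact (mul_eq_zero.1 h2).resolve_left (hgp e).ne'
    · exact hz e he
  · rintro _ _ ⟨T, hT, rfl⟩ ⟨T', hT', rfl⟩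
    refine Set.Subset.antisymm ?_ ?_
    · rintro x ⟨⟨c, hc0, hcs, rfl⟩, ⟨c', hc0', hcs', hx⟩⟩
      refine ⟨c, hc0, fun e he => ⟨hcs e he, ?_, (hcs e he).2⟩, rfl⟩
      obtain ⟨z, hz, hcomb⟩ := (comb_contraction_eq_iff t c c').1 hx
      have hzT : ∀ e, e ∉ T → z e = 0 := fun e he => hz e fun h => he (short_subset hT h)
      have hze := hz e ((mem_relevantPairs_iff e).1 (hcs e he).2)
      refine G.mem_of_comb_eq hN (hfac hT) (hfac hT') (fun f hf => ?_) (fun f hf => ?_)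
        (fun f hf => ?_) (fun f hf => ?_) hcomb ?_
      · have : c f = 0 := by
          by_contra h
          exact hf (hcs f h).1
        simp [this, hzT f hf]
      · have : c' f = 0 := by
          by_contra h
          exact hf (hcs' f h).1
        simp [this]
      · simp only [Pi.mul_apply, Pi.sub_apply, hz f hf, sub_zero]
        exact mul_nonneg (hgp f).le (hc0 f)
      · exact mul_nonneg (hgp f).le (hc0' f)
      · simp only [Pi.mul_apply, Pi.sub_apply, hze, sub_zero]
        exact mul_ne_zero (hgp e).ne' he
    · rintro x ⟨c, hc0, hcs, rfl⟩
      exact ⟨⟨c, hc0, fun e he => (hcs e he).1, rfl⟩, ⟨c, hc0, fun e he => (hcs e he).2, rfl⟩⟩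
  · ext x
    simp only [Set.mem_iUnion, SetLike.mem_coe, mem_span_image_iff_comb]
    constructor
    · rintro ⟨_, ⟨T, hT, rfl⟩, c, hc0, hcs, rfl⟩
      refine ⟨c, fun e he => ?_, rfl⟩
      by_contra h
      exact he (hcs e h).2
    · rintro ⟨c, hcs, rfl⟩
      obtain ⟨T, hT, hpos⟩ := G.cover (hD.imp fun _ h => h.1) (gap t * c)
      have hF := G.frame T hT
      set y := coord (row t) T (gap t * c) with hy
      let c' : Pair n → ℝ := fun e => if e ∈ shortPairs n 2 then 0 else y e / gap t e
      refine ⟨T ∩ relevantPairs n 2, ⟨T, hT.1, rfl⟩, c', fun e => ?_, fun e he => ?_, ?_⟩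
      · simp only [c']
        split_ifs with h
        · exact le_rfl
        · exact div_nonneg (hpos e h) (hgp e).le
      · simp only [c'] at he
        split_ifs at he with h
        · exact absurd rfl he
        · refine ⟨?_, (mem_relevantPairs_iff e).2 h⟩
          by_contra h'
          exact he (by rw [hy, hF.coord_supp _ h', zero_div])
      · refine ((comb_contraction_eq_iff t c' c).2
          ⟨fun e => if e ∈ shortPairs n 2 then -(y e / gap t e) else 0,
            fun e he => if_neg he, ?_⟩).symm
        rw [← hF.comb_coord (gap t * c), ← hy]
        congr 1
        ext e
        have := (hgp e).ne'
        simp only [c', Pi.mul_apply, Pi.sub_apply]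
        split_ifs
        · field_simp
          ring
        · field_simp
          ring

end TwoTri

/-- If, for all strictly increasing parameters along the moment curve in `ℝ⁴`, every
2-triangulation of the `n`-gon indexes linearly independent rows of the bar-and-joint rigidity
matrix, then for all strictly increasing parameters the rows realize the 2-associahedron of the
`n`-gon as a complete simplicial fan. -/
theorem stmt4 (n : ℕ) (hn : 5 ≤ n)
    (H : ∀ t : Fin n → ℝ, StrictMono t →
      ∀ T : Set (Pair n), IsTriangulation n 2 T →
        LinearIndependent ℝ (fun e : T => bjRow (fun i => momentPoint 4 (t i)) e.val)) :
    ∀ t : Fin n → ℝ, StrictMono t →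
      RealizesFan n 2 (bjRow (fun i => momentPoint 4 (t i))) := by
  exact fun _ ht => TwoTri.realizesFan_bjRow hn H ht
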